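/- Let ρ be a quantum state on a finite-dimensional complex Hilbert space H, let {S_n}_{n≥1} satisfy Assumption 1, and suppose S_1 contains a state whose support contains supp(ρ). Let r satisfy max{0, D_0(ρ‖S_1)} < r < s(ρ‖{S_n}), where D_0(ρ‖S_1) = min_{σ ∈ S_1}(−log Tr[ρ^0 σ]) and s(ρ‖{S_n}) is the Stein exponent. Define ψ_{r,ρ}(α,σ) = ((α−1)/α)(r − D_α(ρ‖σ)) for α ∈ (0,1], σ ∈ S_1, and let (α₀,σ₀) be a saddle point of ψ_{r,ρ}, i.e. sup_{α ∈ (0,1]} ψ_{r,ρ}(α,σ₀) = ψ_{r,ρ}(α₀,σ₀) = inf_{σ ∈ S_1} ψ_{r,ρ}(α₀,σ). Then the Hoeffding exponent satisfies d_r(ρ‖{S_n}) = ((α₀−1)/α₀)(r − D_{α₀}(ρ‖σ₀)) if and only if sup_{t ∈ ℝ, τ ∈ S_1} Tr[ρ^{α₀} σ₀^{−(α₀+it)/2} τ σ₀^{−(α₀−it)/2}] = Tr[ρ^{α₀} σ₀^{1−α₀}]. -/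

import Mathlib

open scoped BigOperators ComplexOrder Classical
open MeasureTheory Filter Set

noncomputable section

namespace QHT

variable {ι : Type*} [Fintype ι] [DecidableEq ι]

/-- Generalized matrix power `A ^ w` (complex exponent `w`) of a Hermitian matrix,
via functional calculus on the support: the eigenvalue `0` is mapped to `0`. -/
def mpow (A : Matrix ι ι ℂ) (w : ℂ) : Matrix ι ι ℂ :=
  if hA : A.IsHermitian then
    (hA.eigenvectorUnitary : Matrix ι ι ℂ) *
      Matrix.diagonal (fun i => if hA.eigenvalues i = 0 then 0 else (hA.eigenvalues i : ℂ) ^ w) *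
      star (hA.eigenvectorUnitary : Matrix ι ι ℂ)
  else 0

/-- Matrix logarithm of a Hermitian matrix, taken on its support
(`Real.log 0 = 0`, so the kernel is mapped to `0`). -/
def mlog (A : Matrix ι ι ℂ) : Matrix ι ι ℂ :=
  if hA : A.IsHermitian then
    (hA.eigenvectorUnitary : Matrix ι ι ℂ) *
      Matrix.diagonal (fun i => (Real.log (hA.eigenvalues i) : ℂ)) *
      star (hA.eigenvectorUnitary : Matrix ι ι ℂ)
  else 0

/-- The support of a matrix, i.e. its range as a linear map. -/
def msupp (A : Matrix ι ι ℂ) : Submodule ℂ (ι → ℂ) := LinearMap.range A.mulVecLin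

/-- A quantum state: a positive semidefinite matrix of trace one. -/
def IsState (A : Matrix ι ι ℂ) : Prop := A.PosSemidef ∧ A.trace = 1

/-- Real part of the trace. -/
def rtr (A : Matrix ι ι ℂ) : ℝ := A.trace.re

/-- The Umegaki relative entropy `D(ρ‖σ)`, with value `+∞` when `supp ρ ⊄ supp σ`. -/
def relEnt (ρ σ : Matrix ι ι ℂ) : EReal :=
  if msupp ρ ≤ msupp σ then ((rtr (ρ * (mlog ρ - mlog σ)) : ℝ) : EReal) else ⊤

/-- The polar of a set of matrices (intersected with the PSD cone). -/
def polar (S : Set (Matrix ι ι ℂ)) : Set (Matrix ι ι ℂ) :=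
  {X | X.PosSemidef ∧ ∀ Y ∈ S, rtr (X * Y) ≤ 1}

/-- Entrywise Bochner integral of a matrix-valued function over `ℝ`. -/
def mInt (f : ℝ → Matrix ι ι ℂ) : Matrix ι ι ℂ :=
  Matrix.of fun i j => ∫ t : ℝ, f t i j

/-- Entrywise Bochner integral of a matrix-valued function over a set `s ⊆ ℝ`. -/
def mIntOn (f : ℝ → Matrix ι ι ℂ) (s : Set ℝ) : Matrix ι ι ℂ :=
  Matrix.of fun i j => ∫ t in s, f t i j

/-- `sinc` function. -/
def sinc (s : ℝ) : ℝ := if s = 0 then 1 else Real.sin s / s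

/-- The probability density `β_θ` from the paper (`β₀` is the `θ → 0` limit). -/
def betaDist (θ t : ℝ) : ℝ :=
  if θ = 0 then Real.pi / (2 * (Real.cosh (Real.pi * t) + 1))
  else Real.sin (θ * Real.pi) / (2 * θ * (Real.cosh (Real.pi * t) + Real.cos (θ * Real.pi)))

/-- `Q_{α,z}(ρ‖σ) = Tr[(ρ^{α/2z} σ^{(1-α)/z} ρ^{α/2z})^z]`. -/
def Qaz (α z : ℝ) (ρ σ : Matrix ι ι ℂ) : ℝ :=
  rtr (mpow (mpow ρ ((α / (2 * z) : ℝ) : ℂ) * mpow σ (((1 - α) / z : ℝ) : ℂ) *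
      mpow ρ ((α / (2 * z) : ℝ) : ℂ)) ((z : ℝ) : ℂ))

/-- The `α`-`z` Rényi relative entropy. -/
def Daz (α z : ℝ) (ρ σ : Matrix ι ι ℂ) : EReal :=
  if (α < 1 ∧ (ρ * σ).trace ≠ 0) ∨ msupp ρ ≤ msupp σ then
    (((α - 1)⁻¹ * Real.log (Qaz α z ρ σ) : ℝ) : EReal)
  else ⊤

/-- `Q_α(ρ‖σ) = Tr[ρ^α σ^{1-α}]` (Petz). -/
def Qpetz (α : ℝ) (ρ σ : Matrix ι ι ℂ) : ℝ :=
  rtr (mpow ρ ((α : ℝ) : ℂ) * mpow σ (((1 - α) : ℝ) : ℂ))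

/-- The Petz Rényi divergence. -/
def Dpetz (α : ℝ) (ρ σ : Matrix ι ι ℂ) : EReal :=
  if (α < 1 ∧ (ρ * σ).trace ≠ 0) ∨ msupp ρ ≤ msupp σ then
    (((α - 1)⁻¹ * Real.log (Qpetz α ρ σ) : ℝ) : EReal)
  else ⊤

/-- `Q̃_α(ρ‖σ) = Tr[(σ^{(1-α)/2α} ρ σ^{(1-α)/2α})^α]` (sandwiched). -/
def Qsand (α : ℝ) (ρ σ : Matrix ι ι ℂ) : ℝ :=
  rtr (mpow (mpow σ (((1 - α) / (2 * α) : ℝ) : ℂ) * ρ * mpow σ (((1 - α) / (2 * α) : ℝ) : ℂ))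
    ((α : ℝ) : ℂ))

/-- The sandwiched Rényi divergence. -/
def Dsand (α : ℝ) (ρ σ : Matrix ι ι ℂ) : EReal :=
  if (α < 1 ∧ (ρ * σ).trace ≠ 0) ∨ msupp ρ ≤ msupp σ then
    (((α - 1)⁻¹ * Real.log (Qsand α ρ σ) : ℝ) : EReal)
  else ⊤

/-- `D̃_∞(ρ‖σ)`: the limit of `D̃_α(ρ‖σ)` as `α → +∞` (encoded as a `limsup`; the limit
exists by monotonicity in `α`). -/
def DsandInf (ρ σ : Matrix ι ι ℂ) : EReal :=
  Filter.limsup (fun α : ℝ => Dsand α ρ σ) Filter.atTop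

/-- `χ_{α,z}(ρ,σ) = ρ^{α/2z} (ρ^{α/2z} σ^{(1-α)/z} ρ^{α/2z})^{z-1} ρ^{α/2z}`. -/
def chi (α z : ℝ) (ρ σ : Matrix ι ι ℂ) : Matrix ι ι ℂ :=
  mpow ρ ((α / (2 * z) : ℝ) : ℂ) *
    mpow (mpow ρ ((α / (2 * z) : ℝ) : ℂ) * mpow σ (((1 - α) / z : ℝ) : ℂ) *
      mpow ρ ((α / (2 * z) : ℝ) : ℂ)) (((z - 1 : ℝ)) : ℂ) *
    mpow ρ ((α / (2 * z) : ℝ) : ℂ)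

/-- The data-processing region `𝒟` for `α`-`z` Rényi relative entropies. -/
def Dregion : Set (ℝ × ℝ) :=
  {p | (0 < p.1 ∧ p.1 < 1 ∧ max p.1 (1 - p.1) ≤ p.2) ∨
       (1 < p.1 ∧ max (p.1 / 2) (p.1 - 1) ≤ p.2 ∧ p.2 ≤ p.1) ∨
       (p.1 = 1 ∧ 0 < p.2)}

end QHT

namespace QHT

variable {ι : Type*} [Fintype ι] [DecidableEq ι]

/-! ### Tensor products and many copies -/

/-- Tensor product of a `d₁`- and a `d₂`-dimensional operator, as a `d₁d₂`-dimensional one. -/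
def dtens {a b : ℕ} (A : Matrix (Fin a) (Fin a) ℂ) (B : Matrix (Fin b) (Fin b) ℂ) :
    Matrix (Fin (a * b)) (Fin (a * b)) ℂ :=
  Matrix.of fun x y =>
    A (finProdFinEquiv.symm x).1 (finProdFinEquiv.symm y).1 *
      B (finProdFinEquiv.symm x).2 (finProdFinEquiv.symm y).2

/-- `ρ^{⊗n}` of a `d`-dimensional operator, as a `d^n`-dimensional operator. -/
def dpow {d : ℕ} (ρ : Matrix (Fin d) (Fin d) ℂ) (n : ℕ) :
    Matrix (Fin (d ^ n)) (Fin (d ^ n)) ℂ :=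
  Matrix.of fun x y => ∏ i, ρ (finFunctionFinEquiv.symm x i) (finFunctionFinEquiv.symm y i)

/-- The action of a permutation of the `k` tensor factors on an operator on `(ℂ^d)^{⊗k}`. -/
def permMat (d k : ℕ) (π : Equiv.Perm (Fin k)) (A : Matrix (Fin (d ^ k)) (Fin (d ^ k)) ℂ) :
    Matrix (Fin (d ^ k)) (Fin (d ^ k)) ℂ :=
  Matrix.of fun x y =>
    A (finFunctionFinEquiv ((finFunctionFinEquiv.symm x) ∘ π))
      (finFunctionFinEquiv ((finFunctionFinEquiv.symm y) ∘ π))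

/-- `ρ^{⊗n}` of a `d`-dimensional operator, as an operator on `H^{⊗n}` with `H = ℂ^d`,
indexed by tuples. -/
def tpow {d : ℕ} (ρ : Matrix (Fin d) (Fin d) ℂ) (n : ℕ) :
    Matrix (Fin n → Fin d) (Fin n → Fin d) ℂ :=
  Matrix.of fun x y => ∏ i, ρ (x i) (y i)

/-- Tensor product of an operator on `H^{⊗m}` and an operator on `H^{⊗n}`, as an
operator on `H^{⊗(m+n)}`. -/
def tensOp {d m n : ℕ} (A : Matrix (Fin m → Fin d) (Fin m → Fin d) ℂ)
    (B : Matrix (Fin n → Fin d) (Fin n → Fin d) ℂ) :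
    Matrix (Fin (m + n) → Fin d) (Fin (m + n) → Fin d) ℂ :=
  Matrix.of fun x y =>
    A (fun i => x (Fin.castAdd n i)) (fun i => y (Fin.castAdd n i)) *
      B (fun j => x (Fin.natAdd m j)) (fun j => y (Fin.natAdd m j))

/-- Permutation action on operators on `H^{⊗k}`. -/
def permOp {d k : ℕ} (π : Equiv.Perm (Fin k))
    (A : Matrix (Fin k → Fin d) (Fin k → Fin d) ℂ) :
    Matrix (Fin k → Fin d) (Fin k → Fin d) ℂ :=
  Matrix.of fun x y => A (x ∘ π) (y ∘ π)

/-! ### Hypothesis testing -/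

/-- A test: an operator `T` with `0 ≤ T ≤ I`. -/
def IsTest (T : Matrix ι ι ℂ) : Prop := T.PosSemidef ∧ (1 - T).PosSemidef

/-- Type I error `α_n(ρ|T) = Tr[(I - T) ρ^{⊗n}]`. -/
def typeI {d : ℕ} (ρ : Matrix (Fin d) (Fin d) ℂ) (n : ℕ)
    (T : Matrix (Fin n → Fin d) (Fin n → Fin d) ℂ) : ℝ :=
  rtr ((1 - T) * tpow ρ n)

/-- Type II error `β_n(S|T) = sup_{σ ∈ S} Tr[σ T]`. -/
def typeII {d n : ℕ} (S : Set (Matrix (Fin n → Fin d) (Fin n → Fin d) ℂ))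
    (T : Matrix (Fin n → Fin d) (Fin n → Fin d) ℂ) : ℝ :=
  sSup ((fun σ => rtr (σ * T)) '' S)

/-- `- log x`, valued in `EReal`, with `- log x = +∞` for `x ≤ 0`. -/
def negLog (x : ℝ) : EReal := if x ≤ 0 then ⊤ else ((- Real.log x : ℝ) : EReal)

/-- The exponential rate `-(1/n) log x`. -/
def rate (n : ℕ) (x : ℝ) : EReal := (((n : ℝ)⁻¹ : ℝ) : EReal) * negLog x

/-- The Stein exponent `s(ρ‖{S_n})`. -/
def steinExp {d : ℕ} (ρ : Matrix (Fin d) (Fin d) ℂ)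
    (S : (n : ℕ) → Set (Matrix (Fin n → Fin d) (Fin n → Fin d) ℂ)) : EReal :=
  sSup ((fun r : ℝ => (r : EReal)) ''
    {r : ℝ | 0 ≤ r ∧ ∃ T : (n : ℕ) → Matrix (Fin n → Fin d) (Fin n → Fin d) ℂ,
      (∀ n, IsTest (T n)) ∧
      (r : EReal) ≤ Filter.liminf (fun n => rate n (typeII (S n) (T n))) Filter.atTop ∧
      Filter.Tendsto (fun n => typeI ρ n (T n)) Filter.atTop (nhds 0)})

/-- The Chernoff exponent `c(ρ‖{S_n})`. -/
def chernoffExp {d : ℕ} (ρ : Matrix (Fin d) (Fin d) ℂ)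
    (S : (n : ℕ) → Set (Matrix (Fin n → Fin d) (Fin n → Fin d) ℂ)) : EReal :=
  Filter.liminf (fun n =>
    rate n (sInf ((fun T => typeI ρ n T + typeII (S n) T) '' {T | IsTest T}))) Filter.atTop

/-- The Hoeffding (direct) exponent `d_r(ρ‖{S_n})`. -/
def hoeffdingExp {d : ℕ} (r : ℝ) (ρ : Matrix (Fin d) (Fin d) ℂ)
    (S : (n : ℕ) → Set (Matrix (Fin n → Fin d) (Fin n → Fin d) ℂ)) : EReal :=
  ⨆ T : {T : (n : ℕ) → Matrix (Fin n → Fin d) (Fin n → Fin d) ℂ //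
      (∀ n, IsTest (T n)) ∧
      (r : EReal) ≤ Filter.liminf (fun n => rate n (typeII (S n) (T n))) Filter.atTop},
    Filter.liminf (fun n => rate n (typeI ρ n (T.1 n))) Filter.atTop

/-- The strong converse exponent `sc_r(ρ‖{S_n})`. -/
def scExp {d : ℕ} (r : ℝ) (ρ : Matrix (Fin d) (Fin d) ℂ)
    (S : (n : ℕ) → Set (Matrix (Fin n → Fin d) (Fin n → Fin d) ℂ)) : EReal :=
  ⨅ T : {T : (n : ℕ) → Matrix (Fin n → Fin d) (Fin n → Fin d) ℂ //
      (∀ n, IsTest (T n)) ∧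
      (r : EReal) ≤ Filter.liminf (fun n => rate n (typeII (S n) (T n))) Filter.atTop},
    Filter.limsup (fun n => rate n (1 - typeI ρ n (T.1 n))) Filter.atTop

/-- Assumption 1 of the paper for a family `{S_n}_{n ≥ 1}` of sets of operators
on `H^{⊗n}`, `H = ℂ^d`: each `S_n` is a convex compact set of positive semidefinite
operators, closed under tensor products, and with polar sets closed under tensor
products. -/
structure Assumption1 {d : ℕ}
    (S : (n : ℕ) → Set (Matrix (Fin n → Fin d) (Fin n → Fin d) ℂ)) : Prop where
  psd : ∀ n, 1 ≤ n → ∀ X ∈ S n, X.PosSemidef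
  convex : ∀ n, 1 ≤ n → Convex ℝ (S n)
  compact : ∀ n, 1 ≤ n → IsCompact (S n)
  tens : ∀ m n, 1 ≤ m → 1 ≤ n → ∀ A ∈ S m, ∀ B ∈ S n, tensOp A B ∈ S (m + n)
  polarTens : ∀ m n, 1 ≤ m → 1 ≤ n →
    ∀ A ∈ polar (S m), ∀ B ∈ polar (S n), tensOp A B ∈ polar (S (m + n))

/-- Assumption 1′ of the paper for a dimension-indexed family `{S_d}_{d ≥ 1}`. -/
structure Assumption1' (S : (d : ℕ) → Set (Matrix (Fin d) (Fin d) ℂ)) : Prop where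
  psd : ∀ d, 1 ≤ d → ∀ X ∈ S d, X.PosSemidef
  convex : ∀ d, 1 ≤ d → Convex ℝ (S d)
  compact : ∀ d, 1 ≤ d → IsCompact (S d)
  tens : ∀ d₁ d₂, 1 ≤ d₁ → 1 ≤ d₂ → ∀ A ∈ S d₁, ∀ B ∈ S d₂, dtens A B ∈ S (d₁ * d₂)
  polarTens : ∀ d₁ d₂, 1 ≤ d₁ → 1 ≤ d₂ →
    ∀ A ∈ polar (S d₁), ∀ B ∈ polar (S d₂), dtens A B ∈ polar (S (d₁ * d₂))

end QHT

namespace QHT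

/-- The reliability function `ψ_{r,ρ}(α,σ) = ((α-1)/α)(r - D_α(ρ‖σ))` of the Hoeffding
exponent. -/
noncomputable def psiHoeffding {ι : Type*} [Fintype ι] [DecidableEq ι]
    (r : ℝ) (ρ σ : Matrix ι ι ℂ) (α : ℝ) : EReal :=
  (((α - 1) / α : ℝ) : EReal) * ((r : EReal) - Dpetz α ρ σ)

theorem image_div_one_sub_Ioo : (fun u : ℝ => u / (1 - u)) '' Ioo 0 1 = Ioi 0 := by
  ext x
  simp only [mem_image, mem_Ioo, mem_Ioi]
  constructor
  · rintro ⟨u, ⟨h0, h1⟩, rfl⟩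
    exact div_pos h0 (by linarith)
  · intro hx
    refine ⟨x / (1 + x), ⟨by positivity, ?_⟩, ?_⟩
    · rw [div_lt_one (by positivity)]; linarith
    · field_simp
      ring

theorem abs_deriv_smul_cpow_div_one_add {s : ℂ} {u : ℝ} (hu : u ∈ Ioo (0 : ℝ) 1) :
    |1 / (1 - u) ^ 2| • ((↑(u / (1 - u)) : ℂ) ^ (s - 1) * (1 + (↑(u / (1 - u)) : ℂ))⁻¹) =
      (u : ℂ) ^ (s - 1) * (1 - (u : ℂ)) ^ ((1 - s) - 1) := by
  have h1 : 0 < 1 - u := by linarith [hu.2]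
  have h1' : ((1 - u : ℝ) : ℂ) ≠ 0 := by exact_mod_cast h1.ne'
  have h2 : (1 - (u : ℂ)) = ((1 - u : ℝ) : ℂ) := by push_cast; ring
  have h2' : (1 - (u : ℂ)) ≠ 0 := by rw [h2]; exact h1'
  have h3 : (1 + (↑(u / (1 - u)) : ℂ))⁻¹ = ((1 - u : ℝ) : ℂ) := by
    push_cast
    field_simp
    ring
  have h4 : (((u / (1 - u) : ℝ)) : ℂ) ^ (s - 1) = (u : ℂ) ^ (s - 1) * (((1 - u : ℝ) : ℂ)) ^ (1 - s) := by
    rw [div_eq_mul_inv]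
    rw [Complex.ofReal_mul,
      Complex.mul_cpow_ofReal_nonneg hu.1.le (inv_nonneg.2 h1.le), Complex.ofReal_inv,
      Complex.inv_cpow _ _ (by
        rw [Complex.arg_ofReal_of_nonneg h1.le]; exact Real.pi_pos.ne), ← Complex.cpow_neg, neg_sub]
  rw [h3, h4, abs_of_pos (by positivity), h2,
    Complex.cpow_sub (1 - s) 1 h1', Complex.cpow_one, Complex.real_smul, Complex.ofReal_div,
    Complex.ofReal_pow, Complex.ofReal_one]
  field_simp

theorem hasDerivWithinAt_div_one_sub {u : ℝ} (hu : u ∈ Ioo (0 : ℝ) 1) :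
    HasDerivWithinAt (fun u : ℝ => u / (1 - u)) (1 / (1 - u) ^ 2) (Ioo 0 1) u := by
  have h1 : 1 - u ≠ 0 := by linarith [hu.2]
  have := ((hasDerivAt_id u).div ((hasDerivAt_const u (1 : ℝ)).sub (hasDerivAt_id u)) h1)
  refine (this.congr_deriv ?_).hasDerivWithinAt
  simp

theorem injOn_div_one_sub : InjOn (fun u : ℝ => u / (1 - u)) (Ioo 0 1) := by
  intro a ha b hb h
  have h1 : 1 - a ≠ 0 := by linarith [ha.2]
  have h2 : 1 - b ≠ 0 := by linarith [hb.2]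
  simp only at h
  rw [div_eq_div_iff h1 h2] at h
  linarith

theorem integrableOn_cpow_mul_inv_one_add {s : ℂ} (h0 : 0 < s.re) (h1 : s.re < 1) :
    IntegrableOn (fun x : ℝ => (x : ℂ) ^ (s - 1) * (1 + (x : ℂ))⁻¹) (Ioi 0) := by
  rw [← image_div_one_sub_Ioo, integrableOn_image_iff_integrableOn_abs_deriv_smul
    measurableSet_Ioo (fun u hu => hasDerivWithinAt_div_one_sub hu) injOn_div_one_sub]
  have := Complex.betaIntegral_convergent h0 (v := 1 - s) (by simpa using h1)
  rw [intervalIntegrable_iff_integrableOn_Ioo_of_le zero_le_one] at this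
  exact this.congr_fun (fun u hu => (abs_deriv_smul_cpow_div_one_add hu).symm) measurableSet_Ioo

theorem integral_cpow_mul_inv_one_add {s : ℂ} (h0 : 0 < s.re) (h1 : s.re < 1) :
    ∫ x : ℝ in Ioi 0, (x : ℂ) ^ (s - 1) * (1 + (x : ℂ))⁻¹ =
      Real.pi / Complex.sin (Real.pi * s) := by
  rw [← image_div_one_sub_Ioo, integral_image_eq_integral_abs_deriv_smul
    measurableSet_Ioo (fun u hu => hasDerivWithinAt_div_one_sub hu) injOn_div_one_sub,
    setIntegral_congr_fun measurableSet_Ioo (fun u hu => abs_deriv_smul_cpow_div_one_add hu),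
    ← integral_Ioc_eq_integral_Ioo, ← intervalIntegral.integral_of_le zero_le_one]
  have := Complex.Gamma_mul_Gamma_eq_betaIntegral h0 (t := 1 - s) (by simpa using h1)
  rw [Complex.Gamma_mul_Gamma_one_sub, add_sub_cancel, Complex.Gamma_one, one_mul] at this
  exact this.symm

/-- The normalisation of the integral representation of `x ↦ x ^ θ`. -/
def rpowConst (θ : ℝ) : ℝ := ∫ l in Ioi (0 : ℝ), l ^ (θ - 1) * (1 + l)⁻¹

theorem integrableOn_rpow_mul_inv_one_add {θ : ℝ} (h0 : 0 < θ) (h1 : θ < 1) :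
    IntegrableOn (fun l : ℝ => l ^ (θ - 1) * (1 + l)⁻¹) (Ioi 0) := by
  have : IntegrableOn (fun x : ℝ => ‖(x : ℂ) ^ ((θ : ℂ) - 1) * (1 + (x : ℂ))⁻¹‖) (Ioi 0) :=
    (integrableOn_cpow_mul_inv_one_add (s := θ) (by simpa) (by simpa)).norm
  refine this.congr_fun (fun x hx => ?_) measurableSet_Ioi
  have hx : 0 < x := hx
  simp only [norm_mul, norm_inv]
  rw [Complex.norm_cpow_eq_rpow_re_of_pos hx]
  have : ‖(1 : ℂ) + x‖ = 1 + x := by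
    rw [show (1 : ℂ) + x = ((1 + x : ℝ) : ℂ) by push_cast; rfl, Complex.norm_real,
      Real.norm_of_nonneg (by positivity)]
  rw [this]
  simp

theorem rpowConst_pos {θ : ℝ} (h0 : 0 < θ) (h1 : θ < 1) : 0 < rpowConst θ := by
  unfold rpowConst
  rw [setIntegral_pos_iff_support_of_nonneg_ae]
  · have : (Function.support fun l : ℝ => l ^ (θ - 1) * (1 + l)⁻¹) ∩ Ioi 0 = Ioi 0 := by
      ext x
      simp only [mem_inter_iff, Function.mem_support, mem_Ioi, and_iff_right_iff_imp]
      intro hx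
      positivity
    rw [this]; simp
  · filter_upwards [ae_restrict_mem measurableSet_Ioi] with x hx
    have : 0 < x := hx
    simp only [Pi.zero_apply]
    positivity
  · exact integrableOn_rpow_mul_inv_one_add h0 h1

theorem integrableOn_rpow_mul_div_add {θ : ℝ} (h0 : 0 < θ) (h1 : θ < 1) {x : ℝ} (hx : 0 ≤ x) :
    IntegrableOn (fun l : ℝ => l ^ (θ - 1) * (x / (x + l))) (Ioi 0) := by
  rcases hx.eq_or_lt with rfl | hx
  · simp
  have := (integrableOn_rpow_mul_inv_one_add h0 h1)
  have h2 := (integrableOn_Ioi_comp_mul_left_iff (fun l : ℝ => l ^ (θ - 1) * (1 + l)⁻¹) 0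
    (inv_pos.2 hx)).2 (by simpa using this)
  have h3 : IntegrableOn (fun l : ℝ => x ^ (θ - 1) * ((x⁻¹ * l) ^ (θ - 1) * (1 + x⁻¹ * l)⁻¹))
      (Ioi 0) := h2.const_mul (x ^ (θ - 1))
  refine h3.congr_fun (fun l hl => ?_) measurableSet_Ioi
  have hl : 0 < l := hl
  simp only
  rw [Real.mul_rpow (inv_nonneg.2 hx.le) hl.le, Real.inv_rpow hx.le]
  have : x ^ (θ - 1) ≠ 0 := (Real.rpow_pos_of_pos hx _).ne'
  field_simp

theorem integral_rpow_mul_div_add {θ : ℝ} {x : ℝ} (hx : 0 ≤ x) :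
    ∫ l in Ioi (0 : ℝ), l ^ (θ - 1) * (x / (x + l)) =
      rpowConst θ * (if x = 0 then 0 else x ^ θ) := by
  rcases hx.eq_or_lt with rfl | hx
  · simp
  have h2 := integral_comp_mul_left_Ioi (fun l : ℝ => l ^ (θ - 1) * (1 + l)⁻¹) 0
    (inv_pos.2 hx)
  rw [mul_zero, inv_inv, smul_eq_mul] at h2
  have h3 : ∫ l in Ioi (0 : ℝ), l ^ (θ - 1) * (x / (x + l)) =
      x ^ (θ - 1) * ∫ l in Ioi (0 : ℝ), (x⁻¹ * l) ^ (θ - 1) * (1 + x⁻¹ * l)⁻¹ := by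
    rw [← integral_const_mul]
    refine setIntegral_congr_fun measurableSet_Ioi (fun l hl => ?_)
    have hl : 0 < l := hl
    rw [Real.mul_rpow (inv_nonneg.2 hx.le) hl.le, Real.inv_rpow hx.le]
    have : x ^ (θ - 1) ≠ 0 := (Real.rpow_pos_of_pos hx _).ne'
    field_simp
  rw [h3, h2, if_neg hx.ne', rpowConst, Real.rpow_sub_one hx.ne']
  field_simp

/-- The density appearing in the Fourier representation of the first divided difference of
`x ↦ x ^ (1 - α)`. -/
def divDiffKernel (α w : ℝ) : ℝ :=
  Real.pi / 2 / (Real.sin (Real.pi * (α / 2)) ^ 2 + Real.sinh (Real.pi * w) ^ 2)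

theorem sin_sq_add_sinh_sq_pos {α : ℝ} (h0 : 0 < α) (h1 : α < 1) (w : ℝ) :
    0 < Real.sin (Real.pi * (α / 2)) ^ 2 + Real.sinh (Real.pi * w) ^ 2 := by
  have : 0 < Real.sin (Real.pi * (α / 2)) :=
    Real.sin_pos_of_pos_of_lt_pi (by positivity) (by nlinarith [Real.pi_pos])
  positivity

theorem divDiffKernel_pos {α : ℝ} (h0 : 0 < α) (h1 : α < 1) (w : ℝ) : 0 < divDiffKernel α w :=
  div_pos (by positivity) (sin_sq_add_sinh_sq_pos h0 h1 w)

theorem continuous_divDiffKernel {α : ℝ} (h0 : 0 < α) (h1 : α < 1) :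
    Continuous (divDiffKernel α) := by
  unfold divDiffKernel
  refine Continuous.div continuous_const (by fun_prop) (fun w => (sin_sq_add_sinh_sq_pos h0 h1 w).ne')

theorem normSq_sin (a b : ℝ) :
    Complex.normSq (Complex.sin (a + b * Complex.I)) = Real.sin a ^ 2 + Real.sinh b ^ 2 := by
  rw [Complex.sin_add_mul_I, ← Complex.ofReal_sin, ← Complex.ofReal_cosh, ← Complex.ofReal_cos,
    ← Complex.ofReal_sinh, ← Complex.ofReal_mul, ← Complex.ofReal_mul, Complex.normSq_add_mul_I,
    mul_pow, mul_pow, Real.cosh_sq, Real.cos_sq']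
  ring

theorem one_add_sq_div_four_le_cosh (x : ℝ) : 1 + x ^ 2 / 4 ≤ Real.cosh x := by
  rw [← Real.cosh_abs, ← sq_abs, Real.cosh_eq]
  have h1 := Real.quadratic_le_exp_of_nonneg (abs_nonneg x)
  have h2 := Real.add_one_le_exp (-|x|)
  linarith

theorem norm_inv_sin_le {α : ℝ} (h0 : 0 < α) (h1 : α < 1) (w : ℝ) :
    ‖(Complex.sin (Real.pi * (((α / 2 : ℝ) : ℂ) + w * Complex.I)))⁻¹‖ ≤
      (Real.sin (Real.pi * (α / 2)))⁻¹ * (1 + w ^ 2)⁻¹ := by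
  have hs : 0 < Real.sin (Real.pi * (α / 2)) :=
    Real.sin_pos_of_pos_of_lt_pi (by positivity) (by nlinarith [Real.pi_pos])
  rw [norm_inv, ← mul_inv]
  refine inv_anti₀ (by positivity) ?_
  rw [← abs_of_nonneg (norm_nonneg (Complex.sin _))]
  refine abs_le_of_sq_le_sq' ?_ (abs_nonneg _) |>.2
  rw [sq_abs, Complex.sq_norm, mul_add (Real.pi : ℂ), ← mul_assoc (Real.pi : ℂ),
    ← Complex.ofReal_mul, ← Complex.ofReal_mul, normSq_sin]
  have h2 : 1 + w ^ 2 ≤ Real.cosh (Real.pi * w) := by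
    refine le_trans ?_ (one_add_sq_div_four_le_cosh (Real.pi * w))
    have : (2 * w) ^ 2 ≤ (Real.pi * w) ^ 2 := by
      rw [mul_pow, mul_pow]
      gcongr
      exact Real.two_le_pi
    linarith
  have h3 : (1 + w ^ 2) ^ 2 ≤ Real.cosh (Real.pi * w) ^ 2 := by gcongr
  rw [Real.cosh_sq] at h3
  have h4 : Real.sin (Real.pi * (α / 2)) ^ 2 ≤ 1 := Real.sin_sq_le_one _
  nlinarith [sq_nonneg (Real.sinh (Real.pi * w)), sq_nonneg (Real.sin (Real.pi * (α / 2)))]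

theorem integrable_inv_sin {α : ℝ} (h0 : 0 < α) (h1 : α < 1) :
    Integrable (fun w : ℝ =>
      (Complex.sin (Real.pi * (((α / 2 : ℝ) : ℂ) + w * Complex.I)))⁻¹) := by
  refine Integrable.mono' (integrable_inv_one_add_sq.const_mul
    (Real.sin (Real.pi * (α / 2)))⁻¹) ?_ (ae_of_all _ (fun w => norm_inv_sin_le h0 h1 w))
  refine (Measurable.inv ?_).aestronglyMeasurable
  exact (by fun_prop : Continuous fun w : ℝ =>
    Complex.sin (Real.pi * (((α / 2 : ℝ) : ℂ) + w * Complex.I))).measurable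

theorem inv_sin_mul_inv_sin (α w : ℝ) :
    (1 / (2 * Real.pi) : ℂ) * (Real.pi / Complex.sin (Real.pi * (((α / 2 : ℝ) : ℂ) + w * Complex.I))) *
      (Real.pi / Complex.sin (Real.pi * (((1 - α / 2 : ℝ) : ℂ) + w * Complex.I))) =
      divDiffKernel α w := by
  have e1 : Complex.sin (Real.pi * (((1 - α / 2 : ℝ) : ℂ) + w * Complex.I)) =
      (starRingEnd ℂ) (Complex.sin (Real.pi * (((α / 2 : ℝ) : ℂ) + w * Complex.I))) := by
    rw [← Complex.sin_conj]
    simp only [map_mul, map_add, Complex.conj_ofReal, Complex.conj_I]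
    rw [← Complex.sin_pi_sub]
    congr 1
    push_cast
    ring
  have e2 : ((Real.sin (Real.pi * (α / 2)) ^ 2 + Real.sinh (Real.pi * w) ^ 2 : ℝ) : ℂ) =
      Complex.sin (Real.pi * (((α / 2 : ℝ) : ℂ) + w * Complex.I)) *
      (starRingEnd ℂ) (Complex.sin (Real.pi * (((α / 2 : ℝ) : ℂ) + w * Complex.I))) := by
    rw [Complex.mul_conj, ← normSq_sin]
    congr 3
    push_cast
    ring
  rw [e1, divDiffKernel, Complex.ofReal_div (Real.pi / 2), e2]
  have : (Real.pi : ℂ) ≠ 0 := by exact_mod_cast Real.pi_ne_zero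
  generalize Complex.sin (Real.pi * (((α / 2 : ℝ) : ℂ) + w * Complex.I)) = z
  push_cast
  field_simp

theorem integrable_divDiffKernel {α : ℝ} (h0 : 0 < α) (h1 : α < 1) :
    Integrable (divDiffKernel α) := by
  have hs : 0 < Real.sin (Real.pi * (α / 2)) :=
    Real.sin_pos_of_pos_of_lt_pi (by positivity) (by nlinarith [Real.pi_pos])
  refine Integrable.mono' (integrable_inv_one_add_sq.const_mul
    (Real.pi / 2 * (Real.sin (Real.pi * (α / 2)))⁻¹ ^ 2))
    (continuous_divDiffKernel h0 h1).aestronglyMeasurable (ae_of_all _ (fun w => ?_))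
  have h := norm_inv_sin_le h0 h1 w
  have h2 : ‖(Complex.sin (Real.pi * (((α / 2 : ℝ) : ℂ) + w * Complex.I)))⁻¹‖ ^ 2 =
      (Real.sin (Real.pi * (α / 2)) ^ 2 + Real.sinh (Real.pi * w) ^ 2)⁻¹ := by
    rw [norm_inv, inv_pow, Complex.sq_norm, mul_add, ← Complex.ofReal_mul, ← mul_assoc,
      ← Complex.ofReal_mul, normSq_sin]
  rw [Real.norm_of_nonneg (divDiffKernel_pos h0 h1 w).le, divDiffKernel, div_eq_mul_inv, ← h2]
  have h3 : (1 + w ^ 2)⁻¹ ≤ 1 := inv_le_one_of_one_le₀ (by nlinarith [sq_nonneg w])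
  have h4 : 0 ≤ (1 + w ^ 2)⁻¹ := by positivity
  have h5 := pow_le_pow_left₀ (norm_nonneg _) h 2
  rw [mul_pow] at h5
  rw [mul_assoc]
  gcongr
  refine h5.trans ?_
  gcongr
  nlinarith

theorem inv_one_add_eq_integral {α : ℝ} (h0 : 0 < α) (h1 : α < 1) {x : ℝ} (hx : 0 < x) :
    ((1 + x : ℝ) : ℂ)⁻¹ = ∫ w : ℝ, (1 / (2 * Real.pi) : ℂ) *
      ((x : ℂ) ^ (-(((α / 2 : ℝ) : ℂ) + w * Complex.I)) *
        (Real.pi / Complex.sin (Real.pi * (((α / 2 : ℝ) : ℂ) + w * Complex.I)))) := by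
  have hm : ∀ s : ℂ, 0 < s.re → s.re < 1 → mellin (fun x : ℝ => (1 + (x : ℂ))⁻¹) s =
      Real.pi / Complex.sin (Real.pi * s) := fun s h0 h1 => by
    rw [← integral_cpow_mul_inv_one_add h0 h1, mellin]
    rfl
  have hm' : ∀ w : ℝ, mellin (fun x : ℝ => (1 + (x : ℂ))⁻¹) (((α / 2 : ℝ) : ℂ) + w * Complex.I) =
      Real.pi / Complex.sin (Real.pi * (((α / 2 : ℝ) : ℂ) + w * Complex.I)) := fun w => by
    apply hm
    · simp; linarith
    · simp; linarith
  have := mellinInv_mellin_eq (α / 2) (fun x : ℝ => (1 + (x : ℂ))⁻¹) hx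
    (integrableOn_cpow_mul_inv_one_add (by simp; linarith) (by simp; linarith)) (by
      unfold Complex.VerticalIntegrable
      simp_rw [hm', div_eq_mul_inv]
      exact (integrable_inv_sin h0 h1).const_mul _) (by
      have : (1 : ℂ) + (x : ℂ) ≠ 0 := by
        rw [show (1 : ℂ) + x = ((1 + x : ℝ) : ℂ) by push_cast; rfl]
        exact_mod_cast (by positivity : (1 + x : ℝ) ≠ 0)
      exact ContinuousAt.inv₀ (by fun_prop) this)
  rw [Complex.ofReal_add, Complex.ofReal_one, ← this, mellinInv, integral_const_mul]
  simp_rw [hm', smul_eq_mul, Complex.real_smul]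
  push_cast
  rfl

theorem norm_ofReal_cpow {x : ℝ} (hx : 0 < x) (a w : ℝ) :
    ‖(x : ℂ) ^ (-((a : ℂ) + w * Complex.I))‖ = x ^ (-a) := by
  rw [Complex.norm_cpow_eq_rpow_re_of_pos hx]
  simp

theorem integral_rpow_div_mul_eq {α : ℝ} (h0 : 0 < α) (h1 : α < 1) {z : ℝ} (hz : 0 < z) :
    ((∫ v in Ioi (0 : ℝ), v ^ (1 - α) / ((z + v) * (1 + v)) : ℝ) : ℂ) =
      ∫ w : ℝ, (divDiffKernel α w : ℂ) * (z : ℂ) ^ (-(((α / 2 : ℝ) : ℂ) + w * Complex.I)) := by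
  set F : ℝ → ℝ → ℂ := fun v w => ((v ^ (-α) * (1 + v)⁻¹ : ℝ) : ℂ) * ((1 / (2 * Real.pi) : ℂ) *
      (((z / v : ℝ) : ℂ) ^ (-(((α / 2 : ℝ) : ℂ) + w * Complex.I)) *
        (Real.pi / Complex.sin (Real.pi * (((α / 2 : ℝ) : ℂ) + w * Complex.I))))) with hF
  have hFc : ∀ v : ℝ, 0 < v → ∀ w, F v w = (z : ℂ) ^ (-(((α / 2 : ℝ) : ℂ) + w * Complex.I)) *
      ((v : ℂ) ^ ((((1 - α / 2 : ℝ) : ℂ) + w * Complex.I) - 1) * (1 + (v : ℂ))⁻¹) *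
      ((1 / (2 * Real.pi) : ℂ) *
        (Real.pi / Complex.sin (Real.pi * (((α / 2 : ℝ) : ℂ) + w * Complex.I)))) := fun v hv w => by
    have hv' : (v : ℂ) ≠ 0 := by exact_mod_cast hv.ne'
    have e1 : (((1 - α / 2 : ℝ) : ℂ) + w * Complex.I) - 1 =
      ((-α : ℝ) : ℂ) + (((α / 2 : ℝ) : ℂ) + w * Complex.I) := by push_cast; ring
    rw [hF, e1, Complex.cpow_add _ _ hv']
    simp only
    rw [div_eq_mul_inv z v, Complex.ofReal_mul z, Complex.mul_cpow_ofReal_nonneg hz.le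
      (inv_nonneg.2 hv.le), Complex.ofReal_inv, Complex.inv_cpow _ _ (by
        rw [Complex.arg_ofReal_of_nonneg hv.le]; exact Real.pi_pos.ne), Complex.cpow_neg (v : ℂ),
      inv_inv, Complex.ofReal_mul, Complex.ofReal_cpow hv.le, Complex.ofReal_inv, Complex.ofReal_add,
      Complex.ofReal_one]
    ring
  have hint : Integrable (Function.uncurry F) ((volume.restrict (Ioi (0 : ℝ))).prod volume) := by
    have hi : Integrable (fun p : ℝ × ℝ => ((p.1 ^ (-(α / 2)) * (1 + p.1)⁻¹ : ℝ) : ℂ) *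
        (Complex.sin (Real.pi * (((α / 2 : ℝ) : ℂ) + p.2 * Complex.I)))⁻¹)
        ((volume.restrict (Ioi (0 : ℝ))).prod volume) := by
      have h2 : IntegrableOn (fun l : ℝ => l ^ ((1 - α / 2) - 1) * (1 + l)⁻¹) (Ioi 0) :=
        integrableOn_rpow_mul_inv_one_add (by linarith) (by linarith)
      have h3 : Integrable (fun l : ℝ => (((l ^ (-(α / 2)) * (1 + l)⁻¹ : ℝ)) : ℂ))
          (volume.restrict (Ioi (0 : ℝ))) := by
        refine Integrable.ofReal ?_
        rwa [show (1 - α / 2) - 1 = -(α / 2) by ring] at h2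
      exact h3.mul_prod (integrable_inv_sin h0 h1)
    refine Integrable.mono' (hi.norm.const_mul (z ^ (-(α / 2)))) ?_ ?_
    · rw [hF]
      apply Measurable.aestronglyMeasurable
      unfold Function.uncurry
      simp only
      fun_prop
    · have : ∀ᵐ p : ℝ × ℝ ∂((volume.restrict (Ioi (0 : ℝ))).prod volume), p.1 ∈ Ioi (0 : ℝ) :=
        Measure.quasiMeasurePreserving_fst.ae (ae_restrict_mem measurableSet_Ioi)
      filter_upwards [this] with p hp
      have hp : 0 < p.1 := hp
      have h1p : 0 < 1 + p.1 := by linarith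
      rw [Function.uncurry, hFc p.1 hp, norm_mul, norm_mul, norm_ofReal_cpow hz, norm_mul,
        mul_assoc, norm_mul, norm_mul]
      have e2 : ‖(p.1 : ℂ) ^ (((1 - α / 2 : ℝ) : ℂ) + p.2 * Complex.I - 1)‖ = p.1 ^ (-(α / 2)) := by
        rw [Complex.norm_cpow_eq_rpow_re_of_pos hp]
        simp
      have e3 : ‖(1 + (p.1 : ℂ))⁻¹‖ = (1 + p.1)⁻¹ := by
        rw [norm_inv, show (1 : ℂ) + p.1 = ((1 + p.1 : ℝ) : ℂ) by push_cast; rfl,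
          Complex.norm_real, Real.norm_of_nonneg h1p.le]
      have e4 : ‖((p.1 ^ (-(α / 2)) * (1 + p.1)⁻¹ : ℝ) : ℂ)‖ = p.1 ^ (-(α / 2)) * (1 + p.1)⁻¹ := by
        rw [Complex.norm_real, Real.norm_of_nonneg (by positivity)]
      have e5 : ‖(1 / (2 * Real.pi) : ℂ)‖ = 1 / (2 * Real.pi) := by
        rw [show (1 / (2 * Real.pi) : ℂ) = ((1 / (2 * Real.pi) : ℝ) : ℂ) by push_cast; rfl,
          Complex.norm_real, Real.norm_of_nonneg (by positivity)]
      rw [e2, e3, e4, e5, norm_div, Complex.norm_real, Real.norm_of_nonneg Real.pi_pos.le]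
      rw [norm_inv]
      have hx : 0 ≤ ‖Complex.sin (Real.pi * (((α / 2 : ℝ) : ℂ) + p.2 * Complex.I))‖⁻¹ := by
        positivity
      have h5 : (1 / (2 * Real.pi) * (Real.pi / ‖Complex.sin (Real.pi * (((α / 2 : ℝ) : ℂ) + p.2 * Complex.I))‖)) ≤
          ‖Complex.sin (Real.pi * (((α / 2 : ℝ) : ℂ) + p.2 * Complex.I))‖⁻¹ := by
        have : (1 / (2 * Real.pi) * (Real.pi / ‖Complex.sin (Real.pi * (((α / 2 : ℝ) : ℂ) + p.2 * Complex.I))‖)) =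
          (1 / 2) * ‖Complex.sin (Real.pi * (((α / 2 : ℝ) : ℂ) + p.2 * Complex.I))‖⁻¹ := by
          field_simp
        rw [this]
        linarith
      gcongr
  have h2 : ((∫ v in Ioi (0 : ℝ), v ^ (1 - α) / ((z + v) * (1 + v)) : ℝ) : ℂ) =
      ∫ v in Ioi (0 : ℝ), ∫ w : ℝ, F v w := by
    rw [← integral_complex_ofReal]
    refine setIntegral_congr_fun measurableSet_Ioi fun v hv => ?_
    have hv : 0 < v := hv
    simp only [hF]
    rw [integral_const_mul, ← inv_one_add_eq_integral h0 h1 (div_pos hz hv), ← Complex.ofReal_inv,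
      ← Complex.ofReal_mul]
    congr 1
    rw [show 1 - α = -α + 1 by ring, Real.rpow_add_one hv.ne']
    field_simp
    ring
  rw [h2, integral_integral_swap hint]
  refine integral_congr_ae (ae_of_all _ fun w => ?_)
  simp only
  rw [setIntegral_congr_fun measurableSet_Ioi fun v hv => hFc v hv w, integral_mul_const,
    integral_const_mul, integral_cpow_mul_inv_one_add (by simp; linarith) (by simp; linarith),
    ← inv_sin_mul_inv_sin]
  ring

/-- The first divided difference of `x ↦ x ^ (1 - α)` as a Fourier integral. -/
theorem integral_rpow_div_add_mul_add {α : ℝ} (h0 : 0 < α) (h1 : α < 1) {x y : ℝ}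
    (hx : 0 < x) (hy : 0 < y) :
    ((∫ l in Ioi (0 : ℝ), l ^ (1 - α) / ((x + l) * (y + l)) : ℝ) : ℂ) =
      ∫ w : ℝ, (divDiffKernel α w : ℂ) *
        ((x : ℂ) ^ (-(((α / 2 : ℝ) : ℂ) + w * Complex.I)) *
          (y : ℂ) ^ (-(((α / 2 : ℝ) : ℂ) - w * Complex.I))) := by
  have e := integral_comp_mul_left_Ioi (fun l : ℝ => l ^ (1 - α) / ((x + l) * (y + l))) 0 hy
  rw [mul_zero, smul_eq_mul] at e
  have e1 : ∫ l in Ioi (0 : ℝ), l ^ (1 - α) / ((x + l) * (y + l)) = 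
      y ^ (-α) * ∫ v in Ioi (0 : ℝ), v ^ (1 - α) / ((x / y + v) * (1 + v)) := by
    have : ∫ l in Ioi (0 : ℝ), l ^ (1 - α) / ((x + l) * (y + l)) = y * (y⁻¹ * 
      ∫ l in Ioi (0 : ℝ), l ^ (1 - α) / ((x + l) * (y + l))) := by field_simp
    rw [this, ← e, ← integral_const_mul, ← integral_const_mul]
    refine setIntegral_congr_fun measurableSet_Ioi fun v hv => ?_
    have hv : 0 < v := hv
    rw [Real.mul_rpow hy.le hv.le, show 1 - α = -α + 1 by ring, Real.rpow_add_one hy.ne']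
    field_simp
  rw [e1, Complex.ofReal_mul, integral_rpow_div_mul_eq h0 h1 (div_pos hx hy), ← integral_const_mul]
  refine integral_congr_ae (ae_of_all _ fun w => ?_)
  have hy' : (y : ℂ) ≠ 0 := by exact_mod_cast hy.ne'
  have e3 : -(((α / 2 : ℝ) : ℂ) - w * Complex.I) =
    ((-α : ℝ) : ℂ) + (((α / 2 : ℝ) : ℂ) + w * Complex.I) := by push_cast; ring
  simp only
  rw [e3, Complex.cpow_add _ _ hy', div_eq_mul_inv, Complex.ofReal_mul x,
    Complex.mul_cpow_ofReal_nonneg hx.le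
      (inv_nonneg.2 hy.le), Complex.ofReal_inv, Complex.inv_cpow _ _ (by
        rw [Complex.arg_ofReal_of_nonneg hy.le]; exact Real.pi_pos.ne), Complex.cpow_neg (y : ℂ) (_ + _),
      inv_inv, Complex.ofReal_cpow hy.le]
  ring

theorem integrableOn_rpow_div_add_mul_add {α : ℝ} (h0 : 0 < α) (h1 : α < 1) {x y : ℝ}
    (hx : 0 < x) (hy : 0 < y) :
    IntegrableOn (fun l : ℝ => l ^ (1 - α) / ((x + l) * (y + l))) (Ioi 0) := by
  have h := (integrableOn_rpow_mul_div_add (θ := 1 - α) (by linarith) (by linarith) hx.le).const_mul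
    x⁻¹
  refine Integrable.mono' h ?_ ?_
  · exact (by fun_prop : Measurable fun l : ℝ =>
      l ^ (1 - α) / ((x + l) * (y + l))).aestronglyMeasurable
  · filter_upwards [ae_restrict_mem measurableSet_Ioi] with l hl
    have hl : 0 < l := hl
    rw [Real.norm_of_nonneg (by positivity), Real.rpow_sub_one hl.ne']
    have : l / (y + l) ≤ 1 := by rw [div_le_one (by positivity)]; linarith
    have h3 : l ^ (1 - α) / ((x + l) * (y + l)) =
      x⁻¹ * (l ^ (1 - α) / l * (x / (x + l))) * (l / (y + l)) := by field_simp
    rw [h3]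
    exact mul_le_of_le_one_right (by positivity) this

section Classical

variable {X : Type*} [Fintype X]

/-- The logarithmic moment generating function of `h` with respect to the weights `exp ∘ b`. -/
def lmgf (b h : X → ℝ) (s : ℝ) : ℝ := Real.log (∑ x, Real.exp (b x + s * h x))

/-- The mean of `h` under the tilted distribution with weights `exp (b + s h)`. -/
def lmean (b h : X → ℝ) (s : ℝ) : ℝ :=
  (∑ x, h x * Real.exp (b x + s * h x)) / ∑ x, Real.exp (b x + s * h x)

theorem sum_exp_pos [Nonempty X] (f : X → ℝ) : 0 < ∑ x, Real.exp (f x) :=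
  Finset.sum_pos (fun _ _ => Real.exp_pos _) Finset.univ_nonempty

theorem exp_lmgf [Nonempty X] (b h : X → ℝ) (s : ℝ) :
    Real.exp (lmgf b h s) = ∑ x, Real.exp (b x + s * h x) :=
  Real.exp_log (sum_exp_pos _)

theorem hasDerivAt_lmgf [Nonempty X] (b h : X → ℝ) (s : ℝ) :
    HasDerivAt (lmgf b h) (lmean b h s) s := by
  refine HasDerivAt.log ?_ (sum_exp_pos _).ne'
  refine HasDerivAt.fun_sum fun x _ => ?_
  have h1 : HasDerivAt (fun s => b x + s * h x) (h x) s := by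
    simpa using ((hasDerivAt_id s).mul_const (h x)).const_add (b x)
  simpa [mul_comm] using h1.exp

theorem continuous_lmgf [Nonempty X] (b h : X → ℝ) : Continuous (lmgf b h) :=
  continuous_iff_continuousAt.2 fun s => (hasDerivAt_lmgf b h s).continuousAt

/-- The tilted distribution. -/
def tilt (b h : X → ℝ) (s : ℝ) (x : X) : ℝ := Real.exp (b x + s * h x - lmgf b h s)

theorem tilt_pos (b h : X → ℝ) (s : ℝ) (x : X) : 0 < tilt b h s x := Real.exp_pos _

theorem tilt_eq [Nonempty X] (b h : X → ℝ) (s : ℝ) (x : X) :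
    tilt b h s x = Real.exp (b x + s * h x) / ∑ x, Real.exp (b x + s * h x) := by
  rw [tilt, Real.exp_sub, exp_lmgf]

theorem sum_tilt [Nonempty X] (b h : X → ℝ) (s : ℝ) : ∑ x, tilt b h s x = 1 := by
  simp_rw [tilt_eq, ← Finset.sum_div]
  exact div_self (sum_exp_pos _).ne'

theorem sum_tilt_mul [Nonempty X] (b h : X → ℝ) (s : ℝ) :
    ∑ x, tilt b h s x * h x = lmean b h s := by
  simp_rw [tilt_eq, lmean, Finset.sum_div]
  refine Finset.sum_congr rfl fun x _ => by ring

theorem sum_tilt_mul_sub [Nonempty X] (b h : X → ℝ) (s : ℝ) :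
    ∑ x, tilt b h s x * (h x - lmean b h s) = 0 := by
  simp_rw [mul_sub, Finset.sum_sub_distrib, sum_tilt_mul, ← Finset.sum_mul, sum_tilt]
  ring

theorem lmgf_add_mul_lt [Nonempty X] (b h : X → ℝ) {s a : ℝ} (hsa : a ≠ s)
    (hh : ∃ x, h x ≠ lmean b h s) :
    lmgf b h s + (a - s) * lmean b h s < lmgf b h a := by
  rw [← Real.exp_lt_exp, exp_lmgf, Real.exp_add]
  have e1 : ∀ x, Real.exp (b x + a * h x) = Real.exp (lmgf b h s) *
      Real.exp ((a - s) * lmean b h s) *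
      (tilt b h s x * Real.exp ((a - s) * (h x - lmean b h s))) := fun x => by
    rw [tilt, ← Real.exp_add, ← Real.exp_add, ← Real.exp_add]
    congr 1
    ring
  simp_rw [e1, ← Finset.mul_sum]
  refine lt_mul_of_one_lt_right (by positivity) ?_
  have e2 : ∑ x, tilt b h s x * ((a - s) * (h x - lmean b h s) + 1) = 1 := by
    have : ∀ x, tilt b h s x * ((a - s) * (h x - lmean b h s) + 1) =
      (a - s) * (tilt b h s x * (h x - lmean b h s)) + tilt b h s x := fun x => by ring
    simp_rw [this, Finset.sum_add_distrib, ← Finset.mul_sum, sum_tilt_mul_sub, sum_tilt]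
    ring
  rw [← e2]
  refine Finset.sum_lt_sum (fun x _ => ?_) ?_
  · exact mul_le_mul_of_nonneg_left (Real.add_one_le_exp _) (tilt_pos b h s x).le
  · obtain ⟨x, hx⟩ := hh
    refine ⟨x, Finset.mem_univ _, mul_lt_mul_of_pos_left (Real.add_one_lt_exp ?_) (tilt_pos b h s x)⟩
    exact mul_ne_zero (sub_ne_zero.2 hsa) (sub_ne_zero.2 hx)

theorem lmgf_eq_of_const [Nonempty X] (b h : X → ℝ) {c : ℝ} (hh : ∀ x, h x = c) (s a : ℝ) :
    lmgf b h a = lmgf b h s + (a - s) * c := by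
  apply Real.exp_injective
  rw [exp_lmgf, Real.exp_add, exp_lmgf, Finset.sum_mul]
  refine Finset.sum_congr rfl fun x _ => ?_
  rw [hh, ← Real.exp_add]
  congr 1
  ring

theorem lmean_eq_of_const [Nonempty X] (b h : X → ℝ) {c : ℝ} (hh : ∀ x, h x = c) (s : ℝ) :
    lmean b h s = c := by
  rw [← sum_tilt_mul]
  simp_rw [hh, ← Finset.sum_mul, sum_tilt, one_mul]

theorem sum_fin_prod (W : X → ℝ) (k : ℕ) :
    ∑ x : Fin k → X, ∏ i, W (x i) = (∑ x, W x) ^ k := by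
  rw [Finset.sum_pow']
  simp [Fintype.piFinset_univ]

theorem sum_prod_fin_succ (f : (k : ℕ) → (Fin k → X) → ℝ) (k : ℕ) :
    ∑ x, f (k + 1) x = ∑ a : X, ∑ y : Fin k → X, f (k + 1) (Fin.cons a y) := by
  rw [← Fintype.sum_prod_type']
  exact (Fintype.sum_equiv (Fin.consEquiv fun _ => X) _ _ fun p => rfl).symm

theorem sum_prod_mul_sum_eq_zero {W g : X → ℝ} (hg : ∑ x, W x * g x = 0) (k : ℕ) :
    ∑ x : Fin k → X, (∏ i, W (x i)) * ∑ i, g (x i) = 0 := by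
  induction k with
  | zero => simp
  | succ k ih =>
    rw [sum_prod_fin_succ (fun k x => (∏ i, W (x i)) * ∑ i, g (x i))]
    simp only [Fin.prod_univ_succ, Fin.sum_univ_succ, Fin.cons_zero, Fin.cons_succ]
    have : ∀ (a : X) (y : Fin k → X), (W a * ∏ i, W (y i)) * (g a + ∑ i, g (y i)) =
        (W a * g a) * (∏ i, W (y i)) + W a * ((∏ i, W (y i)) * ∑ i, g (y i)) := fun a y => by ring
    simp_rw [this, Finset.sum_add_distrib, ← Finset.mul_sum, ih, ← Finset.sum_mul, hg]
    simp

theorem sum_prod_mul_sum_sq {W g : X → ℝ} (hW : ∑ x, W x = 1) (hg : ∑ x, W x * g x = 0) (k : ℕ) :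
    ∑ x : Fin k → X, (∏ i, W (x i)) * (∑ i, g (x i)) ^ 2 = k * ∑ x, W x * g x ^ 2 := by
  induction k with
  | zero => simp
  | succ k ih =>
    rw [sum_prod_fin_succ (fun k x => (∏ i, W (x i)) * (∑ i, g (x i)) ^ 2)]
    simp only [Fin.prod_univ_succ, Fin.sum_univ_succ, Fin.cons_zero, Fin.cons_succ]
    have : ∀ (a : X) (y : Fin k → X), (W a * ∏ i, W (y i)) * (g a + ∑ i, g (y i)) ^ 2 =
        (W a * g a ^ 2) * (∏ i, W (y i)) + 2 * (W a * g a) * ((∏ i, W (y i)) * ∑ i, g (y i)) +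
          W a * ((∏ i, W (y i)) * (∑ i, g (y i)) ^ 2) := fun a y => by ring
    simp_rw [this, Finset.sum_add_distrib, ← Finset.mul_sum, ih, sum_prod_mul_sum_eq_zero hg,
      ← Finset.sum_mul, sum_fin_prod, hW]
    push_cast
    ring

/-- A weak law of large numbers for product weights. -/
theorem exists_forall_half_le_sum {W g : X → ℝ} (hW0 : ∀ x, 0 ≤ W x) (hW : ∑ x, W x = 1)
    (hg : ∑ x, W x * g x = 0) {δ : ℝ} (hδ : 0 < δ) :
    ∃ K : ℕ, ∀ k ≥ K, 1 / 2 ≤ ∑ x : Fin k → X with |∑ i, g (x i)| ≤ k * δ, ∏ i, W (x i) := by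
  obtain ⟨K, hK⟩ := exists_nat_gt (2 * (∑ x, W x * g x ^ 2) / δ ^ 2)
  refine ⟨max K 1, fun k hk => ?_⟩
  have hk1 : (1 : ℝ) ≤ k := by exact_mod_cast (le_max_right _ _).trans hk
  have hk2 : (K : ℝ) ≤ k := by exact_mod_cast (le_max_left _ _).trans hk
  have h1 : ∑ x : Fin k → X with ¬ |∑ i, g (x i)| ≤ k * δ, ∏ i, W (x i) ≤ 1 / 2 := by
    have hle : (k * δ) ^ 2 * ∑ x : Fin k → X with ¬ |∑ i, g (x i)| ≤ k * δ, ∏ i, W (x i) ≤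
        ∑ x : Fin k → X, (∏ i, W (x i)) * (∑ i, g (x i)) ^ 2 := by
      rw [Finset.mul_sum]
      refine (Finset.sum_le_sum fun x hx => ?_).trans
        (Finset.sum_le_sum_of_subset_of_nonneg (Finset.filter_subset _ _) fun x _ _ => ?_)
      · rw [mul_comm]
        refine mul_le_mul_of_nonneg_left ?_ (Finset.prod_nonneg fun i _ => hW0 _)
        have := (not_le.1 (Finset.mem_filter.1 hx).2).le
        rw [← sq_abs (∑ i, g (x i))]
        exact pow_le_pow_left₀ (by positivity) this 2
      · exact mul_nonneg (Finset.prod_nonneg fun i _ => hW0 _) (sq_nonneg _)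
    rw [sum_prod_mul_sum_sq hW hg] at hle
    rw [div_lt_iff₀ (by positivity)] at hK
    have h3 : (K : ℝ) * δ ^ 2 ≤ k * δ ^ 2 := by gcongr
    have h4 : (k : ℝ) * (2 * ∑ x, W x * g x ^ 2) ≤ k * (k * δ ^ 2) := by
      refine mul_le_mul_of_nonneg_left ?_ (by positivity)
      linarith
    have h5 : 0 < ((k : ℝ) * δ) ^ 2 := by positivity
    nlinarith
  have h2 := Finset.sum_filter_add_sum_filter_not Finset.univ
    (fun x : Fin k → X => |∑ i, g (x i)| ≤ k * δ) (fun x => ∏ i, W (x i))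
  rw [sum_fin_prod, hW, one_pow] at h2
  linarith

theorem exists_forall_le_sum_min [Nonempty X] (b h : X → ℝ) (s : ℝ) {δ : ℝ} (hδ : 0 < δ) :
    ∃ K : ℕ, ∀ k ≥ K,
      1 / 2 * Real.exp (-(k * ((s - 1) * lmean b h s - lmgf b h s + |1 - s| * δ))) ≤
      ∑ x : Fin k → X, min (∏ i, Real.exp (b (x i) + h (x i)))
        (Real.exp (k * (lmean b h s + δ)) * ∏ i, Real.exp (b (x i))) := by
  obtain ⟨K, hK⟩ := exists_forall_half_le_sum (fun x => (tilt_pos b h s x).le) (sum_tilt b h s)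
    (sum_tilt_mul_sub b h s) hδ
  refine ⟨K, fun k hk => ?_⟩
  refine (mul_le_mul_of_nonneg_right (hK k hk) (Real.exp_pos _).le).trans ?_
  rw [Finset.sum_mul]
  refine (Finset.sum_le_sum fun x hx => ?_).trans
        (Finset.sum_le_sum_of_subset_of_nonneg (Finset.filter_subset _ _) fun x _ _ => ?_)
  · have hx := (Finset.mem_filter.1 hx).2
    rw [Finset.sum_sub_distrib, Finset.sum_const, Finset.card_univ, Fintype.card_fin,
      nsmul_eq_mul] at hx
    have hx' := abs_le.1 hx
    simp only [tilt]
    simp_rw [← Real.exp_sum, ← Real.exp_add, Finset.sum_add_distrib, Finset.sum_sub_distrib,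
      Finset.sum_add_distrib, ← Finset.mul_sum, Finset.sum_const, Finset.card_univ,
      Fintype.card_fin, nsmul_eq_mul]
    set B := ∑ i, b (x i)
    set G := ∑ i, h (x i)
    have key : (1 - s) * (k * lmean b h s - G) ≤ |1 - s| * (k * δ) := by
      refine (le_abs_self _).trans ?_
      rw [abs_mul, abs_sub_comm _ G]
      gcongr
    refine le_min ?_ ?_
    · rw [Real.exp_le_exp]
      nlinarith
    · rw [Real.exp_le_exp]
      nlinarith [hx'.2]
  · exact le_min (Finset.prod_nonneg fun _ _ => (Real.exp_pos _).le)
      (mul_nonneg (Real.exp_pos _).le (Finset.prod_nonneg fun _ _ => (Real.exp_pos _).le))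

/-- The classical reliability function. -/
def psiC (b h : X → ℝ) (r s : ℝ) : ℝ := ((s - 1) * r - lmgf b h s) / s

theorem hasDerivAt_psiC [Nonempty X] (b h : X → ℝ) (r : ℝ) {s : ℝ} (hs : s ≠ 0) :
    HasDerivAt (psiC b h r) ((r - (s * lmean b h s - lmgf b h s)) / s ^ 2) s := by
  have h1 := ((((hasDerivAt_id s).sub_const 1).mul_const r).sub (hasDerivAt_lmgf b h s)).div
    (hasDerivAt_id s) hs
  refine h1.congr_deriv ?_
  simp only [id, Pi.sub_apply]
  field_simp
  ring

theorem psiC_eq_of_stationary (b h : X → ℝ) {r s : ℝ} (hs : s ≠ 0)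
    (hq : s * lmean b h s - lmgf b h s = r) :
    psiC b h r s = (s - 1) * lmean b h s - lmgf b h s := by
  rw [psiC, ← hq]
  field_simp
  ring

theorem stationary_of_isLocalMax [Nonempty X] (b h : X → ℝ) {r s : ℝ} (hs : s ≠ 0)
    (hm : IsLocalMax (psiC b h r) s) : s * lmean b h s - lmgf b h s = r := by
  have := hm.hasDerivAt_eq_zero (hasDerivAt_psiC b h r hs)
  rw [div_eq_zero_iff] at this
  rcases this with h | h
  · linarith
  · exact absurd h (pow_ne_zero 2 hs)

theorem psiC_lt_of_stationary [Nonempty X] (b h : X → ℝ) {r s a : ℝ} (hs : 0 < s) (ha : 0 < a)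
    (hq : s * lmean b h s - lmgf b h s = r) (h1 : lmgf b h 1 = 0) (hr : r < lmean b h 1)
    (has : a ≠ s) : psiC b h r a < psiC b h r s := by
  have hh : ∃ x, h x ≠ lmean b h s := by
    by_contra hcon
    push Not at hcon
    have e1 := lmgf_eq_of_const b h hcon s 1
    have e2 := lmean_eq_of_const b h hcon 1
    rw [e2] at hr
    linarith
  have := lmgf_add_mul_lt b h has hh
  rw [psiC_eq_of_stationary b h hs.ne' hq, psiC, div_lt_iff₀ ha, ← hq]
  linarith

/-- Lowering the rate slightly, an interior maximum of the reliability function produces a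
tilting parameter adapted to the rate. -/
theorem exists_stationary_of_lt [Nonempty X] (b h : X → ℝ) {r a s₀ c : ℝ} (ha : 0 < a)
    (has : a < s₀) (hsc : s₀ < c) (hc : c ≤ 1) (hψa : psiC b h r a < psiC b h r s₀)
    (hψc : psiC b h r c < psiC b h r s₀) {M : ℝ} (hM : ∀ s ∈ Icc a c, psiC b h r s ≤ M)
    {ε : ℝ} (hε : 0 < ε) :
    ∃ s, (s - 1) * lmean b h s - lmgf b h s + lmean b h s < r ∧
      (s - 1) * lmean b h s - lmgf b h s ≤ M + ε := by
  obtain ⟨η, hη0, hη1, hη2, hη3⟩ : ∃ η, 0 < η ∧ η / a ≤ ε ∧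
      η / a < psiC b h r s₀ - psiC b h r a ∧ η / a < psiC b h r s₀ - psiC b h r c := by
    refine ⟨a * (min ε (min (psiC b h r s₀ - psiC b h r a) (psiC b h r s₀ - psiC b h r c)) / 2),
      ?_, ?_, ?_, ?_⟩
    · have := lt_min hε (lt_min (sub_pos.2 hψa) (sub_pos.2 hψc))
      positivity
    all_goals
      rw [mul_div_cancel_left₀ _ ha.ne']
      have h0 := lt_min hε (lt_min (sub_pos.2 hψa) (sub_pos.2 hψc))
      have h1 := min_le_left ε (min (psiC b h r s₀ - psiC b h r a) (psiC b h r s₀ - psiC b h r c))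
      have h2 := (min_le_right ε (min (psiC b h r s₀ - psiC b h r a)
        (psiC b h r s₀ - psiC b h r c))).trans (min_le_left _ _)
      have h3 := (min_le_right ε (min (psiC b h r s₀ - psiC b h r a)
        (psiC b h r s₀ - psiC b h r c))).trans (min_le_right _ _)
      linarith
  have hsh : ∀ s, 0 < s → psiC b h (r - η) s = psiC b h r s + (1 - s) / s * η := fun s hs => by
    unfold psiC
    field_simp
    ring
  have hbd : ∀ s ∈ Icc a c, 0 ≤ (1 - s) / s * η ∧ (1 - s) / s * η ≤ η / a := fun s hs => by
    have hs0 : 0 < s := ha.trans_le hs.1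
    have hs1 : s ≤ 1 := hs.2.trans hc
    refine ⟨mul_nonneg (div_nonneg (by linarith) hs0.le) hη0.le, ?_⟩
    rw [div_mul_eq_mul_div]
    exact div_le_div₀ hη0.le (by nlinarith) ha hs.1
  have hcont : ContinuousOn (psiC b h (r - η)) (Icc a c) := fun s hs =>
    (hasDerivAt_psiC b h (r - η) (ha.trans_le hs.1).ne').continuousAt.continuousWithinAt
  obtain ⟨s, hs, hmax⟩ := isCompact_Icc.exists_isMaxOn (nonempty_Icc.2 (has.trans hsc).le) hcont
  have hmem₀ : s₀ ∈ Icc a c := ⟨has.le, hsc.le⟩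
  have hs₀ : psiC b h (r - η) s₀ ≤ psiC b h (r - η) s := hmax hmem₀
  have hs0 : 0 < s := ha.trans_le hs.1
  rw [hsh s₀ (ha.trans has), hsh s hs0] at hs₀
  have hb₀ := hbd s₀ hmem₀
  have hbs := hbd s hs
  have hsa : s ≠ a := by
    rintro rfl
    linarith [hbs.2]
  have hsc' : s ≠ c := by
    rintro rfl
    linarith [hbs.2]
  have hloc : IsLocalMax (psiC b h (r - η)) s := by
    refine hmax.isLocalMax (Icc_mem_nhds (lt_of_le_of_ne hs.1 hsa.symm) (lt_of_le_of_ne hs.2 hsc'))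
  have hq := stationary_of_isLocalMax b h hs0.ne' hloc
  refine ⟨s, by linarith, ?_⟩
  rw [← psiC_eq_of_stationary b h hs0.ne' hq, hsh s hs0]
  linarith [hM s hs, hbs.2]

/-- If the reliability function is nonpositive, then the rate is at least the relative entropy. -/
theorem lmean_one_le_of_psiC_nonpos [Nonempty X] (b h : X → ℝ) {r : ℝ}
    (hψ : ∀ s ∈ Ioo (0 : ℝ) 1, psiC b h r s ≤ 0) (h1 : lmgf b h 1 ≤ 0) :
    lmgf b h 1 = 0 ∧ lmean b h 1 ≤ r := by
  have hle : ∀ s ∈ Ioo (0 : ℝ) 1, (s - 1) * r ≤ lmgf b h s := fun s hs => by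
    have := hψ s hs
    rw [psiC, div_le_iff₀ hs.1] at this
    linarith
  have hne : (nhdsWithin (1 : ℝ) (Ioo 0 1)).NeBot := by
    rw [← mem_closure_iff_nhdsWithin_neBot, closure_Ioo (by norm_num)]
    simp
  have h2 : 0 ≤ lmgf b h 1 := by
    have t1 : Tendsto (fun s : ℝ => (s - 1) * r) (nhdsWithin 1 (Ioo 0 1)) (nhds ((1 - 1) * r)) :=
      (Continuous.tendsto (by fun_prop) 1).mono_left nhdsWithin_le_nhds
    have t2 : Tendsto (lmgf b h) (nhdsWithin 1 (Ioo 0 1)) (nhds (lmgf b h 1)) :=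
      ((continuous_lmgf b h).tendsto 1).mono_left nhdsWithin_le_nhds
    have := le_of_tendsto_of_tendsto t1 t2 (eventually_mem_nhdsWithin.mono hle)
    simpa using this
  have h3 : lmgf b h 1 = 0 := le_antisymm h1 h2
  refine ⟨h3, ?_⟩
  have := (hasDerivAt_lmgf b h 1).tendsto_slope
  have t := this.mono_left (nhdsWithin_mono 1 (fun s (hs : s ∈ Ioo (0 : ℝ) 1) => hs.2.ne))
  refine le_of_tendsto t (eventually_mem_nhdsWithin.mono fun s hs => ?_)
  rw [slope_def_field, h3, sub_zero, div_le_iff_of_neg (by linarith [hs.2])]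
  linarith [hle s hs]

end Classical

section Spectral

variable {ι κ κ' : Type*} [Fintype ι] [DecidableEq ι] [Fintype κ] [DecidableEq κ]
  [Fintype κ'] [DecidableEq κ']

/-- Scalar power on the support. -/
def pw (w : ℂ) (x : ℝ) : ℂ := if x = 0 then 0 else (x : ℂ) ^ w

/-- Functional calculus of a Hermitian matrix. -/
def mfun (f : ℝ → ℂ) (A : Matrix ι ι ℂ) : Matrix ι ι ℂ :=
  if hA : A.IsHermitian then
    (hA.eigenvectorUnitary : Matrix ι ι ℂ) *
      Matrix.diagonal (fun i => f (hA.eigenvalues i)) *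
      star (hA.eigenvectorUnitary : Matrix ι ι ℂ)
  else 0

theorem mpow_eq_mfun (A : Matrix ι ι ℂ) (w : ℂ) : mpow A w = mfun (pw w) A := rfl

/-- A unitary diagonalisation, where the eigenvectors may be indexed by any type. -/
structure SpecRep (A : Matrix ι ι ℂ) (V : Matrix ι κ ℂ) (μ : κ → ℝ) : Prop where
  mul_conj : V * V.conjTranspose = 1
  conj_mul : V.conjTranspose * V = 1
  eq : A = V * Matrix.diagonal (fun i => (μ i : ℂ)) * V.conjTranspose

theorem specRep_eigen {A : Matrix ι ι ℂ} (hA : A.IsHermitian) :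
    SpecRep A (hA.eigenvectorUnitary : Matrix ι ι ℂ) hA.eigenvalues where
  mul_conj := Matrix.mem_unitaryGroup_iff.1 hA.eigenvectorUnitary.2
  conj_mul := Matrix.mem_unitaryGroup_iff'.1 hA.eigenvectorUnitary.2
  eq := by
    conv_lhs => rw [hA.spectral_theorem]
    rw [Unitary.conjStarAlgAut_apply]
    rfl

theorem SpecRep.isHermitian {A : Matrix ι ι ℂ} {V : Matrix ι κ ℂ} {μ : κ → ℝ}
    (h : SpecRep A V μ) : A.IsHermitian := by
  rw [h.eq]
  have : (Matrix.diagonal fun i => (μ i : ℂ)).IsHermitian := by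
    rw [Matrix.isHermitian_diagonal_iff]
    intro i
    simp [isSelfAdjoint_iff]
  exact Matrix.isHermitian_mul_mul_conjTranspose V this

theorem SpecRep.mfun_eq {A : Matrix ι ι ℂ} {V : Matrix ι κ ℂ} {μ : κ → ℝ}
    (h : SpecRep A V μ) (f : ℝ → ℂ) :
    mfun f A = V * Matrix.diagonal (fun i => f (μ i)) * V.conjTranspose := by
  have hA := h.isHermitian
  rw [mfun, dif_pos hA]
  have h' := specRep_eigen hA
  set U := (hA.eigenvectorUnitary : Matrix ι ι ℂ)
  set ν := hA.eigenvalues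
  have e1 : Matrix.diagonal (fun i => (ν i : ℂ)) * (U.conjTranspose * V) =
      (U.conjTranspose * V) * Matrix.diagonal (fun i => (μ i : ℂ)) := by
    calc _ = (U.conjTranspose * U) * Matrix.diagonal (fun i => (ν i : ℂ)) * (U.conjTranspose * V) := by
          rw [h'.conj_mul, Matrix.one_mul]
      _ = U.conjTranspose * (U * Matrix.diagonal (fun i => (ν i : ℂ)) * U.conjTranspose) * V := by
          simp only [Matrix.mul_assoc]
      _ = U.conjTranspose * (V * Matrix.diagonal (fun i => (μ i : ℂ)) * V.conjTranspose) * V := by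
          rw [← h'.eq, h.eq]
      _ = (U.conjTranspose * V) * Matrix.diagonal (fun i => (μ i : ℂ)) * (V.conjTranspose * V) := by
          simp only [Matrix.mul_assoc]
      _ = _ := by rw [h.conj_mul, Matrix.mul_one]
  have e2 : Matrix.diagonal (fun i => f (ν i)) * (U.conjTranspose * V) =
      (U.conjTranspose * V) * Matrix.diagonal (fun i => f (μ i)) := by
    ext i j
    have := congrFun (congrFun e1 i) j
    rw [Matrix.diagonal_mul, Matrix.mul_diagonal] at this ⊢
    by_cases hc : (U.conjTranspose * V) i j = 0
    · simp [hc]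
    · rw [mul_comm] at this
      have h2 := mul_left_cancel₀ hc this
      rw [Complex.ofReal_inj] at h2
      rw [h2, mul_comm]
  calc U * Matrix.diagonal (fun i => f (ν i)) * U.conjTranspose
      = U * (Matrix.diagonal (fun i => f (ν i)) * (U.conjTranspose * V)) * V.conjTranspose := by
        rw [show U * (Matrix.diagonal (fun i => f (ν i)) * (U.conjTranspose * V)) * V.conjTranspose =
          U * Matrix.diagonal (fun i => f (ν i)) * U.conjTranspose * (V * V.conjTranspose) by
            simp only [Matrix.mul_assoc], h.mul_conj, Matrix.mul_one]
    _ = (U * U.conjTranspose) * V * Matrix.diagonal (fun i => f (μ i)) * V.conjTranspose := by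
        rw [e2]; simp only [Matrix.mul_assoc]
    _ = _ := by rw [h'.mul_conj, Matrix.one_mul]

theorem SpecRep.mfun_mul {A : Matrix ι ι ℂ} {V : Matrix ι κ ℂ} {μ : κ → ℝ}
    (h : SpecRep A V μ) (f g : ℝ → ℂ) : mfun f A * mfun g A = mfun (fun x => f x * g x) A := by
  rw [h.mfun_eq, h.mfun_eq, h.mfun_eq]
  calc _ = V * Matrix.diagonal (fun i => f (μ i)) * (V.conjTranspose * V) *
        Matrix.diagonal (fun i => g (μ i)) * V.conjTranspose := by simp only [Matrix.mul_assoc]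
    _ = _ := by rw [h.conj_mul, Matrix.mul_one, Matrix.mul_assoc V, Matrix.diagonal_mul_diagonal]

theorem mfun_mul {A : Matrix ι ι ℂ} (hA : A.IsHermitian) (f g : ℝ → ℂ) :
    mfun f A * mfun g A = mfun (fun x => f x * g x) A :=
  (specRep_eigen hA).mfun_mul f g

theorem mfun_congr {A : Matrix ι ι ℂ} (hA : A.IsHermitian) {f g : ℝ → ℂ}
    (h : ∀ i, f (hA.eigenvalues i) = g (hA.eigenvalues i)) : mfun f A = mfun g A := by
  rw [(specRep_eigen hA).mfun_eq, (specRep_eigen hA).mfun_eq]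
  simp_rw [h]

theorem mfun_id {A : Matrix ι ι ℂ} (hA : A.IsHermitian) : mfun (fun x => (x : ℂ)) A = A := by
  rw [(specRep_eigen hA).mfun_eq]
  exact (specRep_eigen hA).eq.symm

theorem mfun_one {A : Matrix ι ι ℂ} (hA : A.IsHermitian) : mfun (fun _ => 1) A = 1 := by
  rw [(specRep_eigen hA).mfun_eq, Matrix.diagonal_one, Matrix.mul_one, (specRep_eigen hA).mul_conj]

theorem SpecRep.trace_mul_mfun {A : Matrix ι ι ℂ} {V : Matrix ι κ ℂ} {μ : κ → ℝ}
    (h : SpecRep A V μ) (f : ℝ → ℂ) (R : Matrix ι ι ℂ) :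
    (R * mfun f A).trace = ∑ j, f (μ j) * (V.conjTranspose * R * V) j j := by
  rw [h.mfun_eq, ← Matrix.mul_assoc, Matrix.trace_mul_comm, ← Matrix.mul_assoc, ← Matrix.mul_assoc,
    Matrix.trace]
  refine Finset.sum_congr rfl fun j _ => ?_
  rw [Matrix.diag_apply, Matrix.mul_diagonal, mul_comm]

theorem SpecRep.trace_mul_mfun_mul_mfun {A : Matrix ι ι ℂ} {V : Matrix ι κ ℂ} {μ : κ → ℝ}
    (h : SpecRep A V μ) (f g : ℝ → ℂ) (R B : Matrix ι ι ℂ) :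
    (R * (mfun f A * B * mfun g A)).trace = ∑ i, ∑ j, (f (μ i) * g (μ j)) *
      ((V.conjTranspose * R * V) j i * (V.conjTranspose * B * V) i j) := by
  have e : (R * (mfun f A * B * mfun g A)).trace =
      ((V.conjTranspose * R * V) * Matrix.diagonal (fun i => f (μ i)) * (V.conjTranspose * B * V) *
        Matrix.diagonal (fun i => g (μ i))).trace := by
    rw [h.mfun_eq, h.mfun_eq]
    rw [show R * (V * Matrix.diagonal (fun i => f (μ i)) * V.conjTranspose * B *
      (V * Matrix.diagonal (fun i => g (μ i)) * V.conjTranspose)) =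
      (R * V * Matrix.diagonal (fun i => f (μ i)) * V.conjTranspose * B *
      V * Matrix.diagonal (fun i => g (μ i))) * V.conjTranspose by simp only [Matrix.mul_assoc],
      Matrix.trace_mul_comm]
    simp only [Matrix.mul_assoc]
  rw [e, Matrix.trace, Finset.sum_comm]
  refine Finset.sum_congr rfl fun j _ => ?_
  rw [Matrix.diag_apply, Matrix.mul_diagonal, Matrix.mul_apply, Finset.sum_mul]
  refine Finset.sum_congr rfl fun i _ => ?_
  rw [Matrix.mul_diagonal]
  ring

theorem diag_nonneg {R : Matrix ι ι ℂ} (hR : R.PosSemidef) (i : ι) : 0 ≤ (R i i).re :=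
  (Complex.le_def.1 (hR.diag_nonneg (i := i))).1

theorem diag_eq_re {R : Matrix ι ι ℂ} (hR : R.PosSemidef) (i : ι) : R i i = ((R i i).re : ℂ) := by
  have := (Complex.le_def.1 (hR.diag_nonneg (i := i))).2
  exact Complex.ext rfl (by simpa using this.symm)

theorem mfun_posSemidef {A : Matrix ι ι ℂ} (hA : A.IsHermitian) {f : ℝ → ℂ}
    (hf : ∀ i, 0 ≤ f (hA.eigenvalues i)) : (mfun f A).PosSemidef := by
  rw [(specRep_eigen hA).mfun_eq]
  exact (Matrix.PosSemidef.diagonal fun i => hf i).mul_mul_conjTranspose_same _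

theorem pw_nonneg {x : ℝ} (hx : 0 ≤ x) (a : ℝ) : 0 ≤ pw (a : ℂ) x := by
  rw [pw]
  split_ifs
  · exact le_rfl
  · rw [← Complex.ofReal_cpow hx]
    exact_mod_cast Real.rpow_nonneg hx a

theorem mpow_posSemidef {A : Matrix ι ι ℂ} (hA : A.PosSemidef) (a : ℝ) :
    (mpow A (a : ℂ)).PosSemidef := by
  rw [mpow_eq_mfun]
  exact mfun_posSemidef hA.1 fun i => pw_nonneg (hA.eigenvalues_nonneg i) a

theorem pw_mul_pw {x : ℝ} (a b : ℂ) : pw a x * pw b x = pw (a + b) x := by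
  unfold pw
  split_ifs with h
  · simp
  · rw [Complex.cpow_add _ _ (by exact_mod_cast h)]

theorem mpow_mul_mpow {A : Matrix ι ι ℂ} (hA : A.IsHermitian) (a b : ℂ) :
    mpow A a * mpow A b = mpow A (a + b) := by
  rw [mpow_eq_mfun, mpow_eq_mfun, mfun_mul hA, mpow_eq_mfun]
  congr 1
  funext x
  exact pw_mul_pw a b

theorem mpow_one {A : Matrix ι ι ℂ} (hA : A.IsHermitian) : mpow A 1 = A := by
  have : pw 1 = fun x : ℝ => (x : ℂ) := by
    funext x
    rw [pw]
    split_ifs with h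
    · simp [h]
    · simp
  rw [mpow_eq_mfun, this, mfun_id hA]

theorem pw_mul_of_nonneg {x y : ℝ} (hx : 0 ≤ x) (hy : 0 ≤ y) (w : ℂ) :
    pw w (x * y) = pw w x * pw w y := by
  unfold pw
  by_cases h1 : x = 0
  · simp [h1]
  by_cases h2 : y = 0
  · simp [h2]
  rw [if_neg (mul_ne_zero h1 h2), if_neg h1, if_neg h2, Complex.ofReal_mul,
    Complex.mul_cpow_ofReal_nonneg hx hy]

theorem pw_prod {k : ℕ} {x : Fin k → ℝ} (hx : ∀ i, 0 ≤ x i) (w : ℂ) :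
    pw w (∏ i, x i) = ∏ i, pw w (x i) := by
  induction k with
  | zero => simp [pw]
  | succ k ih =>
    rw [Fin.prod_univ_succ, Fin.prod_univ_succ, pw_mul_of_nonneg (hx 0)
      (Finset.prod_nonneg fun i _ => hx _), ih fun i => hx _]

theorem mpow_smul {A : Matrix ι ι ℂ} (hA : A.PosSemidef) {c : ℝ} (hc : 0 < c) (a : ℝ) :
    mpow ((c : ℂ) • A) (a : ℂ) = ((c ^ a : ℝ) : ℂ) • mpow A a := by
  have h := specRep_eigen hA.1
  have h2 : SpecRep ((c : ℂ) • A) (hA.1.eigenvectorUnitary : Matrix ι ι ℂ)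
      (fun i => c * hA.1.eigenvalues i) := by
    refine ⟨h.mul_conj, h.conj_mul, ?_⟩
    conv_lhs => rw [h.eq]
    rw [← Matrix.smul_mul, ← Matrix.mul_smul, ← Matrix.diagonal_smul]
    congr 3
    ext i
    simp
  rw [mpow_eq_mfun, h2.mfun_eq, mpow_eq_mfun, h.mfun_eq, ← Matrix.smul_mul, ← Matrix.mul_smul,
    ← Matrix.diagonal_smul]
  congr 3
  ext i
  rw [pw_mul_of_nonneg hc.le (hA.eigenvalues_nonneg i), Pi.smul_apply, smul_eq_mul,
    pw, if_neg hc.ne', ← Complex.ofReal_cpow hc.le]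

theorem rtr_add (A B : Matrix ι ι ℂ) : rtr (A + B) = rtr A + rtr B := by
  simp [rtr, Matrix.trace_add]

theorem rtr_sub (A B : Matrix ι ι ℂ) : rtr (A - B) = rtr A - rtr B := by
  simp [rtr, Matrix.trace_sub]

theorem rtr_smul (c : ℝ) (A : Matrix ι ι ℂ) : rtr ((c : ℂ) • A) = c * rtr A := by
  simp [rtr, Matrix.trace_smul]

theorem rtr_real_smul (c : ℝ) (A : Matrix ι ι ℂ) : rtr (c • A) = c * rtr A := by
  simp [rtr, Matrix.trace_smul]

theorem rtr_mul_comm (A B : Matrix ι ι ℂ) : rtr (A * B) = rtr (B * A) := by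
  rw [rtr, rtr, Matrix.trace_mul_comm]

theorem rtr_mul_nonneg {A B : Matrix ι ι ℂ} (hA : A.PosSemidef) (hB : B.PosSemidef) :
    0 ≤ rtr (A * B) := by
  have h := specRep_eigen hB.1
  have h2 : rtr (A * B) = (A * mfun (fun x => (x : ℂ)) B).trace.re := by rw [mfun_id hB.1]; rfl
  rw [h2, h.trace_mul_mfun, Complex.re_sum]
  refine Finset.sum_nonneg fun j _ => ?_
  rw [Complex.re_ofReal_mul]
  exact mul_nonneg (hB.eigenvalues_nonneg j) (diag_nonneg (hA.conjTranspose_mul_mul_same _) j)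

theorem posSemidef_of_rtr_nonneg {A : Matrix ι ι ℂ} (hA : A.IsHermitian)
    (h : ∀ R : Matrix ι ι ℂ, R.PosSemidef → 0 ≤ rtr (R * A)) : A.PosSemidef := by
  rw [hA.posSemidef_iff_eigenvalues_nonneg]
  intro i
  have hS := specRep_eigen hA
  have h1 := h _ (mfun_posSemidef hA (f := fun x => if x = hA.eigenvalues i then 1 else 0)
    (fun j => by split_ifs <;> simp))
  have h3 : mfun (fun x => if x = hA.eigenvalues i then 1 else 0) A * A =
    mfun (fun x => ((if x = hA.eigenvalues i then x else 0 : ℝ) : ℂ)) A := by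
    have h4 : mfun (fun x => if x = hA.eigenvalues i then 1 else 0) A * A =
      mfun (fun x => if x = hA.eigenvalues i then 1 else 0) A * mfun (fun x => (x : ℂ)) A := by
      rw [mfun_id hA]
    rw [h4, mfun_mul hA]
    congr 1
    funext x
    split_ifs <;> simp
  rw [h3, ← Matrix.one_mul (mfun _ A), rtr, hS.trace_mul_mfun, Matrix.mul_one, hS.conj_mul] at h1
  simp only [Matrix.one_apply_eq, mul_one, Complex.re_sum, Complex.ofReal_re] at h1
  by_contra hneg
  simp only [Pi.zero_apply, not_le] at hneg
  have : ∑ x, (if hA.eigenvalues x = hA.eigenvalues i then hA.eigenvalues x else 0) < 0 := by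
    refine Finset.sum_neg' (fun j _ => ?_) ⟨i, Finset.mem_univ _, by simpa using hneg⟩
    split_ifs with hh
    · rw [hh]; exact hneg.le
    · exact le_rfl
  linarith

end Spectral

section Resolvent

variable {ι κ : Type*} [Fintype ι] [DecidableEq ι] [Fintype κ] [DecidableEq κ]

/-- The resolvent `(A + l)⁻¹`. -/
def rsv (l : ℝ) (A : Matrix ι ι ℂ) : Matrix ι ι ℂ := mfun (fun x => ((x + l)⁻¹ : ℝ)) A

/-- The matrix `A (A + l)⁻¹`. -/
def frac (l : ℝ) (A : Matrix ι ι ℂ) : Matrix ι ι ℂ := mfun (fun x => (x / (x + l) : ℝ)) A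

theorem mfun_add {A : Matrix ι ι ℂ} (hA : A.IsHermitian) (f g : ℝ → ℂ) :
    mfun f A + mfun g A = mfun (fun x => f x + g x) A := by
  have h := specRep_eigen hA
  rw [h.mfun_eq, h.mfun_eq, h.mfun_eq, ← Matrix.add_mul, ← Matrix.mul_add, Matrix.diagonal_add]

theorem mfun_smul {A : Matrix ι ι ℂ} (hA : A.IsHermitian) (c : ℂ) (g : ℝ → ℂ) :
    c • mfun g A = mfun (fun x => c * g x) A := by
  have h := specRep_eigen hA
  rw [h.mfun_eq, h.mfun_eq, ← Matrix.smul_mul, ← Matrix.mul_smul, ← Matrix.diagonal_smul]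
  rfl

theorem add_smul_one_eq_mfun {A : Matrix ι ι ℂ} (hA : A.IsHermitian) (l : ℝ) :
    A + (l : ℂ) • (1 : Matrix ι ι ℂ) = mfun (fun x => ((x + l : ℝ) : ℂ)) A := by
  have : ((l : ℂ) • (1 : Matrix ι ι ℂ)) = mfun (fun _ => (l : ℂ) * 1) A := by
    rw [← mfun_smul hA, mfun_one hA]
  rw [this]
  nth_rw 1 [← mfun_id hA]
  rw [mfun_add hA]
  congr 1
  funext x
  push_cast
  ring

theorem rsv_mul {A : Matrix ι ι ℂ} (hA : A.PosSemidef) {l : ℝ} (hl : 0 < l) :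
    rsv l A * (A + (l : ℂ) • (1 : Matrix ι ι ℂ)) = 1 := by
  rw [add_smul_one_eq_mfun hA.1, rsv, mfun_mul hA.1, ← mfun_one hA.1]
  refine mfun_congr hA.1 fun i => ?_
  have : hA.1.eigenvalues i + l ≠ 0 := by have := hA.eigenvalues_nonneg i; positivity
  rw [← Complex.ofReal_mul, inv_mul_cancel₀ this, Complex.ofReal_one]

theorem mul_rsv {A : Matrix ι ι ℂ} (hA : A.PosSemidef) {l : ℝ} (hl : 0 < l) :
    (A + (l : ℂ) • (1 : Matrix ι ι ℂ)) * rsv l A = 1 :=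
  mul_eq_one_comm.1 (rsv_mul hA hl)

theorem rsv_posSemidef {A : Matrix ι ι ℂ} (hA : A.PosSemidef) {l : ℝ} (hl : 0 < l) :
    (rsv l A).PosSemidef :=
  mfun_posSemidef hA.1 fun i => by
    have := hA.eigenvalues_nonneg i
    exact_mod_cast (by positivity : 0 ≤ (hA.1.eigenvalues i + l)⁻¹)

theorem frac_eq {A : Matrix ι ι ℂ} (hA : A.PosSemidef) {l : ℝ} (hl : 0 < l) :
    frac l A = 1 - (l : ℂ) • rsv l A := by
  rw [eq_sub_iff_add_eq, rsv, mfun_smul hA.1, frac, mfun_add hA.1, ← mfun_one hA.1]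
  refine mfun_congr hA.1 fun i => ?_
  have : hA.1.eigenvalues i + l ≠ 0 := by have := hA.eigenvalues_nonneg i; positivity
  rw [← Complex.ofReal_mul, ← Complex.ofReal_add, ← Complex.ofReal_one]
  congr 1
  field_simp

/-- The tangent inequality for the operator concave function `x / (x + l)`. -/
theorem rtr_mul_frac_le {R τ ω : Matrix ι ι ℂ} (hR : R.PosSemidef) (hτ : τ.PosSemidef)
    (hω : ω.PosSemidef) {l : ℝ} (hl : 0 < l) :
    rtr (R * frac l τ) ≤ rtr (R * frac l ω) + l * (rtr (R * (rsv l ω * τ * rsv l ω)) -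
      rtr (R * (rsv l ω * ω * rsv l ω))) := by
  set Y := rsv l ω with hY
  set Z := rsv l τ with hZ
  set A := τ + (l : ℂ) • (1 : Matrix ι ι ℂ) with hA
  have hApos : A.PosSemidef := hτ.add (Matrix.PosSemidef.one.smul (by exact_mod_cast hl.le))
  have hYh : Y.conjTranspose = Y := (rsv_posSemidef hω hl).1
  have hZh : Z.conjTranspose = Z := (rsv_posSemidef hτ hl).1
  have hP : ((Z - Y) * A * (Z - Y)).PosSemidef := by
    have := hApos.conjTranspose_mul_mul_same (Z - Y)
    rwa [Matrix.conjTranspose_sub, hYh, hZh] at this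
  have h1 := rtr_mul_nonneg hR hP
  have e1 : (Z - Y) * A * (Z - Y) = Z - Y - Y + Y * A * Y := by
    have a1 : Z * A = 1 := rsv_mul hτ hl
    have a2 : A * Z = 1 := mul_rsv hτ hl
    rw [Matrix.sub_mul, a1, Matrix.sub_mul, Matrix.mul_sub, Matrix.one_mul, Matrix.one_mul,
      Matrix.mul_sub (Y * A), Matrix.mul_assoc Y A Z, a2, Matrix.mul_one]
    abel
  have e2 : Y * A * Y = Y * τ * Y - Y * ω * Y + Y := by
    have a3 : Y * (ω + (l : ℂ) • (1 : Matrix ι ι ℂ)) = 1 := rsv_mul hω hl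
    have a4 : Y * (ω + (l : ℂ) • (1 : Matrix ι ι ℂ)) * Y = Y := by rw [a3, Matrix.one_mul]
    have a5 : A = τ - ω + (ω + (l : ℂ) • (1 : Matrix ι ι ℂ)) := by rw [hA]; abel
    rw [a5, Matrix.mul_add, Matrix.add_mul, a4, Matrix.mul_sub, Matrix.sub_mul]
  rw [e1, e2, show Z - Y - Y + (Y * τ * Y - Y * ω * Y + Y) = Z - Y + (Y * τ * Y - Y * ω * Y) by abel,
    Matrix.mul_add, Matrix.mul_sub, Matrix.mul_sub, rtr_add, rtr_sub, rtr_sub] at h1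
  rw [frac_eq hτ hl, frac_eq hω hl, Matrix.mul_sub, Matrix.mul_sub, rtr_sub, rtr_sub,
    Matrix.mul_smul, Matrix.mul_smul, rtr_smul, rtr_smul]
  nlinarith

theorem re_pw {x : ℝ} (hx : 0 ≤ x) (a : ℝ) : pw (a : ℂ) x = ((if x = 0 then 0 else x ^ a : ℝ) : ℂ) := by
  rw [pw]
  split_ifs
  · simp
  · rw [Complex.ofReal_cpow hx]

theorem rtr_mul_mfun {A : Matrix ι ι ℂ} {V : Matrix ι κ ℂ} {μ : κ → ℝ}
    (h : SpecRep A V μ) (f : ℝ → ℝ) (R : Matrix ι ι ℂ) :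
    rtr (R * mfun (fun x => (f x : ℂ)) A) =
      ∑ j, f (μ j) * ((V.conjTranspose * R * V) j j).re := by
  rw [rtr, h.trace_mul_mfun, Complex.re_sum]
  simp_rw [Complex.re_ofReal_mul]

theorem mpow_eq_mfun_real {A : Matrix ι ι ℂ} (hA : A.PosSemidef) (a : ℝ) :
    mpow A (a : ℂ) = mfun (fun x => ((if x = 0 then 0 else x ^ a : ℝ) : ℂ)) A := by
  rw [mpow_eq_mfun]
  exact mfun_congr hA.1 fun i => re_pw (hA.eigenvalues_nonneg i) a

theorem integrableOn_rpow_mul_rtr_frac {τ : Matrix ι ι ℂ} (hτ : τ.PosSemidef)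
    (R : Matrix ι ι ℂ) {θ : ℝ} (h0 : 0 < θ) (h1 : θ < 1) :
    IntegrableOn (fun l : ℝ => l ^ (θ - 1) * rtr (R * frac l τ)) (Ioi 0) := by
  have h := specRep_eigen hτ.1
  simp_rw [frac, rtr_mul_mfun h, Finset.mul_sum, ← mul_assoc]
  exact integrable_finsetSum _ fun j _ =>
    Integrable.mul_const (integrableOn_rpow_mul_div_add h0 h1 (hτ.eigenvalues_nonneg j)) _

theorem integral_rpow_mul_rtr_frac {τ : Matrix ι ι ℂ} (hτ : τ.PosSemidef)
    (R : Matrix ι ι ℂ) {θ : ℝ} (h0 : 0 < θ) (h1 : θ < 1) :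
    ∫ l in Ioi (0 : ℝ), l ^ (θ - 1) * rtr (R * frac l τ) =
      rpowConst θ * rtr (R * mpow τ (θ : ℂ)) := by
  have h := specRep_eigen hτ.1
  rw [mpow_eq_mfun_real hτ]
  simp_rw [frac, rtr_mul_mfun h, Finset.mul_sum, ← mul_assoc]
  rw [integral_finsetSum _ fun j _ =>
    Integrable.mul_const (integrableOn_rpow_mul_div_add h0 h1 (hτ.eigenvalues_nonneg j)) _]
  refine Finset.sum_congr rfl fun j _ => ?_
  rw [integral_mul_const, integral_rpow_mul_div_add (hτ.eigenvalues_nonneg j)]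

theorem rtr_mul_mpow_mono {R τ τ' : Matrix ι ι ℂ} (hR : R.PosSemidef) (hτ : τ.PosSemidef)
    (hτ' : τ'.PosSemidef) (h : (τ' - τ).PosSemidef) {θ : ℝ} (h0 : 0 < θ) (h1 : θ < 1) :
    rtr (R * mpow τ (θ : ℂ)) ≤ rtr (R * mpow τ' (θ : ℂ)) := by
  refine le_of_mul_le_mul_left ?_ (rpowConst_pos h0 h1)
  rw [← integral_rpow_mul_rtr_frac hτ R h0 h1, ← integral_rpow_mul_rtr_frac hτ' R h0 h1]
  refine setIntegral_mono_on (integrableOn_rpow_mul_rtr_frac hτ R h0 h1)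
    (integrableOn_rpow_mul_rtr_frac hτ' R h0 h1) measurableSet_Ioi fun l hl => ?_
  have hl : 0 < l := hl
  refine mul_le_mul_of_nonneg_left ?_ (by positivity)
  have h2 := rtr_mul_frac_le hR hτ hτ' hl
  have h3 := (rsv_posSemidef hτ' hl).1
  have h4 := h.conjTranspose_mul_mul_same (rsv l τ')
  rw [h3] at h4
  have h5 := rtr_mul_nonneg hR h4
  rw [Matrix.mul_sub, Matrix.sub_mul, Matrix.mul_sub, rtr_sub] at h5
  nlinarith

theorem rtr_mul_mpow_concave {R τ τ' : Matrix ι ι ℂ} (hR : R.PosSemidef) (hτ : τ.PosSemidef)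
    (hτ' : τ'.PosSemidef) {θ : ℝ} (h0 : 0 < θ) (h1 : θ < 1) {p q : ℝ} (hp : 0 ≤ p) (hq : 0 ≤ q)
    (hpq : p + q = 1) :
    p * rtr (R * mpow τ (θ : ℂ)) + q * rtr (R * mpow τ' (θ : ℂ)) ≤
      rtr (R * mpow (p • τ + q • τ') (θ : ℂ)) := by
  have hω : (p • τ + q • τ').PosSemidef := (hτ.smul hp).add (hτ'.smul hq)
  refine le_of_mul_le_mul_left ?_ (rpowConst_pos h0 h1)
  have i1 := integrableOn_rpow_mul_rtr_frac hτ R h0 h1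
  have i2 := integrableOn_rpow_mul_rtr_frac hτ' R h0 h1
  have i3 := integrableOn_rpow_mul_rtr_frac hω R h0 h1
  rw [mul_add, mul_left_comm, mul_left_comm _ q, ← integral_rpow_mul_rtr_frac hτ R h0 h1,
    ← integral_rpow_mul_rtr_frac hτ' R h0 h1, ← integral_rpow_mul_rtr_frac hω R h0 h1,
    ← integral_const_mul, ← integral_const_mul, ← integral_add (i1.const_mul p) (i2.const_mul q)]
  refine setIntegral_mono_on ((i1.const_mul p).add (i2.const_mul q)) i3 measurableSet_Ioi
    fun l hl => ?_
  have hl : 0 < l := hl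
  have h2 := rtr_mul_frac_le hR hτ hω hl
  have h3 := rtr_mul_frac_le hR hτ' hω hl
  set ω := p • τ + q • τ' with hωd
  set Y := rsv l ω
  have e : rtr (R * (Y * ω * Y)) = p * rtr (R * (Y * τ * Y)) + q * rtr (R * (Y * τ' * Y)) := by
    rw [hωd, Matrix.mul_add, Matrix.add_mul, Matrix.mul_add, rtr_add, Matrix.mul_smul,
      Matrix.mul_smul, Matrix.smul_mul, Matrix.smul_mul, Matrix.mul_smul, Matrix.mul_smul,
      rtr_real_smul, rtr_real_smul]
  have h4 : p * rtr (R * frac l τ) + q * rtr (R * frac l τ') ≤ rtr (R * frac l ω) := by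
    have a1 := mul_le_mul_of_nonneg_left h2 hp
    have a2 := mul_le_mul_of_nonneg_left h3 hq
    have : rtr (R * frac l ω) = p * rtr (R * frac l ω) + q * rtr (R * frac l ω) := by
      rw [← add_mul, hpq, one_mul]
    rw [this]
    have e' : p * (l * (rtr (R * (Y * τ * Y)) - rtr (R * (Y * ω * Y)))) +
        q * (l * (rtr (R * (Y * τ' * Y)) - rtr (R * (Y * ω * Y)))) = 0 := by
      have : p = 1 - q := by linarith
      rw [e, this]; ring
    linarith
  have h5 : 0 ≤ l ^ (θ - 1) := by positivity
  calc _ = l ^ (θ - 1) * (p * rtr (R * frac l τ) + q * rtr (R * frac l τ')) := by ring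
    _ ≤ _ := mul_le_mul_of_nonneg_left h4 h5

theorem mpow_sub_posSemidef {τ τ' : Matrix ι ι ℂ} (hτ : τ.PosSemidef)
    (hτ' : τ'.PosSemidef) (h : (τ' - τ).PosSemidef) {θ : ℝ} (h0 : 0 < θ) (h1 : θ < 1) :
    (mpow τ' (θ : ℂ) - mpow τ (θ : ℂ)).PosSemidef := by
  refine posSemidef_of_rtr_nonneg ((mpow_posSemidef hτ' θ).1.sub (mpow_posSemidef hτ θ).1)
    fun R hR => ?_
  have := rtr_mul_mpow_mono hR hτ hτ' h h0 h1
  rw [Matrix.mul_sub, rtr_sub]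
  linarith

/-- Audenaert's inequality, in the form of a test between two positive semidefinite matrices. -/
theorem exists_test_le {A B : Matrix ι ι ℂ} (hA : A.PosSemidef) (hB : B.PosSemidef)
    {α : ℝ} (h0 : 0 < α) (h1 : α < 1) :
    ∃ T : Matrix ι ι ℂ, IsTest T ∧
      rtr ((1 - T) * A) + rtr (T * B) ≤ rtr (mpow A (α : ℂ) * mpow B ((1 - α : ℝ) : ℂ)) := by
  have hD : (A - B).IsHermitian := hA.1.sub hB.1
  set T := mfun (fun x => if 0 < x then 1 else 0) (A - B) with hT
  set N := mfun (fun x => ((max x 0 : ℝ) : ℂ)) (A - B) with hN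
  have hT1 : 1 - T = mfun (fun x => if 0 < x then 0 else 1) (A - B) := by
    rw [sub_eq_iff_eq_add, hT, mfun_add hD, ← mfun_one hD]
    congr 1
    funext x
    split_ifs <;> simp
  have hNpos : N.PosSemidef := mfun_posSemidef hD fun i => by
    exact_mod_cast le_max_right _ _
  have hNsub : (N - (A - B)).PosSemidef := by
    have : N - (A - B) = mfun (fun x => ((max x 0 - x : ℝ) : ℂ)) (A - B) := by
      have e := mfun_add hD (fun x => ((max x 0 - x : ℝ) : ℂ)) fun x => (x : ℂ)
      rw [mfun_id hD] at e
      rw [sub_eq_iff_eq_add, e]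
      refine mfun_congr hD fun i => ?_
      push_cast
      ring
    rw [this]
    refine mfun_posSemidef hD fun i => ?_
    exact_mod_cast sub_nonneg.2 (le_max_left _ _)
  have hTN : T * (A - B) = N := by
    nth_rw 1 [← mfun_id hD]
    rw [hT, mfun_mul hD, hN]
    congr 1
    funext x
    split_ifs with h
    · rw [max_eq_left h.le, one_mul]
    · rw [max_eq_right (not_lt.1 h), zero_mul, Complex.ofReal_zero]
  refine ⟨T, ⟨mfun_posSemidef hD fun i => ?_, ?_⟩, ?_⟩
  · split_ifs <;> simp
  · rw [hT1]
    refine mfun_posSemidef hD fun i => ?_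
    split_ifs <;> simp
  have hC : (B + N).PosSemidef := hB.add hNpos
  set C := B + N with hCd
  have hBC : (C - B).PosSemidef := by rw [hCd, add_sub_cancel_left]; exact hNpos
  have hAC : (C - A).PosSemidef := by
    rw [hCd, show B + N - A = N - (A - B) by abel]; exact hNsub
  have k0 : 0 < 1 - α := by linarith
  have k1 : 1 - α < 1 := by linarith
  have hpow : ∀ M : Matrix ι ι ℂ, M.PosSemidef →
      mpow M (α : ℂ) * mpow M ((1 - α : ℝ) : ℂ) = M := fun M hM => by
    rw [mpow_mul_mpow hM.1, ← Complex.ofReal_add, add_sub_cancel, Complex.ofReal_one, mpow_one hM.1]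
  have s1 := rtr_mul_mpow_mono (mpow_posSemidef hA α) hA hC hAC k0 k1
  have s2 := rtr_mul_mpow_mono (mpow_sub_posSemidef hB hC hBC k0 k1) hA hC hAC h0 h1
  have s3 := rtr_mul_mpow_mono (mpow_posSemidef hB (1 - α)) hB hC hBC h0 h1
  rw [hpow A hA] at s1
  have c1 := rtr_mul_comm (mpow C ((1 - α : ℝ) : ℂ)) (mpow A (α : ℂ))
  have c2 := rtr_mul_comm (mpow B ((1 - α : ℝ) : ℂ)) (mpow C (α : ℂ))
  have c3 := rtr_mul_comm (mpow B ((1 - α : ℝ) : ℂ)) (mpow A (α : ℂ))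
  have c4 := rtr_mul_comm (mpow C ((1 - α : ℝ) : ℂ)) (mpow C (α : ℂ))
  have c5 := rtr_mul_comm (mpow B ((1 - α : ℝ) : ℂ)) (mpow B (α : ℂ))
  rw [Matrix.sub_mul, Matrix.sub_mul, rtr_sub, rtr_sub] at s2
  rw [hpow C hC] at c4
  rw [hpow B hB] at c5
  have hCt : rtr C = rtr B + rtr N := by rw [hCd, rtr_add]
  have hTt : rtr (T * A) - rtr (T * B) = rtr N := by rw [← rtr_sub, ← Matrix.mul_sub, hTN]
  rw [Matrix.sub_mul, Matrix.one_mul, rtr_sub]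
  linarith

end Resolvent

section DividedDifference

variable {ι κ : Type*} [Fintype ι] [DecidableEq ι] [Fintype κ] [DecidableEq κ]

/-- The weighted trace of `B` sandwiched between resolvents of `ω`. -/
def jf (α : ℝ) (R ω B : Matrix ι ι ℂ) (l : ℝ) : ℝ :=
  l ^ (1 - α) * rtr (R * (rsv l ω * B * rsv l ω))

/-- The trace of `B` twisted by complex powers of `σ`. -/
def twist (α : ℝ) (R σ B : Matrix ι ι ℂ) (w : ℝ) : ℝ :=
  rtr (R * (mpow σ (-(((α / 2 : ℝ) : ℂ) + w * Complex.I)) * B *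
    mpow σ (-(((α / 2 : ℝ) : ℂ) - w * Complex.I))))

theorem jf_eq_sum {ω : Matrix ι ι ℂ} {V : Matrix ι κ ℂ} {μ : κ → ℝ} (h : SpecRep ω V μ)
    (α : ℝ) (R B : Matrix ι ι ℂ) (l : ℝ) :
    jf α R ω B l = ∑ i, ∑ j, l ^ (1 - α) / ((μ i + l) * (μ j + l)) *
      ((V.conjTranspose * R * V) j i * (V.conjTranspose * B * V) i j).re := by
  rw [jf, rsv, rtr, h.trace_mul_mfun_mul_mfun, Complex.re_sum, Finset.mul_sum]
  refine Finset.sum_congr rfl fun i _ => ?_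
  rw [Complex.re_sum, Finset.mul_sum]
  refine Finset.sum_congr rfl fun j _ => ?_
  rw [← Complex.ofReal_mul, Complex.re_ofReal_mul, ← mul_inv, ← mul_assoc, div_eq_mul_inv]

theorem measurable_jf {ω : Matrix ι ι ℂ} (hω : ω.IsHermitian) (α : ℝ) (R B : Matrix ι ι ℂ) :
    Measurable (jf α R ω B) := by
  have : jf α R ω B = _ := funext fun l => jf_eq_sum (specRep_eigen hω) α R B l
  rw [this]
  refine Finset.measurable_sum _ fun i _ => Finset.measurable_sum _ fun j _ => ?_
  fun_prop

theorem twist_eq_re_sum {σ : Matrix ι ι ℂ} {V : Matrix ι κ ℂ} {μ : κ → ℝ} (h : SpecRep σ V μ)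
    (α : ℝ) (R B : Matrix ι ι ℂ) (w : ℝ) :
    twist α R σ B w = (∑ i, ∑ j, (pw (-(((α / 2 : ℝ) : ℂ) + w * Complex.I)) (μ i) *
      pw (-(((α / 2 : ℝ) : ℂ) - w * Complex.I)) (μ j)) *
      ((V.conjTranspose * R * V) j i * (V.conjTranspose * B * V) i j)).re := by
  rw [twist, rtr, mpow_eq_mfun, mpow_eq_mfun, h.trace_mul_mfun_mul_mfun]

theorem continuous_pw_line (x a : ℝ) (s : ℂ) :
    Continuous fun w : ℝ => pw (-((a : ℂ) + s * w * Complex.I)) x := by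
  unfold pw
  split_ifs with h
  · exact continuous_const
  · have hx : (x : ℂ) ≠ 0 := by exact_mod_cast h
    exact Continuous.const_cpow (by fun_prop) (Or.inl hx)

theorem continuous_twist {σ : Matrix ι ι ℂ} (hσ : σ.IsHermitian) (α : ℝ) (R B : Matrix ι ι ℂ) :
    Continuous (twist α R σ B) := by
  have : twist α R σ B = _ := funext fun l => twist_eq_re_sum (specRep_eigen hσ) α R B l
  rw [this]
  refine Complex.continuous_re.comp (continuous_finsetSum _ fun i _ =>
    continuous_finsetSum _ fun j _ => (Continuous.mul ?_ ?_).mul continuous_const)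
  · simpa using continuous_pw_line (hσ.eigenvalues i) (α / 2) 1
  · simpa [sub_eq_add_neg] using continuous_pw_line (hσ.eigenvalues j) (α / 2) (-1)

theorem twist_self {σ : Matrix ι ι ℂ} (hσ : σ.PosSemidef) (α : ℝ) (R : Matrix ι ι ℂ) (w : ℝ) :
    twist α R σ σ w = rtr (R * mpow σ ((1 - α : ℝ) : ℂ)) := by
  have e : mpow σ (-(((α / 2 : ℝ) : ℂ) + w * Complex.I)) * σ *
    mpow σ (-(((α / 2 : ℝ) : ℂ) - w * Complex.I)) = mpow σ ((1 - α : ℝ) : ℂ) := by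
    nth_rw 2 [← mpow_one hσ.1]
    rw [mpow_mul_mpow hσ.1, mpow_mul_mpow hσ.1]
    congr 1
    push_cast
    ring
  rw [twist, e]

theorem integral_jf {σ : Matrix ι ι ℂ} (hσ : σ.PosSemidef) {α : ℝ} (h0 : 0 < α) (h1 : α < 1)
    {R B : Matrix ι ι ℂ} {V : Matrix ι ι ℂ} (hV : V = (hσ.1.eigenvectorUnitary : Matrix ι ι ℂ))
    (hz : ∀ i j, hσ.1.eigenvalues i = 0 ∨ hσ.1.eigenvalues j = 0 →
      (V.conjTranspose * R * V) j i * (V.conjTranspose * B * V) i j = 0) :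
    IntegrableOn (jf α R σ B) (Ioi 0) ∧ Integrable (fun w => divDiffKernel α w * twist α R σ B w) ∧
      ∫ l in Ioi 0, jf α R σ B l = ∫ w, divDiffKernel α w * twist α R σ B w := by
  subst hV
  have h := specRep_eigen hσ.1
  set V := (hσ.1.eigenvectorUnitary : Matrix ι ι ℂ)
  set μ := hσ.1.eigenvalues
  set c : ι → ι → ℂ := fun i j => (V.conjTranspose * R * V) j i * (V.conjTranspose * B * V) i j
    with hc
  have hμ : ∀ i, 0 ≤ μ i := hσ.eigenvalues_nonneg
  have key : ∀ i j, c i j = 0 ∨ (0 < μ i ∧ 0 < μ j) := fun i j => by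
    by_cases hi : μ i = 0
    · exact Or.inl (hz i j (Or.inl hi))
    by_cases hj : μ j = 0
    · exact Or.inl (hz i j (Or.inr hj))
    exact Or.inr ⟨lt_of_le_of_ne (hμ i) (Ne.symm hi), lt_of_le_of_ne (hμ j) (Ne.symm hj)⟩
  have i1 : ∀ i j, IntegrableOn (fun l : ℝ => l ^ (1 - α) / ((μ i + l) * (μ j + l)) * (c i j).re)
      (Ioi 0) := fun i j => by
    rcases key i j with h | ⟨hi, hj⟩
    · simp [h]
    · exact (integrableOn_rpow_div_add_mul_add h0 h1 hi hj).mul_const _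
  set g : ι → ι → ℝ → ℂ := fun i j w => (divDiffKernel α w : ℂ) *
    (pw (-(((α / 2 : ℝ) : ℂ) + w * Complex.I)) (μ i) *
      pw (-(((α / 2 : ℝ) : ℂ) - w * Complex.I)) (μ j)) * c i j with hg
  have i2 : ∀ i j, Integrable (g i j) := fun i j => by
    rcases key i j with h | ⟨hi, hj⟩
    · simp [hg, h]
    · refine Integrable.mul_const ?_ _
      refine Integrable.mono' ((integrable_divDiffKernel h0 h1).mul_const
        (μ i ^ (-(α / 2)) * μ j ^ (-(α / 2)))) ?_ (ae_of_all _ fun w => le_of_eq ?_)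
      · refine Continuous.aestronglyMeasurable ?_
        refine (Complex.continuous_ofReal.comp (continuous_divDiffKernel h0 h1)).mul
          (Continuous.mul ?_ ?_)
        · simpa using continuous_pw_line (μ i) (α / 2) 1
        · simpa [sub_eq_add_neg] using continuous_pw_line (μ j) (α / 2) (-1)
      · have a1 := norm_ofReal_cpow hi (α / 2) w
        have a2 := norm_ofReal_cpow hj (α / 2) (-w)
        rw [Complex.ofReal_neg, neg_mul, ← sub_eq_add_neg] at a2
        rw [norm_mul, norm_mul, pw, pw, if_neg hi.ne', if_neg hj.ne', a1, a2,
          Complex.norm_real, Real.norm_of_nonneg (divDiffKernel_pos h0 h1 w).le]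
  have e2 : ∀ i j, (∫ l in Ioi (0 : ℝ), l ^ (1 - α) / ((μ i + l) * (μ j + l)) * (c i j).re) =
      (∫ w, g i j w).re := fun i j => by
    rcases key i j with h | ⟨hi, hj⟩
    · simp [hg, h]
    · rw [hg, integral_mul_const, integral_mul_const]
      have := integral_rpow_div_add_mul_add h0 h1 hi hj
      simp only [pw, if_neg hi.ne', if_neg hj.ne']
      rw [← this, Complex.re_ofReal_mul]
  have ej : jf α R σ B = fun l => ∑ i, ∑ j, l ^ (1 - α) / ((μ i + l) * (μ j + l)) * (c i j).re :=
    funext fun l => jf_eq_sum h α R B l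
  have et : (fun w => divDiffKernel α w * twist α R σ B w) =
      fun w => (∑ i, ∑ j, g i j w).re := funext fun w => by
    rw [twist_eq_re_sum h, ← Complex.re_ofReal_mul, Finset.mul_sum]
    refine congrArg Complex.re (Finset.sum_congr rfl fun i _ => ?_)
    rw [Finset.mul_sum]
    refine Finset.sum_congr rfl fun j _ => ?_
    rw [hg, hc]
    ring
  have i3 : Integrable fun w => ∑ i, ∑ j, g i j w :=
    integrable_finsetSum _ fun i _ => integrable_finsetSum _ fun j _ => i2 i j
  refine ⟨?_, ?_, ?_⟩
  · rw [ej]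
    exact integrable_finsetSum _ fun i _ => integrable_finsetSum _ fun j _ => i1 i j
  · rw [et]
    exact i3.re
  · rw [et, ej, integral_finsetSum _ fun i _ => integrable_finsetSum _ fun j _ => i1 i j]
    have : ∫ w, (∑ i, ∑ j, g i j w).re = (∫ w, ∑ i, ∑ j, g i j w).re := by
      exact integral_re i3
    rw [this, integral_finsetSum _ fun i _ => integrable_finsetSum _ fun j _ => i2 i j,
      Complex.re_sum]
    refine Finset.sum_congr rfl fun i _ => ?_
    rw [integral_finsetSum _ fun j _ => i1 i j, integral_finsetSum _ fun j _ => i2 i j,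
      Complex.re_sum]
    exact Finset.sum_congr rfl fun j _ => e2 i j

theorem conj_diag {σ : Matrix ι ι ℂ} {V : Matrix ι κ ℂ} {μ : κ → ℝ} (h : SpecRep σ V μ) :
    V.conjTranspose * σ * V = Matrix.diagonal fun i => (μ i : ℂ) := by
  calc _ = (V.conjTranspose * V) * Matrix.diagonal (fun i => (μ i : ℂ)) *
        (V.conjTranspose * V) := by
        conv_lhs => rw [h.eq]
        simp only [Matrix.mul_assoc]
    _ = _ := by rw [h.conj_mul, Matrix.one_mul, Matrix.mul_one]

theorem integral_jf_self {σ : Matrix ι ι ℂ} (hσ : σ.PosSemidef) {α : ℝ} (h0 : 0 < α) (h1 : α < 1)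
    (R : Matrix ι ι ℂ) :
    IntegrableOn (jf α R σ σ) (Ioi 0) ∧
      ∫ l in Ioi 0, jf α R σ σ l =
        (∫ w, divDiffKernel α w) * rtr (R * mpow σ ((1 - α : ℝ) : ℂ)) := by
  have := integral_jf hσ h0 h1 (R := R) (B := σ) rfl fun i j hij => by
    rw [conj_diag (specRep_eigen hσ.1), Matrix.diagonal_apply]
    split_ifs with h
    · subst h
      rcases hij with h | h <;> simp [h]
    · simp
  refine ⟨this.1, ?_⟩
  rw [this.2.2]
  simp_rw [twist_self hσ]
  rw [integral_mul_const]

theorem jf_nonneg {R ω B : Matrix ι ι ℂ} (hR : R.PosSemidef) (hω : ω.PosSemidef)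
    (hB : B.PosSemidef) (α : ℝ) {l : ℝ} (hl : 0 < l) : 0 ≤ jf α R ω B l := by
  have h := hB.conjTranspose_mul_mul_same (rsv l ω)
  rw [(rsv_posSemidef hω hl).1] at h
  exact mul_nonneg (by positivity) (rtr_mul_nonneg hR h)

theorem jf_add (α : ℝ) (R ω B B' : Matrix ι ι ℂ) (l : ℝ) :
    jf α R ω (B + B') l = jf α R ω B l + jf α R ω B' l := by
  simp only [jf, Matrix.add_mul, rtr_add, mul_add]

theorem jf_smul (α : ℝ) (R ω B : Matrix ι ι ℂ) (c l : ℝ) :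
    jf α R ω (c • B) l = c * jf α R ω B l := by
  simp only [jf, Matrix.mul_smul, Matrix.smul_mul, rtr_real_smul]
  ring

end DividedDifference

section SupportBound

variable {ι κ : Type*} [Fintype ι] [DecidableEq ι] [Fintype κ] [DecidableEq κ]

theorem PosSemidef.apply_eq_zero_of_diag {A : Matrix ι ι ℂ} (hA : A.PosSemidef) {j : ι}
    (hj : A j j = 0) (i : ι) : A i j = 0 := by
  obtain ⟨C, rfl⟩ : ∃ C : Matrix ι ι ℂ, A = C.conjTranspose * C := by
    refine ⟨mpow A ((1 / 2 : ℝ) : ℂ), ?_⟩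
    rw [(mpow_posSemidef hA _).1, mpow_mul_mpow hA.1, ← Complex.ofReal_add, add_halves,
      Complex.ofReal_one, mpow_one hA.1]
  have h : ∀ k, C k j = 0 := by
    rw [Matrix.mul_apply] at hj
    have h2 : ∑ k, Complex.normSq (C k j) = 0 := by
      have := congrArg Complex.re hj
      rw [Complex.re_sum] at this
      rw [← Complex.zero_re, ← this]
      refine Finset.sum_congr rfl fun k _ => ?_
      rw [Matrix.conjTranspose_apply, Complex.star_def, ← Complex.normSq_eq_conj_mul_self,
        Complex.ofReal_re]
    intro k
    exact Complex.normSq_eq_zero.1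
      ((Finset.sum_eq_zero_iff_of_nonneg fun k _ => Complex.normSq_nonneg _).1 h2 k
        (Finset.mem_univ k))
  rw [Matrix.mul_apply]
  exact Finset.sum_eq_zero fun k _ => by rw [h k, mul_zero]

theorem eigenvalues_le_rtr {A : Matrix ι ι ℂ} (hA : A.PosSemidef) (i : ι) :
    hA.1.eigenvalues i ≤ rtr A := by
  have : rtr A = ∑ i, hA.1.eigenvalues i := by
    rw [rtr, hA.1.trace_eq_sum_eigenvalues, Complex.re_sum]
    rfl
  rw [this]
  exact Finset.single_le_sum (fun i _ => hA.eigenvalues_nonneg i) (Finset.mem_univ i)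

theorem rtr_smul_one_sub_posSemidef {A : Matrix ι ι ℂ} (hA : A.PosSemidef) :
    ((rtr A : ℂ) • (1 : Matrix ι ι ℂ) - A).PosSemidef := by
  have e := mfun_add hA.1 (fun x => ((rtr A - x : ℝ) : ℂ)) fun x => (x : ℂ)
  rw [mfun_id hA.1] at e
  have e2 : (rtr A : ℂ) • (1 : Matrix ι ι ℂ) = mfun (fun _ => (rtr A : ℂ) * 1) A := by
    rw [← mfun_smul hA.1, mfun_one hA.1]
  have : (rtr A : ℂ) • (1 : Matrix ι ι ℂ) - A = mfun (fun x => ((rtr A - x : ℝ) : ℂ)) A := by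
    rw [sub_eq_iff_eq_add, e, e2]
    refine mfun_congr hA.1 fun i => ?_
    push_cast
    ring
  rw [this]
  refine mfun_posSemidef hA.1 fun i => ?_
  exact_mod_cast sub_nonneg.2 (eigenvalues_le_rtr hA i)

theorem exists_eq_mul_of_msupp_le {A B : Matrix ι ι ℂ} (h : msupp A ≤ msupp B) :
    ∃ M : Matrix ι ι ℂ, A = B * M := by
  have : ∀ j, ∃ v : ι → ℂ, B.mulVec v = A.mulVec (Pi.single j 1) := fun j => by
    have : A.mulVec (Pi.single j 1) ∈ msupp B := h ⟨Pi.single j 1, rfl⟩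
    exact this
  choose v hv using this
  refine ⟨Matrix.of fun i j => v j i, ?_⟩
  ext i j
  have := congrFun (hv j) i
  rw [Matrix.mulVec_single_one] at this
  rw [Matrix.mul_apply]
  exact this.symm

/-- Powers of `A` are dominated by any matrix whose support contains that of `A`. -/
theorem exists_smul_sub_mpow_posSemidef {A B : Matrix ι ι ℂ} (hA : A.PosSemidef)
    (hB : B.PosSemidef) (h : msupp A ≤ msupp B) (a : ℝ) :
    ∃ C : ℝ, ((C : ℂ) • B - mpow A (a : ℂ)).PosSemidef := by
  obtain ⟨M₀, hM₀⟩ := exists_eq_mul_of_msupp_le h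
  set H := mpow A ((a / 2 : ℝ) : ℂ) with hH
  set M := M₀ * mpow A ((a / 2 - 1 : ℝ) : ℂ) with hM
  have hHM : H = B * M := by
    rw [hM, ← Matrix.mul_assoc, ← hM₀]
    nth_rw 1 [← mpow_one hA.1]
    rw [mpow_mul_mpow hA.1, hH]
    congr 1
    push_cast
    ring
  have hHh : H.conjTranspose = H := (mpow_posSemidef hA _).1
  have hAa : mpow A (a : ℂ) = H * H := by
    rw [hH, mpow_mul_mpow hA.1, ← Complex.ofReal_add, add_halves]
  have e1 : mpow A (a : ℂ) = B * (M * M.conjTranspose) * B := by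
    have : H = M.conjTranspose * B := by
      rw [← hHh, hHM, Matrix.conjTranspose_mul, hB.1]
    rw [hAa]
    nth_rw 1 [hHM]
    rw [this]
    simp only [Matrix.mul_assoc]
  have hP : (M * M.conjTranspose).PosSemidef := Matrix.posSemidef_self_mul_conjTranspose M
  set P := M * M.conjTranspose
  have h1 := (rtr_smul_one_sub_posSemidef hP).conjTranspose_mul_mul_same B
  rw [hB.1] at h1
  set G := mpow B ((1 / 2 : ℝ) : ℂ) with hG
  have hGh : G.conjTranspose = G := (mpow_posSemidef hB _).1
  have hGG : G * G = B := by
    rw [hG, mpow_mul_mpow hB.1, ← Complex.ofReal_add, add_halves, Complex.ofReal_one, mpow_one hB.1]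
  have h2 := (rtr_smul_one_sub_posSemidef hB).conjTranspose_mul_mul_same G
  rw [hGh] at h2
  have hBG : G * B * G = B * B := by
    rw [← hGG]
    simp only [Matrix.mul_assoc]
  have hPt : 0 ≤ rtr P := by simpa using rtr_mul_nonneg Matrix.PosSemidef.one hP
  have h3 := h1.add (h2.smul (by exact_mod_cast hPt : (0 : ℂ) ≤ (rtr P : ℂ)))
  refine ⟨rtr P * rtr B, ?_⟩
  convert h3 using 1
  rw [e1]
  simp only [Matrix.mul_sub, Matrix.sub_mul, Matrix.mul_smul, Matrix.smul_mul, Matrix.mul_one,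
    hBG, hGG, smul_sub, smul_smul, Complex.ofReal_mul]
  abel

/-- If `R` is dominated by `τ` and `τ` has integrable resolvent trace at `σ`, then `R` vanishes on
the kernel of `σ`. -/
theorem conj_diag_eq_zero_of_integrableOn_jf {R σ τ : Matrix ι ι ℂ} (hR : R.PosSemidef)
    (hσ : σ.PosSemidef) {C : ℝ} (hC : ((C : ℂ) • τ - R).PosSemidef) {α : ℝ}
    (hI : IntegrableOn (jf α R σ τ) (Ioi 0)) {V : Matrix ι ι ℂ}
    (hV : V = (hσ.1.eigenvectorUnitary : Matrix ι ι ℂ)) {j : ι} (hj : hσ.1.eigenvalues j = 0) :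
    (V.conjTranspose * R * V) j j = 0 := by
  subst hV
  have h := specRep_eigen hσ.1
  set V := (hσ.1.eigenvectorUnitary : Matrix ι ι ℂ)
  set μ := hσ.1.eigenvalues
  have hμ : ∀ i, 0 ≤ μ i := hσ.eigenvalues_nonneg
  have hR' : (V.conjTranspose * R * V).PosSemidef := hR.conjTranspose_mul_mul_same V
  set R' := V.conjTranspose * R * V
  set x := (R' j j).re with hx
  have hle : ∀ l : ℝ, 0 < l → l ^ (-1 - α) * x ^ 2 ≤ C * jf α R σ τ l := fun l hl => by
    have h1 := jf_nonneg hR hσ hC α hl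
    have e : (C : ℂ) • τ - R = C • τ + (-1 : ℝ) • R := by
      rw [sub_eq_add_neg, neg_smul, one_smul]; rfl
    rw [e, jf_add, jf_smul, jf_smul] at h1
    have h2 : l ^ (-1 - α) * x ^ 2 ≤ jf α R σ R l := by
      rw [jf_eq_sum h]
      have hnn : ∀ a b, 0 ≤ l ^ (1 - α) / ((μ a + l) * (μ b + l)) *
          (R' b a * R' a b).re := fun a b => by
        have : R' b a = (starRingEnd ℂ) (R' a b) := (hR'.1.apply b a).symm
        rw [this, ← Complex.normSq_eq_conj_mul_self, Complex.ofReal_re]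
        have := hμ a
        have := hμ b
        have := Complex.normSq_nonneg (R' a b)
        positivity
      refine le_trans ?_ (Finset.single_le_sum (fun a _ => Finset.sum_nonneg fun b _ => hnn a b)
        (Finset.mem_univ j))
      refine le_trans (le_of_eq ?_) (Finset.single_le_sum (fun b _ => hnn j b)
        (Finset.mem_univ j))
      rw [hj, zero_add, diag_eq_re hR' j, ← Complex.ofReal_mul, Complex.ofReal_re, ← hx,
        show (-1 - α) = (1 - α) - 2 by ring, Real.rpow_sub hl, Real.rpow_two]
      ring
    linarith
  rw [diag_eq_re hR' j, ← hx]
  by_contra hne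
  have hx0 : x ≠ 0 := fun h => hne (by rw [h, Complex.ofReal_zero])
  refine not_integrableOn_Ioi_rpow (-1 - α) ?_
  have h3 : IntegrableOn (fun l : ℝ => l ^ (-1 - α) * x ^ 2) (Ioi 0) := by
    refine Integrable.mono' (hI.const_mul C) (by fun_prop) ?_
    refine (ae_restrict_mem measurableSet_Ioi).mono fun l hl => ?_
    have hl : 0 < l := hl
    rw [Real.norm_of_nonneg (by positivity)]
    exact hle l hl
  have h4 := h3.mul_const (x ^ 2)⁻¹
  refine h4.congr (ae_of_all _ fun l => ?_)
  field_simp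

theorem tendsto_rsv {ω : ℕ → Matrix ι ι ℂ} {σ : Matrix ι ι ℂ} (hω : ∀ n, (ω n).PosSemidef)
    (hσ : σ.PosSemidef) (h : Tendsto ω atTop (nhds σ)) {l : ℝ} (hl : 0 < l) :
    Tendsto (fun n => rsv l (ω n)) atTop (nhds (rsv l σ)) := by
  have e : ∀ {A : Matrix ι ι ℂ}, A.PosSemidef →
      rsv l A = ((A + (l : ℂ) • (1 : Matrix ι ι ℂ)).det)⁻¹ •
        (A + (l : ℂ) • (1 : Matrix ι ι ℂ)).adjugate := fun {A} hA => by
    rw [← Matrix.inv_eq_left_inv (rsv_mul hA hl), Matrix.inv_def, Ring.inverse_eq_inv']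
  rw [e hσ, funext fun n => e (hω n)]
  have h1 : Tendsto (fun n => ω n + (l : ℂ) • (1 : Matrix ι ι ℂ)) atTop
      (nhds (σ + (l : ℂ) • (1 : Matrix ι ι ℂ))) := h.add_const _
  have h2 : (σ + (l : ℂ) • (1 : Matrix ι ι ℂ)).det ≠ 0 := by
    have := congrArg Matrix.det (rsv_mul hσ hl)
    rw [Matrix.det_mul, Matrix.det_one] at this
    exact right_ne_zero_of_mul_eq_one this
  have c1 : Continuous fun A : Matrix ι ι ℂ => A.det := continuous_id.matrix_det
  have c2 : Continuous fun A : Matrix ι ι ℂ => A.adjugate := continuous_id.matrix_adjugate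
  exact ((c1.tendsto _).comp h1 |>.inv₀ h2).smul ((c2.tendsto _).comp h1)

/-- The directional derivative of `R ↦ Tr R σ^(1-α)` controls the resolvent integral. -/
theorem integrableOn_jf_of_le {R σ τ : Matrix ι ι ℂ} (hR : R.PosSemidef)
    (hσ : σ.PosSemidef) (hτ : τ.PosSemidef) {α : ℝ} (h0 : 0 < α) (h1 : α < 1)
    (hle : ∀ ε : ℝ, 0 < ε → ε < 1 → rtr (R * mpow ((1 - ε) • σ + ε • τ) ((1 - α : ℝ) : ℂ)) ≤
      rtr (R * mpow σ ((1 - α : ℝ) : ℂ))) :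
    IntegrableOn (jf α R σ τ) (Ioi 0) ∧ ∫ l in Ioi 0, jf α R σ τ l ≤
      (∫ w, divDiffKernel α w) * rtr (R * mpow σ ((1 - α : ℝ) : ℂ)) := by
  set K := ∫ w, divDiffKernel α w with hK
  set Q := rtr (R * mpow σ ((1 - α : ℝ) : ℂ)) with hQ
  have hK0 : 0 ≤ K := integral_nonneg fun w => (divDiffKernel_pos h0 h1 w).le
  have hQ0 : 0 ≤ Q := rtr_mul_nonneg hR (mpow_posSemidef hσ _)
  have main : ∀ ε : ℝ, 0 < ε → ε < 1 → ((1 - ε) • σ + ε • τ).PosSemidef ∧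
      IntegrableOn (jf α R ((1 - ε) • σ + ε • τ) τ) (Ioi 0) ∧
      ∫ l in Ioi 0, jf α R ((1 - ε) • σ + ε • τ) τ l ≤ K * Q := fun ε e0 e1 => by
    have hεQ := hle ε e0 e1
    have k1 : 0 < 1 - ε := by linarith
    have hω : ((1 - ε) • σ + ε • τ).PosSemidef := (hσ.smul k1.le).add (hτ.smul e0.le)
    have hs : ∀ l, jf α R ((1 - ε) • σ + ε • τ) ((1 - ε) • σ + ε • τ) l =
        (1 - ε) * jf α R ((1 - ε) • σ + ε • τ) σ l + ε * jf α R ((1 - ε) • σ + ε • τ) τ l :=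
      fun l => by rw [jf_add, jf_smul, jf_smul]
    set ω := (1 - ε) • σ + ε • τ
    obtain ⟨hI, hIe⟩ := integral_jf_self hω h0 h1 R
    have n1 : ∀ l : ℝ, 0 < l → 0 ≤ jf α R ω σ l := fun l hl => jf_nonneg hR hω hσ α hl
    have n2 : ∀ l : ℝ, 0 < l → 0 ≤ jf α R ω τ l := fun l hl => jf_nonneg hR hω hτ α hl
    have i1 : IntegrableOn (jf α R ω σ) (Ioi 0) := by
      refine Integrable.mono' (hI.const_mul (1 - ε)⁻¹)
        (measurable_jf hω.1 α R σ).aestronglyMeasurable ?_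
      refine (ae_restrict_mem measurableSet_Ioi).mono fun l hl => ?_
      rw [Real.norm_of_nonneg (n1 l hl), le_inv_mul_iff₀ k1, hs]
      have := mul_nonneg e0.le (n2 l hl)
      linarith
    have i2 : IntegrableOn (jf α R ω τ) (Ioi 0) := by
      refine Integrable.mono' (hI.const_mul ε⁻¹)
        (measurable_jf hω.1 α R τ).aestronglyMeasurable ?_
      refine (ae_restrict_mem measurableSet_Ioi).mono fun l hl => ?_
      rw [Real.norm_of_nonneg (n2 l hl), le_inv_mul_iff₀ e0, hs]
      have := mul_nonneg k1.le (n1 l hl)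
      linarith
    have k0 : 0 < 1 - α := by linarith
    have k2 : 1 - α < 1 := by linarith
    have hsum : ∫ l in Ioi 0, jf α R ω ω l =
        (1 - ε) * (∫ l in Ioi 0, jf α R ω σ l) + ε * ∫ l in Ioi 0, jf α R ω τ l := by
      simp_rw [hs]
      rw [integral_add (i1.const_mul _) (i2.const_mul _), integral_const_mul, integral_const_mul]
    have htan : (∫ l in Ioi (0 : ℝ), l ^ (1 - α - 1) * rtr (R * frac l σ)) ≤
        ∫ l in Ioi (0 : ℝ), (l ^ (1 - α - 1) * rtr (R * frac l ω) +
          (jf α R ω σ l - jf α R ω ω l)) := by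
      refine setIntegral_mono_on (integrableOn_rpow_mul_rtr_frac hσ R k0 k2)
        ((integrableOn_rpow_mul_rtr_frac hω R k0 k2).add (i1.sub hI)) measurableSet_Ioi
        fun l hl => ?_
      have hl : 0 < l := hl
      have h2 := mul_le_mul_of_nonneg_left (rtr_mul_frac_le hR hσ hω hl)
        (Real.rpow_nonneg hl.le (1 - α - 1))
      refine h2.trans (le_of_eq ?_)
      have e3 : l ^ (1 - α) = l ^ (1 - α - 1) * l := by
        rw [Real.rpow_sub_one hl.ne', div_mul_cancel₀ _ hl.ne']
      simp only [jf, e3]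
      ring
    have i3 : IntegrableOn (fun l => jf α R ω σ l - jf α R ω ω l) (Ioi 0) := i1.sub hI
    rw [integral_add (integrableOn_rpow_mul_rtr_frac hω R k0 k2) i3,
      integral_sub i1 hI, integral_rpow_mul_rtr_frac hσ R k0 k2,
      integral_rpow_mul_rtr_frac hω R k0 k2] at htan
    have h3 := mul_le_mul_of_nonneg_left hεQ (rpowConst_pos k0 k2).le
    refine ⟨hω, i2, ?_⟩
    have h4 := mul_le_mul_of_nonneg_left hεQ hK0
    rw [hsum] at htan hIe
    nlinarith
  set ε : ℕ → ℝ := fun n => 1 / ((n : ℝ) + 2) with hε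
  have hε0 : ∀ n, 0 < ε n := fun n => by positivity
  have hε1 : ∀ n, ε n < 1 := fun n => by
    rw [hε]
    simp only
    rw [div_lt_one (by positivity)]
    have : (0 : ℝ) ≤ n := n.cast_nonneg
    linarith
  have hεt : Tendsto ε atTop (nhds 0) := by
    have := (tendsto_add_atTop_iff_nat 1).2 (tendsto_one_div_add_atTop_nhds_zero_nat (𝕜 := ℝ))
    refine this.congr fun n => ?_
    rw [hε]
    push_cast
    ring_nf
  have hωt : Tendsto (fun n => (1 - ε n) • σ + ε n • τ) atTop (nhds σ) := by
    have := ((tendsto_const_nhds (x := (1 : ℝ))).sub hεt).smul_const σ |>.add (hεt.smul_const τ)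
    simpa using this
  have hlim : ∀ l : ℝ, 0 < l → Tendsto (fun n => jf α R ((1 - ε n) • σ + ε n • τ) τ l) atTop
      (nhds (jf α R σ τ l)) := fun l hl => by
    have h := tendsto_rsv (fun n => (main _ (hε0 n) (hε1 n)).1) hσ hωt hl
    have c : Continuous fun Y : Matrix ι ι ℂ => l ^ (1 - α) * rtr (R * (Y * τ * Y)) := by
      unfold rtr
      fun_prop
    exact (c.tendsto _).comp h
  have hlint : ∫⁻ l in Ioi (0 : ℝ), ENNReal.ofReal (jf α R σ τ l) ≤ ENNReal.ofReal (K * Q) := by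
    calc _ = ∫⁻ l in Ioi (0 : ℝ), liminf (fun n =>
          ENNReal.ofReal (jf α R ((1 - ε n) • σ + ε n • τ) τ l)) atTop := by
          refine setLIntegral_congr_fun measurableSet_Ioi fun l hl => ?_
          exact ((ENNReal.continuous_ofReal.tendsto _).comp (hlim l hl)).liminf_eq.symm
      _ ≤ liminf (fun n => ∫⁻ l in Ioi (0 : ℝ),
          ENNReal.ofReal (jf α R ((1 - ε n) • σ + ε n • τ) τ l)) atTop := by
          refine lintegral_liminf_le fun n => ?_
          exact (measurable_jf (main _ (hε0 n) (hε1 n)).1.1 α R τ).ennreal_ofReal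
      _ ≤ liminf (fun _ : ℕ => ENNReal.ofReal (K * Q)) atTop := by
          refine liminf_le_liminf (Eventually.of_forall fun n => ?_)
          obtain ⟨a1, a2, a3⟩ := main _ (hε0 n) (hε1 n)
          rw [← ofReal_integral_eq_lintegral_ofReal a2
            ((ae_restrict_mem measurableSet_Ioi).mono fun l hl => jf_nonneg hR a1 hτ α hl)]
          exact ENNReal.ofReal_le_ofReal a3
      _ = _ := by simp
  have hnn : 0 ≤ᵐ[volume.restrict (Ioi (0 : ℝ))] jf α R σ τ :=
    (ae_restrict_mem measurableSet_Ioi).mono fun l hl => jf_nonneg hR hσ hτ α hl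
  have hI : IntegrableOn (jf α R σ τ) (Ioi 0) := by
    refine ⟨(measurable_jf hσ.1 α R τ).aestronglyMeasurable, ?_⟩
    rw [hasFiniteIntegral_iff_ofReal hnn]
    exact hlint.trans_lt ENNReal.ofReal_lt_top
  refine ⟨hI, ?_⟩
  rw [← ofReal_integral_eq_lintegral_ofReal hI hnn] at hlint
  exact (ENNReal.ofReal_le_ofReal_iff (mul_nonneg hK0 hQ0)).1 hlint

end SupportBound

section Tensor

variable {ι κ ν : Type*} [Fintype ι] [DecidableEq ι] [Fintype κ] [DecidableEq κ] [Fintype ν]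
  [DecidableEq ν]

/-- The `k`-fold tensor power of a rectangular matrix, indexed by tuples. -/
def kpow (U : Matrix ι κ ℂ) (k : ℕ) : Matrix (Fin k → ι) (Fin k → κ) ℂ :=
  Matrix.of fun x y => ∏ i, U (x i) (y i)

theorem kpow_apply (U : Matrix ι κ ℂ) (k : ℕ) (x : Fin k → ι) (y : Fin k → κ) :
    kpow U k x y = ∏ i, U (x i) (y i) := rfl

theorem kpow_mul (A : Matrix ι κ ℂ) (B : Matrix κ ν ℂ) (k : ℕ) :
    kpow (A * B) k = kpow A k * kpow B k := by
  ext x y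
  simp only [kpow_apply, Matrix.mul_apply, ← Finset.prod_mul_distrib]
  rw [Finset.prod_univ_sum, Fintype.piFinset_univ]

theorem kpow_conjTranspose (A : Matrix ι κ ℂ) (k : ℕ) :
    (kpow A k).conjTranspose = kpow A.conjTranspose k := by
  ext x y
  simp [kpow_apply, Matrix.conjTranspose_apply]

theorem kpow_diagonal (f : ι → ℂ) (k : ℕ) :
    kpow (Matrix.diagonal f) k = Matrix.diagonal fun x => ∏ i, f (x i) := by
  ext x y
  rw [kpow_apply, Matrix.diagonal_apply]
  split_ifs with h
  · subst h
    simp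
  · obtain ⟨i, hi⟩ := Function.ne_iff.1 h
    exact Finset.prod_eq_zero (Finset.mem_univ i) (Matrix.diagonal_apply_ne _ hi)

theorem kpow_one (k : ℕ) : kpow (1 : Matrix ι ι ℂ) k = 1 := by
  rw [← Matrix.diagonal_one, kpow_diagonal, ← Matrix.diagonal_one]
  simp

theorem trace_kpow (A : Matrix ι ι ℂ) (k : ℕ) : (kpow A k).trace = A.trace ^ k := by
  simp only [Matrix.trace, Matrix.diag_apply, kpow_apply]
  rw [← Finset.card_fin k, ← Finset.prod_const, Finset.prod_univ_sum, Fintype.piFinset_univ,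
    Finset.card_fin]

theorem SpecRep.kpow {A : Matrix ι ι ℂ} {V : Matrix ι κ ℂ} {μ : κ → ℝ} (h : SpecRep A V μ)
    (k : ℕ) : SpecRep (kpow A k) (kpow V k) fun x => ∏ i, μ (x i) where
  mul_conj := by rw [kpow_conjTranspose, ← kpow_mul, h.mul_conj, kpow_one]
  conj_mul := by rw [kpow_conjTranspose, ← kpow_mul, h.conj_mul, kpow_one]
  eq := by
    conv_lhs => rw [h.eq]
    rw [kpow_mul, kpow_mul, kpow_diagonal, kpow_conjTranspose]
    simp

theorem SpecRep.submatrix {A : Matrix ι ι ℂ} {V : Matrix ι κ ℂ} {μ : κ → ℝ} (h : SpecRep A V μ)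
    (e : ν ≃ ι) : SpecRep (A.submatrix e e) (V.submatrix e id) μ where
  mul_conj := by
    rw [Matrix.conjTranspose_submatrix, ← Matrix.submatrix_mul _ _ _ _ _ Function.bijective_id,
      h.mul_conj, Matrix.submatrix_one_equiv]
  conj_mul := by
    rw [Matrix.conjTranspose_submatrix, Matrix.submatrix_mul_equiv, h.conj_mul,
      Matrix.submatrix_one _ Function.injective_id]
  eq := by
    conv_lhs => rw [h.eq]
    rw [Matrix.submatrix_mul _ _ _ _ _ Function.bijective_id,
      Matrix.submatrix_mul _ _ _ _ _ Function.bijective_id, Matrix.conjTranspose_submatrix,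
      Matrix.submatrix_id_id]

theorem trace_mul_eq_ofReal {A B : Matrix ι ι ℂ} (hA : A.IsHermitian) (hB : B.IsHermitian) :
    (A * B).trace = (rtr (A * B) : ℂ) := by
  have h : star (A * B).trace = (A * B).trace := by
    rw [← Matrix.trace_conjTranspose, Matrix.conjTranspose_mul, hA, hB, Matrix.trace_mul_comm]
  exact (Complex.conj_eq_iff_re.1 h).symm

variable {d m : ℕ}

/-- Splitting a tuple of length `m * k` into `k` blocks of length `m`. -/
def blk (X : Type*) (m k : ℕ) : (Fin (m * k) → X) ≃ (Fin k → Fin m → X) :=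
  (Equiv.arrowCongr (finProdFinEquiv.trans (finCongr (Nat.mul_comm k m))).symm
    (Equiv.refl X)).trans (Equiv.curry _ _ _)

theorem blk_apply (X : Type*) (m k : ℕ) (x : Fin (m * k) → X) (i : Fin k) (j : Fin m) :
    blk X m k x i j = x (finCongr (Nat.mul_comm k m) (finProdFinEquiv (i, j))) := rfl

/-- The `k`-fold tensor power of an operator on `m` systems. -/
def bpow (M : Matrix (Fin m → Fin d) (Fin m → Fin d) ℂ) (k : ℕ) :
    Matrix (Fin (m * k) → Fin d) (Fin (m * k) → Fin d) ℂ :=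
  (kpow M k).submatrix (blk (Fin d) m k) (blk (Fin d) m k)

theorem bpow_mul (A B : Matrix (Fin m → Fin d) (Fin m → Fin d) ℂ) (k : ℕ) :
    bpow (A * B) k = bpow A k * bpow B k := by
  rw [bpow, bpow, bpow, Matrix.submatrix_mul_equiv, kpow_mul]

theorem trace_bpow (A : Matrix (Fin m → Fin d) (Fin m → Fin d) ℂ) (k : ℕ) :
    (bpow A k).trace = A.trace ^ k := by
  rw [← trace_kpow, Matrix.trace, Matrix.trace]
  exact (blk (Fin d) m k).sum_comp fun x => kpow A k x x

theorem SpecRep.bpow {A : Matrix (Fin m → Fin d) (Fin m → Fin d) ℂ} {V : Matrix (Fin m → Fin d) κ ℂ}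
    {μ : κ → ℝ} (h : SpecRep A V μ) (k : ℕ) :
    SpecRep (bpow A k) ((QHT.kpow V k).submatrix (blk (Fin d) m k) id) fun x => ∏ i, μ (x i) :=
  (h.kpow k).submatrix _

theorem mpow_bpow {A : Matrix (Fin m → Fin d) (Fin m → Fin d) ℂ} (hA : A.PosSemidef) (k : ℕ)
    (w : ℂ) : mpow (bpow A k) w = bpow (mpow A w) k := by
  have h := specRep_eigen hA.1
  rw [mpow_eq_mfun, mpow_eq_mfun, (h.bpow k).mfun_eq, h.mfun_eq]
  simp_rw [pw_prod fun i => hA.eigenvalues_nonneg _]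
  rw [← kpow_diagonal (fun i => pw w (hA.1.eigenvalues i))]
  rw [bpow, kpow_mul, kpow_mul, ← kpow_conjTranspose]
  ext x y
  simp [Matrix.mul_apply]

theorem bpow_posSemidef {A : Matrix (Fin m → Fin d) (Fin m → Fin d) ℂ} (hA : A.PosSemidef)
    (k : ℕ) : (bpow A k).PosSemidef := by
  have h := specRep_eigen hA.1
  rw [((h.bpow k)).eq]
  refine (Matrix.PosSemidef.diagonal fun x => ?_).mul_mul_conjTranspose_same _
  exact Complex.zero_le_real.2 (Finset.prod_nonneg fun i _ => hA.eigenvalues_nonneg _)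

theorem bpow_smul (c : ℂ) (A : Matrix (Fin m → Fin d) (Fin m → Fin d) ℂ) (k : ℕ) :
    bpow (c • A) k = c ^ k • bpow A k := by
  ext x y
  simp [bpow, kpow_apply, Finset.prod_mul_distrib]

theorem tpow_mul_eq_bpow (ρ : Matrix (Fin d) (Fin d) ℂ) (m k : ℕ) :
    tpow ρ (m * k) = bpow (tpow ρ m) k := by
  ext x y
  simp only [tpow, bpow, kpow_apply, Matrix.of_apply, Matrix.submatrix_apply, blk_apply]
  rw [← Fintype.prod_prod_type' (fun (i : Fin k) (j : Fin m) =>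
    ρ (x (finCongr (Nat.mul_comm k m) (finProdFinEquiv (i, j))))
      (y (finCongr (Nat.mul_comm k m) (finProdFinEquiv (i, j)))))]
  exact ((finProdFinEquiv.trans (finCongr (Nat.mul_comm k m))).prod_comp
    fun i => ρ (x i) (y i)).symm

theorem bpow_succ (M : Matrix (Fin m → Fin d) (Fin m → Fin d) ℂ) (k : ℕ) :
    bpow M (k + 1) = tensOp (bpow M k) M := by
  ext x y
  simp only [bpow, tensOp, kpow_apply, Matrix.of_apply, Matrix.submatrix_apply]
  rw [Fin.prod_univ_castSucc]
  have h1 : ∀ (x : Fin (m * (k + 1)) → Fin d) (i : Fin k), blk (Fin d) m (k + 1) x i.castSucc =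
      blk (Fin d) m k (fun i => x (Fin.castAdd m i)) i := fun x i => by
    funext j
    rw [blk_apply, blk_apply]
    exact congrArg x (Fin.ext (by simp))
  have h2 : ∀ (x : Fin (m * (k + 1)) → Fin d), blk (Fin d) m (k + 1) x (Fin.last k) =
      fun j => x (Fin.natAdd (m * k) j) := fun x => by
    funext j
    rw [blk_apply]
    exact congrArg x (Fin.ext (by simp [add_comm]))
  rw [h2, h2]
  simp_rw [h1]

theorem bpow_one_mem {F : (n : ℕ) → Set (Matrix (Fin n → Fin d) (Fin n → Fin d) ℂ)}
    {M : Matrix (Fin m → Fin d) (Fin m → Fin d) ℂ} (hM : M ∈ F m) : bpow M 1 ∈ F (m * 1) := by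
  have key : ∀ n (h : n = m), (M.submatrix (fun x : Fin n → Fin d => fun i => x (Fin.cast h.symm i))
      fun x : Fin n → Fin d => fun i => x (Fin.cast h.symm i)) ∈ F n := by
    rintro n rfl
    exact hM
  convert key (m * 1) (mul_one m) using 1
  ext x y
  simp only [bpow, kpow_apply, Matrix.submatrix_apply, Fin.prod_univ_one]
  congr 1

theorem bpow_mem {F : (n : ℕ) → Set (Matrix (Fin n → Fin d) (Fin n → Fin d) ℂ)}
    (hF : ∀ m n, 1 ≤ m → 1 ≤ n → ∀ A ∈ F m, ∀ B ∈ F n, tensOp A B ∈ F (m + n)) (hm : 1 ≤ m)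
    {M : Matrix (Fin m → Fin d) (Fin m → Fin d) ℂ} (hM : M ∈ F m) {k : ℕ} (hk : 1 ≤ k) :
    bpow M k ∈ F (m * k) := by
  induction k, hk using Nat.le_induction with
  | base => exact bpow_one_mem hM
  | succ k hk ih =>
    rw [bpow_succ]
    exact hF (m * k) m (Nat.mul_pos hm hk) hm _ ih _ hM

theorem rtr_bpow {X : Matrix (Fin m → Fin d) (Fin m → Fin d) ℂ} (hX : X.trace = (rtr X : ℂ))
    (k : ℕ) : rtr (bpow X k) = rtr X ^ k := by
  rw [rtr, trace_bpow, hX, ← Complex.ofReal_pow, Complex.ofReal_re]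

theorem Qpetz_bpow {A B : Matrix (Fin m → Fin d) (Fin m → Fin d) ℂ} (hA : A.PosSemidef)
    (hB : B.PosSemidef) (s : ℝ) (k : ℕ) :
    Qpetz s (bpow A k) (bpow B k) = Qpetz s A B ^ k := by
  rw [Qpetz, mpow_bpow hA, mpow_bpow hB, ← bpow_mul, rtr_bpow, Qpetz]
  exact trace_mul_eq_ofReal (mpow_posSemidef hA _).1 (mpow_posSemidef hB _).1

end Tensor

section NussbaumSzkola

variable {ι κ κ' : Type*} [Fintype ι] [DecidableEq ι] [Fintype κ] [DecidableEq κ]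
  [Fintype κ'] [DecidableEq κ']

theorem IsTest.one_sub {T : Matrix ι ι ℂ} (hT : IsTest T) : IsTest (1 - T) :=
  ⟨hT.2, by rw [sub_sub_cancel]; exact hT.1⟩

theorem IsTest.sub_sq_posSemidef {T : Matrix ι ι ℂ} (hT : IsTest T) : (T - T * T).PosSemidef := by
  have h1 := hT.2.conjTranspose_mul_mul_same T
  have h2 := hT.1.conjTranspose_mul_mul_same (1 - T)
  rw [hT.1.1] at h1
  rw [hT.2.1] at h2
  have := h1.add h2
  have e : T * (1 - T) * T + (1 - T) * T * (1 - T) = T - T * T := by noncomm_ring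
  rwa [e] at this

theorem IsTest.rtr_mul_sq_le {T A : Matrix ι ι ℂ} (hT : IsTest T) (hA : A.PosSemidef) :
    rtr (A * (T * T)) ≤ rtr (T * A) := by
  have := rtr_mul_nonneg hA hT.sub_sq_posSemidef
  rw [Matrix.mul_sub, rtr_sub] at this
  rw [rtr_mul_comm T A]
  linarith

theorem rtr_eq_sum_of_specRep {A : Matrix ι ι ℂ} {U : Matrix ι κ ℂ} {lam : κ → ℝ}
    (hU : SpecRep A U lam) {V : Matrix ι κ' ℂ} (hV : V * V.conjTranspose = 1) {T : Matrix ι ι ℂ}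
    (hT : T.IsHermitian) :
    rtr (A * (T * T)) = ∑ i, ∑ j, lam i * Complex.normSq ((V.conjTranspose * T * U) j i) := by
  have h1 : rtr (A * (T * T)) = ∑ i, lam i * ((U.conjTranspose * (T * T) * U) i i).re := by
    have := rtr_mul_mfun hU (fun x => x) (T * T)
    rw [mfun_id hU.isHermitian, rtr_mul_comm] at this
    exact this
  rw [h1]
  refine Finset.sum_congr rfl fun i _ => ?_
  have h2 : U.conjTranspose * (T * T) * U =
      (V.conjTranspose * T * U).conjTranspose * (V.conjTranspose * T * U) := by
    rw [Matrix.conjTranspose_mul, Matrix.conjTranspose_mul, Matrix.conjTranspose_conjTranspose, hT]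
    calc _ = U.conjTranspose * T * (V * V.conjTranspose) * (T * U) := by
          rw [hV, Matrix.mul_one]
          simp only [Matrix.mul_assoc]
      _ = _ := by simp only [Matrix.mul_assoc]
  rw [h2, Matrix.mul_apply, Complex.re_sum, Finset.mul_sum]
  refine Finset.sum_congr rfl fun j _ => ?_
  rw [Matrix.conjTranspose_apply, Complex.star_def, ← Complex.normSq_eq_conj_mul_self,
    Complex.ofReal_re]

theorem normSq_add_le (a b : ℂ) :
    Complex.normSq (a + b) ≤ 2 * (Complex.normSq a + Complex.normSq b) := by
  simp only [Complex.normSq_apply, Complex.add_re, Complex.add_im]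
  nlinarith [sq_nonneg (a.re - b.re), sq_nonneg (a.im - b.im)]

/-- Lower bound on the error of a test by the classical error of the
Nussbaum–Szkoła distributions. -/
theorem half_sum_min_le {A B : Matrix ι ι ℂ} {U : Matrix ι κ ℂ} {V : Matrix ι κ' ℂ} {lam : κ → ℝ}
    {μ : κ' → ℝ} (hA : SpecRep A U lam) (hB : SpecRep B V μ) (hAp : A.PosSemidef)
    (hBp : B.PosSemidef) (hlam : ∀ i, 0 ≤ lam i) (hμ : ∀ i, 0 ≤ μ i) {T : Matrix ι ι ℂ}
    (hT : IsTest T) {L : ℝ} (hL : 0 ≤ L) :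
    1 / 2 * ∑ i, ∑ j, min (lam i) (L * μ j) * Complex.normSq ((U.conjTranspose * V) i j) ≤
      rtr ((1 - T) * A) + L * rtr (T * B) := by
  have h1 := hT.one_sub.rtr_mul_sq_le hAp
  have h2 := mul_le_mul_of_nonneg_left (hT.rtr_mul_sq_le hBp) hL
  rw [rtr_eq_sum_of_specRep hA hB.mul_conj hT.2.1] at h1
  rw [rtr_eq_sum_of_specRep hB hA.mul_conj hT.1.1, Finset.sum_comm, Finset.mul_sum] at h2
  refine le_trans ?_ (add_le_add h1 h2)
  rw [← Finset.sum_add_distrib, Finset.mul_sum]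
  refine Finset.sum_le_sum fun i _ => ?_
  rw [Finset.mul_sum, Finset.mul_sum, ← Finset.sum_add_distrib]
  refine Finset.sum_le_sum fun j _ => ?_
  have e1 : Complex.normSq ((V.conjTranspose * (1 - T) * U : Matrix κ' κ ℂ) j i) =
      Complex.normSq ((U.conjTranspose * (1 - T) * V : Matrix κ κ' ℂ) i j) := by
    have : (V.conjTranspose * (1 - T) * U : Matrix κ' κ ℂ) =
        (U.conjTranspose * (1 - T) * V : Matrix κ κ' ℂ).conjTranspose := by
      rw [Matrix.conjTranspose_mul, Matrix.conjTranspose_mul, Matrix.conjTranspose_conjTranspose,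
        hT.2.1, Matrix.mul_assoc]
    rw [this, Matrix.conjTranspose_apply, Complex.star_def, Complex.normSq_conj]
  have e2 : (U.conjTranspose * V : Matrix κ κ' ℂ) i j =
      (U.conjTranspose * (1 - T) * V : Matrix κ κ' ℂ) i j +
      (U.conjTranspose * T * V : Matrix κ κ' ℂ) i j := by
    rw [← Matrix.add_apply, ← Matrix.add_mul, ← Matrix.mul_add, sub_add_cancel, Matrix.mul_one]
  rw [e1, e2]
  generalize (U.conjTranspose * (1 - T) * V : Matrix κ κ' ℂ) i j = a
  generalize (U.conjTranspose * T * V : Matrix κ κ' ℂ) i j = b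
  have hn := normSq_add_le a b
  have ha := Complex.normSq_nonneg a
  have hb := Complex.normSq_nonneg b
  have m0 : 0 ≤ min (lam i) (L * μ j) := le_min (hlam i) (mul_nonneg hL (hμ j))
  have m1 := mul_le_mul_of_nonneg_right (min_le_left (lam i) (L * μ j)) ha
  have m2 := mul_le_mul_of_nonneg_right (min_le_right (lam i) (L * μ j)) hb
  have m3 := mul_le_mul_of_nonneg_left hn m0
  nlinarith

/-- Trace of a product of functions of two operators in terms of the overlaps of their eigenvectors. -/
theorem rtr_mfun_mul_mfun {A B : Matrix ι ι ℂ} {U : Matrix ι κ ℂ} {V : Matrix ι κ' ℂ} {lam : κ → ℝ}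
    {μ : κ' → ℝ} (hA : SpecRep A U lam) (hB : SpecRep B V μ) (f g : ℝ → ℝ) :
    rtr (mfun (fun x => (f x : ℂ)) A * mfun (fun x => (g x : ℂ)) B) =
      ∑ i, ∑ j, f (lam i) * g (μ j) * Complex.normSq ((U.conjTranspose * V) i j) := by
  rw [rtr_mul_mfun hB, Finset.sum_comm]
  refine Finset.sum_congr rfl fun j _ => ?_
  have e : V.conjTranspose * mfun (fun x => (f x : ℂ)) A * V =
      (U.conjTranspose * V).conjTranspose * (Matrix.diagonal (fun i => (f (lam i) : ℂ)) *
        (U.conjTranspose * V)) := by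
    rw [hA.mfun_eq, Matrix.conjTranspose_mul, Matrix.conjTranspose_conjTranspose]
    simp only [Matrix.mul_assoc]
  rw [e, Matrix.mul_apply, Complex.re_sum, Finset.mul_sum]
  refine Finset.sum_congr rfl fun i _ => ?_
  rw [Matrix.conjTranspose_apply, Matrix.diagonal_mul, Complex.star_def, mul_left_comm,
    ← Complex.normSq_eq_conj_mul_self, ← Complex.ofReal_mul, Complex.ofReal_re]
  ring

variable {A B : Matrix ι ι ℂ}

/-- The squared overlap of eigenvectors of `A` and `B`. -/
def overlap (hA : A.PosSemidef) (hB : B.PosSemidef) (p : ι × ι) : ℝ :=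
  Complex.normSq (((hA.1.eigenvectorUnitary : Matrix ι ι ℂ).conjTranspose *
    (hB.1.eigenvectorUnitary : Matrix ι ι ℂ)) p.1 p.2)

/-- The sample space on which both Nussbaum–Szkoła distributions are positive. -/
def NSIdx (hA : A.PosSemidef) (hB : B.PosSemidef) : Type _ :=
  {p : ι × ι // hA.1.eigenvalues p.1 ≠ 0 ∧ hB.1.eigenvalues p.2 ≠ 0 ∧ overlap hA hB p ≠ 0}

instance (hA : A.PosSemidef) (hB : B.PosSemidef) : Fintype (NSIdx hA hB) := by
  unfold NSIdx; infer_instance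

/-- Logarithm of the second Nussbaum–Szkoła distribution. -/
def nsB (hA : A.PosSemidef) (hB : B.PosSemidef) (x : NSIdx hA hB) : ℝ :=
  Real.log (hB.1.eigenvalues x.1.2 * overlap hA hB x.1)

/-- Log-likelihood ratio of the Nussbaum–Szkoła distributions. -/
def nsH (hA : A.PosSemidef) (hB : B.PosSemidef) (x : NSIdx hA hB) : ℝ :=
  Real.log (hA.1.eigenvalues x.1.1) - Real.log (hB.1.eigenvalues x.1.2)

theorem overlap_nonneg (hA : A.PosSemidef) (hB : B.PosSemidef) (p : ι × ι) :
    0 ≤ overlap hA hB p := Complex.normSq_nonneg _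

theorem exp_nsB (hA : A.PosSemidef) (hB : B.PosSemidef) (x : NSIdx hA hB) :
    Real.exp (nsB hA hB x) = hB.1.eigenvalues x.1.2 * overlap hA hB x.1 := by
  have h1 := hB.eigenvalues_nonneg x.1.2
  have h2 := overlap_nonneg hA hB x.1
  exact Real.exp_log (lt_of_le_of_ne (mul_nonneg h1 h2) (mul_ne_zero x.2.2.1 x.2.2.2).symm)

theorem exp_nsB_add (hA : A.PosSemidef) (hB : B.PosSemidef) (s : ℝ) (x : NSIdx hA hB) :
    Real.exp (nsB hA hB x + s * nsH hA hB x) = hA.1.eigenvalues x.1.1 ^ s *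
      hB.1.eigenvalues x.1.2 ^ (1 - s) * overlap hA hB x.1 := by
  have h1 : 0 < hA.1.eigenvalues x.1.1 :=
    lt_of_le_of_ne (hA.eigenvalues_nonneg x.1.1) x.2.1.symm
  have h2 : 0 < hB.1.eigenvalues x.1.2 :=
    lt_of_le_of_ne (hB.eigenvalues_nonneg x.1.2) x.2.2.1.symm
  have e : s * nsH hA hB x = Real.log (hA.1.eigenvalues x.1.1) * s +
      Real.log (hB.1.eigenvalues x.1.2) * (-s) := by
    rw [nsH]; ring
  rw [Real.exp_add, exp_nsB, e, Real.exp_add, ← Real.rpow_def_of_pos h1, ← Real.rpow_def_of_pos h2,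
    sub_eq_add_neg, Real.rpow_add h2, Real.rpow_one]
  ring

theorem sum_NSIdx (hA : A.PosSemidef) (hB : B.PosSemidef) (f : ι × ι → ℝ)
    (hf : ∀ p, f p ≠ 0 → hA.1.eigenvalues p.1 ≠ 0 ∧ hB.1.eigenvalues p.2 ≠ 0 ∧ overlap hA hB p ≠ 0) :
    ∑ x : NSIdx hA hB, f x.1 = ∑ i, ∑ j, f (i, j) := by
  rw [← Fintype.sum_prod_type, ← Finset.sum_filter_of_ne fun p _ h => hf p h]
  exact (Finset.sum_subtype _ (fun p => by simp) f).symm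

theorem Qpetz_eq_sum (hA : A.PosSemidef) (hB : B.PosSemidef) (s : ℝ) :
    Qpetz s A B = ∑ x, Real.exp (nsB hA hB x + s * nsH hA hB x) := by
  simp_rw [exp_nsB_add]
  rw [Qpetz, mpow_eq_mfun_real hA, mpow_eq_mfun_real hB,
    rtr_mfun_mul_mfun (specRep_eigen hA.1) (specRep_eigen hB.1)]
  refine (sum_NSIdx hA hB (fun p => (if hA.1.eigenvalues p.1 = 0 then 0 else
    hA.1.eigenvalues p.1 ^ s) * (if hB.1.eigenvalues p.2 = 0 then 0 else
    hB.1.eigenvalues p.2 ^ (1 - s)) * overlap hA hB p) fun p hp => ?_).symm.trans ?_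
  swap
  · refine Finset.sum_congr rfl fun x _ => ?_
    rw [if_neg x.2.1, if_neg x.2.2.1]
  · have h1 := left_ne_zero_of_mul hp
    refine ⟨fun h => h1 ?_, fun h => h1 ?_, right_ne_zero_of_mul hp⟩ <;> simp [h]

theorem nonempty_NSIdx (hA : A.PosSemidef) (hB : B.PosSemidef) (h : (A * B).trace ≠ 0) :
    Nonempty (NSIdx hA hB) := by
  by_contra hcon
  rw [not_nonempty_iff] at hcon
  have e := rtr_mfun_mul_mfun (specRep_eigen hA.1) (specRep_eigen hB.1) (fun x => x) fun x => x
  rw [mfun_id hA.1, mfun_id hB.1] at e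
  have e' := e.trans (sum_NSIdx hA hB (fun p => hA.1.eigenvalues p.1 * hB.1.eigenvalues p.2 *
    overlap hA hB p) fun p hp => ?_).symm
  · rw [Finset.univ_eq_empty, Finset.sum_empty] at e'
    exact h (by rw [trace_mul_eq_ofReal hA.1 hB.1, e', Complex.ofReal_zero])
  · exact ⟨left_ne_zero_of_mul (left_ne_zero_of_mul hp),
      right_ne_zero_of_mul (left_ne_zero_of_mul hp), right_ne_zero_of_mul hp⟩

theorem lmgf_ns (hA : A.PosSemidef) (hB : B.PosSemidef) (s : ℝ) :
    lmgf (nsB hA hB) (nsH hA hB) s = Real.log (Qpetz s A B) := by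
  rw [Qpetz_eq_sum hA hB, lmgf]

theorem Qpetz_pos (hA : A.PosSemidef) (hB : B.PosSemidef) (h : (A * B).trace ≠ 0) (s : ℝ) :
    0 < Qpetz s A B := by
  have := nonempty_NSIdx hA hB h
  rw [Qpetz_eq_sum hA hB]
  exact sum_exp_pos _

theorem Qpetz_one_eq_sum (hA : A.PosSemidef) (hB : B.PosSemidef) :
    Qpetz 1 A B = ∑ i, ∑ j, hA.1.eigenvalues i * (if hB.1.eigenvalues j = 0 then 0 else 1) *
      overlap hA hB (i, j) := by
  rw [Qpetz, mpow_eq_mfun_real hA, mpow_eq_mfun_real hB,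
    rtr_mfun_mul_mfun (specRep_eigen hA.1) (specRep_eigen hB.1)]
  refine Finset.sum_congr rfl fun i _ => Finset.sum_congr rfl fun j _ => ?_
  have h1 : (if hA.1.eigenvalues i = 0 then 0 else hA.1.eigenvalues i ^ (1 : ℝ)) =
      hA.1.eigenvalues i := by
    split_ifs with h
    · exact h.symm
    · exact Real.rpow_one _
  rw [h1, sub_self]
  simp only [Real.rpow_zero]
  rfl

theorem rtr_eq_sum_overlap (hA : A.PosSemidef) (hB : B.PosSemidef) :
    rtr A = ∑ i, ∑ j, hA.1.eigenvalues i * overlap hA hB (i, j) := by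
  have e := rtr_mfun_mul_mfun (specRep_eigen hA.1) (specRep_eigen hB.1) (fun x => x) fun _ => 1
  rw [mfun_id hA.1] at e
  simp only [Complex.ofReal_one] at e
  rw [mfun_one hB.1, Matrix.mul_one] at e
  rw [e]
  simp only [mul_one]
  rfl

theorem Qpetz_one_le (hA : A.PosSemidef) (hB : B.PosSemidef) : Qpetz 1 A B ≤ rtr A := by
  rw [Qpetz_one_eq_sum hA hB, rtr_eq_sum_overlap hA hB]
  refine Finset.sum_le_sum fun i _ => Finset.sum_le_sum fun j _ => ?_
  refine mul_le_mul_of_nonneg_right ?_ (overlap_nonneg hA hB _)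
  refine mul_le_of_le_one_right (hA.eigenvalues_nonneg i) ?_
  split_ifs <;> norm_num

theorem Qpetz_one_eq (hA : A.PosSemidef) (hB : B.PosSemidef) (a : ℝ)
    (h : ∀ j, hB.1.eigenvalues j = 0 → (((hB.1.eigenvectorUnitary : Matrix ι ι ℂ).conjTranspose *
      mpow A a * (hB.1.eigenvectorUnitary : Matrix ι ι ℂ)) j j) = 0) : Qpetz 1 A B = rtr A := by
  rw [Qpetz_one_eq_sum hA hB, rtr_eq_sum_overlap hA hB]
  refine Finset.sum_congr rfl fun i _ => Finset.sum_congr rfl fun j _ => ?_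
  split_ifs with hj
  swap
  · rw [mul_one]
  rw [mul_zero, zero_mul]
  by_contra hcon
  have hli : hA.1.eigenvalues i ≠ 0 := fun h0 => hcon (by rw [h0, zero_mul])
  have hov : overlap hA hB (i, j) ≠ 0 := fun h0 => hcon (by rw [h0, mul_zero])
  have hz := congrArg Complex.re (h j hj)
  have e : (hB.1.eigenvectorUnitary : Matrix ι ι ℂ).conjTranspose * mpow A a *
      (hB.1.eigenvectorUnitary : Matrix ι ι ℂ) =
      ((hA.1.eigenvectorUnitary : Matrix ι ι ℂ).conjTranspose *
        (hB.1.eigenvectorUnitary : Matrix ι ι ℂ)).conjTranspose * (Matrix.diagonal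
        (fun i => ((if hA.1.eigenvalues i = 0 then 0 else hA.1.eigenvalues i ^ a : ℝ) : ℂ)) *
        ((hA.1.eigenvectorUnitary : Matrix ι ι ℂ).conjTranspose *
        (hB.1.eigenvectorUnitary : Matrix ι ι ℂ))) := by
    rw [mpow_eq_mfun_real hA, (specRep_eigen hA.1).mfun_eq, Matrix.conjTranspose_mul,
      Matrix.conjTranspose_conjTranspose]
    simp only [Matrix.mul_assoc]
  rw [e, Matrix.mul_apply, Complex.re_sum, Complex.zero_re] at hz
  have hterm : ∀ l, (((hA.1.eigenvectorUnitary : Matrix ι ι ℂ).conjTranspose *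
        (hB.1.eigenvectorUnitary : Matrix ι ι ℂ)).conjTranspose j l * (Matrix.diagonal
        (fun i => ((if hA.1.eigenvalues i = 0 then 0 else hA.1.eigenvalues i ^ a : ℝ) : ℂ)) *
        ((hA.1.eigenvectorUnitary : Matrix ι ι ℂ).conjTranspose *
        (hB.1.eigenvectorUnitary : Matrix ι ι ℂ))) l j).re =
      (if hA.1.eigenvalues l = 0 then 0 else hA.1.eigenvalues l ^ a) * overlap hA hB (l, j) := by
    intro l
    rw [Matrix.conjTranspose_apply, Matrix.diagonal_mul, ← starRingEnd_apply, mul_left_comm,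
      ← Complex.normSq_eq_conj_mul_self, ← Complex.ofReal_mul, Complex.ofReal_re]
    rfl
  simp_rw [hterm] at hz
  have hnn : ∀ l ∈ Finset.univ, 0 ≤ (if hA.1.eigenvalues l = 0 then 0 else
      hA.1.eigenvalues l ^ a) * overlap hA hB (l, j) := fun l _ => by
    refine mul_nonneg ?_ (overlap_nonneg hA hB _)
    split_ifs
    · exact le_rfl
    · exact Real.rpow_nonneg (hA.eigenvalues_nonneg l) a
  have := (Finset.sum_eq_zero_iff_of_nonneg hnn).1 hz i (Finset.mem_univ _)
  rw [if_neg hli] at this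
  rcases mul_eq_zero.1 this with h' | h'
  · exact (Real.rpow_pos_of_pos (lt_of_le_of_ne (hA.eigenvalues_nonneg i) hli.symm) a).ne' h'
  · exact hov h'

end NussbaumSzkola

section ProductBound

variable {d m : ℕ} {A B : Matrix (Fin m → Fin d) (Fin m → Fin d) ℂ}

/-- Lower bound on the error of a test between `A^{⊗k}` and `B^{⊗k}` by the classical error
of the product Nussbaum–Szkoła distributions. -/
theorem half_sum_min_bpow_le (hA : A.PosSemidef) (hB : B.PosSemidef) (k : ℕ)
    {T : Matrix (Fin (m * k) → Fin d) (Fin (m * k) → Fin d) ℂ} (hT : IsTest T) {L : ℝ}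
    (hL : 0 ≤ L) :
    1 / 2 * ∑ x : Fin k → NSIdx hA hB, min (∏ i, Real.exp (nsB hA hB (x i) + nsH hA hB (x i)))
      (L * ∏ i, Real.exp (nsB hA hB (x i))) ≤
      rtr ((1 - T) * bpow A k) + L * rtr (T * bpow B k) := by
  have hU := specRep_eigen hA.1
  have hV := specRep_eigen hB.1
  refine le_trans ?_ (half_sum_min_le (hU.bpow k) (hV.bpow k) (bpow_posSemidef hA k)
    (bpow_posSemidef hB k) (fun x => Finset.prod_nonneg fun i _ => hA.eigenvalues_nonneg _)
    (fun x => Finset.prod_nonneg fun i _ => hB.eigenvalues_nonneg _) hT hL)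
  refine mul_le_mul_of_nonneg_left ?_ (by norm_num)
  have hW : ((kpow (hA.1.eigenvectorUnitary : Matrix (Fin m → Fin d) (Fin m → Fin d) ℂ) k).submatrix
      (blk (Fin d) m k) id).conjTranspose * (kpow (hB.1.eigenvectorUnitary : Matrix (Fin m → Fin d) (Fin m → Fin d) ℂ)
      k).submatrix (blk (Fin d) m k) id = kpow ((hA.1.eigenvectorUnitary :
      Matrix (Fin m → Fin d) (Fin m → Fin d) ℂ).conjTranspose * (hB.1.eigenvectorUnitary : Matrix (Fin m → Fin d) (Fin m → Fin d) ℂ)) k := by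
    rw [kpow_mul, ← kpow_conjTranspose, Matrix.conjTranspose_submatrix,
      Matrix.submatrix_mul_equiv, Matrix.submatrix_id_id]
  rw [hW, ← Fintype.sum_prod_type' fun (x y : Fin k → Fin m → Fin d) =>
    min (∏ i, hA.1.eigenvalues (x i)) (L * ∏ i, hB.1.eigenvalues (y i)) *
      Complex.normSq (kpow ((hA.1.eigenvectorUnitary :
      Matrix (Fin m → Fin d) (Fin m → Fin d) ℂ).conjTranspose * (hB.1.eigenvectorUnitary : Matrix (Fin m → Fin d) (Fin m → Fin d) ℂ)) k x y)]
  let e : (Fin k → NSIdx hA hB) → (Fin k → Fin m → Fin d) × (Fin k → Fin m → Fin d) :=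
    fun x => (fun l => (x l).1.1, fun l => (x l).1.2)
  have he : Function.Injective e := by
    intro x y hxy
    funext l
    refine Subtype.ext (Prod.ext ?_ ?_)
    · exact congrFun (congrArg Prod.fst hxy) l
    · exact congrFun (congrArg Prod.snd hxy) l
  refine le_trans (le_of_eq ?_) (Finset.sum_le_sum_of_subset_of_nonneg
    (Finset.subset_univ (Finset.univ.map ⟨e, he⟩)) fun p _ _ => ?_)
  · rw [Finset.sum_map]
    refine Finset.sum_congr rfl fun x _ => ?_
    have h1 : ∀ i, Real.exp (nsB hA hB (x i) + nsH hA hB (x i)) =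
        hA.1.eigenvalues (x i).1.1 * overlap hA hB (x i).1 := fun i => by
      have := exp_nsB_add hA hB 1 (x i)
      rwa [one_mul, Real.rpow_one, sub_self, Real.rpow_zero, mul_one] at this
    simp_rw [h1, exp_nsB, Finset.prod_mul_distrib]
    rw [← mul_assoc, ← min_mul_of_nonneg _ _
      (Finset.prod_nonneg fun i _ => overlap_nonneg hA hB _), kpow_apply, map_prod]
    rfl
  · exact mul_nonneg (le_min (Finset.prod_nonneg fun i _ => hA.eigenvalues_nonneg _)
      (mul_nonneg hL (Finset.prod_nonneg fun i _ => hB.eigenvalues_nonneg _)))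
      (Complex.normSq_nonneg _)

end ProductBound

section Rates

variable {ι : Type*} [Fintype ι] [DecidableEq ι] {d : ℕ}

theorem le_exp_of_lt_rate {n : ℕ} (hn : 1 ≤ n) {x r : ℝ} (h : (r : EReal) < rate n x) :
    x ≤ Real.exp (-(n * r)) := by
  rw [rate, negLog] at h
  split_ifs at h with hx
  · exact hx.trans (Real.exp_pos _).le
  · push Not at hx
    have hn' : (0 : ℝ) < n := by exact_mod_cast hn
    rw [← EReal.coe_mul, EReal.coe_lt_coe_iff, lt_inv_mul_iff₀ hn'] at h
    rw [← Real.log_le_iff_le_exp hx]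
    linarith

theorem rate_le_of_exp_le {n : ℕ} (hn : 1 ≤ n) {x c : ℝ} (h : Real.exp (-(n * c)) ≤ x) :
    rate n x ≤ (c : EReal) := by
  have hx := (Real.exp_pos _).trans_le h
  have hn' : (0 : ℝ) < n := by exact_mod_cast hn
  rw [rate, negLog, if_neg hx.not_ge, ← EReal.coe_mul, EReal.coe_le_coe_iff, inv_mul_le_iff₀ hn']
  rw [← Real.le_log_iff_exp_le hx] at h
  linarith

theorem le_rate_of_le_exp {n : ℕ} (hn : 1 ≤ n) {x c : ℝ} (h : x ≤ Real.exp (-(n * c))) :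
    (c : EReal) ≤ rate n x := by
  have hn' : (0 : ℝ) < n := by exact_mod_cast hn
  rw [rate, negLog]
  split_ifs with hx
  · rw [EReal.coe_mul_top_of_pos (inv_pos.2 hn')]
    exact le_top
  · push Not at hx
    rw [← EReal.coe_mul, EReal.coe_le_coe_iff, le_inv_mul_iff₀ hn']
    rw [← Real.log_le_iff_le_exp hx] at h
    linarith

theorem continuous_rtr : Continuous (rtr : Matrix ι ι ℂ → ℝ) :=
  Complex.continuous_re.comp (continuous_id.matrix_trace)

theorem rtr_mul_le_typeII {n : ℕ} {F : Set (Matrix (Fin n → Fin d) (Fin n → Fin d) ℂ)}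
    (hF : IsCompact F) (T : Matrix (Fin n → Fin d) (Fin n → Fin d) ℂ) {σ} (hσ : σ ∈ F) :
    rtr (σ * T) ≤ typeII F T := by
  refine le_csSup (hF.image ?_).bddAbove (mem_image_of_mem _ hσ)
  exact continuous_rtr.comp (continuous_id.matrix_mul continuous_const)

end Rates

section Converse

variable {d : ℕ} {ρ : Matrix (Fin d) (Fin d) ℂ}
  {S : (n : ℕ) → Set (Matrix (Fin n → Fin d) (Fin n → Fin d) ℂ)} {m : ℕ}
  {τ : Matrix (Fin m → Fin d) (Fin m → Fin d) ℂ}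

/-- Lower bound on the type I error of tests whose type II error decays with rate at least `r`. -/
theorem eventually_le_typeI (hS : Assumption1 S) (hm : 1 ≤ m) (hτ : τ ∈ S m)
    (hA : (tpow ρ m).PosSemidef) (hB : τ.PosSemidef) (h0 : (tpow ρ m * τ).trace ≠ 0) {r : ℝ}
    {T : (n : ℕ) → Matrix (Fin n → Fin d) (Fin n → Fin d) ℂ} (hT : ∀ n, IsTest (T n))
    (hr : (r : EReal) ≤ liminf (fun n => rate n (typeII (S n) (T n))) atTop) {s p E : ℝ}
    (hE : E = lmean (nsB hA hB) (nsH hA hB) s)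
    (hp : p = (s - 1) * E - lmgf (nsB hA hB) (nsH hA hB) s) (hpE : p + E < m * r) {ε : ℝ}
    (hε : 0 < ε) :
    ∀ᶠ k : ℕ in atTop, 1 / 8 * Real.exp (-(k * (p + |1 - s| * ε))) ≤
      typeI ρ (m * k) (T (m * k)) := by
  have hne := nonempty_NSIdx hA hB h0
  have hm0 : (0 : ℝ) < m := by exact_mod_cast hm
  set η := (m * r - (p + E)) / 4 with hη
  have hη0 : 0 < η := by rw [hη]; linarith
  set δ := min ε (η / (1 + |1 - s|)) with hδ
  have hs0 : 0 ≤ |1 - s| := abs_nonneg _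
  have hδ0 : 0 < δ := lt_min hε (div_pos hη0 (by linarith))
  have hδ1 : (1 + |1 - s|) * δ ≤ η := by
    have := min_le_right ε (η / (1 + |1 - s|))
    rw [← hδ, le_div_iff₀ (by linarith)] at this
    linarith
  obtain ⟨K, hK⟩ := exists_forall_le_sum_min (nsB hA hB) (nsH hA hB) s hδ0
  have hr' : ((r - η / m : ℝ) : EReal) < liminf (fun n => rate n (typeII (S n) (T n))) atTop := by
    refine lt_of_lt_of_le ?_ hr
    rw [EReal.coe_lt_coe_iff]
    have := div_pos hη0 hm0
    linarith
  have ev := eventually_lt_of_lt_liminf hr'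
  have hmk : Tendsto (fun k : ℕ => m * k) atTop atTop := tendsto_id.const_mul_atTop' hm
  have ev2 : ∀ᶠ k : ℕ in atTop, Real.log 8 ≤ k * η := by
    have : Tendsto (fun k : ℕ => (k : ℝ) * η) atTop atTop :=
      tendsto_natCast_atTop_atTop.atTop_mul_const hη0
    exact this.eventually_ge_atTop _
  filter_upwards [hmk.eventually ev, ev2, eventually_ge_atTop (max K 1)] with k h1 h2 h3
  have hk1 : 1 ≤ k := (le_max_right _ _).trans h3
  have hβ := le_exp_of_lt_rate (Nat.mul_pos hm hk1) h1
  have hmem : bpow τ k ∈ S (m * k) := bpow_mem hS.tens hm hτ hk1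
  have hle := rtr_mul_le_typeII (hS.compact _ (Nat.mul_pos hm hk1)) (T (m * k)) hmem
  have hmain := half_sum_min_bpow_le hA hB k (hT (m * k)) (Real.exp_pos (k * (E + δ))).le
  have hcl := hK k ((le_max_left _ _).trans h3)
  rw [← hE, ← hp] at hcl
  rw [typeI, tpow_mul_eq_bpow]
  have hb : Real.exp (k * (E + δ)) * rtr (T (m * k) * bpow τ k) ≤
      1 / 8 * Real.exp (-(k * (p + |1 - s| * δ))) := by
    rw [rtr_mul_comm]
    refine (mul_le_mul_of_nonneg_left (hle.trans hβ) (Real.exp_pos _).le).trans ?_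
    have e8 : (1 / 8 : ℝ) = Real.exp (-Real.log 8) := by
      rw [Real.exp_neg, Real.exp_log (by norm_num)]; norm_num
    rw [e8, ← Real.exp_add, ← Real.exp_add, Real.exp_le_exp]
    push_cast
    have e1 : (m : ℝ) * k * (r - η / m) = k * (m * r - η) := by field_simp
    rw [e1]
    have hk0 : (0 : ℝ) ≤ k := Nat.cast_nonneg k
    have := mul_le_mul_of_nonneg_left hδ1 hk0
    have e2 : m * r = 4 * η + (p + E) := by rw [hη]; ring
    rw [e2]
    nlinarith
  have hmono : Real.exp (-(k * (p + |1 - s| * ε))) ≤ Real.exp (-(k * (p + |1 - s| * δ))) := by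
    rw [Real.exp_le_exp, neg_le_neg_iff]
    gcongr
    exact min_le_left _ _
  linarith

theorem hoeffdingExp_le_of_lt (hS : Assumption1 S) (hm : 1 ≤ m) (hτ : τ ∈ S m)
    (hA : (tpow ρ m).PosSemidef) (hB : τ.PosSemidef) (h0 : (tpow ρ m * τ).trace ≠ 0) {r : ℝ}
    {s p E : ℝ} (hE : E = lmean (nsB hA hB) (nsH hA hB) s)
    (hp : p = (s - 1) * E - lmgf (nsB hA hB) (nsH hA hB) s) (hpE : p + E < m * r) :
    hoeffdingExp r ρ S ≤ ((p / m : ℝ) : EReal) := by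
  have hm0 : (0 : ℝ) < m := by exact_mod_cast hm
  refine iSup_le fun T => ?_
  by_contra hcon
  push Not at hcon
  obtain ⟨c, hc1, hc2⟩ := EReal.lt_iff_exists_real_btwn.1 hcon
  rw [EReal.coe_lt_coe_iff, div_lt_iff₀ hm0] at hc1
  set η := (c * m - p) / 2 with hη
  have hη0 : 0 < η := by rw [hη]; linarith
  have hs0 : 0 ≤ |1 - s| := abs_nonneg _
  have hε0 : 0 < η / (1 + |1 - s|) := div_pos hη0 (by linarith)
  have hε1 : |1 - s| * (η / (1 + |1 - s|)) ≤ η := by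
    rw [mul_div_assoc', div_le_iff₀ (by linarith)]
    nlinarith
  have ev := eventually_le_typeI hS hm hτ hA hB h0 T.2.1 T.2.2 hE hp hpE hε0
  have ev2 : ∀ᶠ k : ℕ in atTop, Real.log 8 ≤ k * η := by
    have : Tendsto (fun k : ℕ => (k : ℝ) * η) atTop atTop :=
      tendsto_natCast_atTop_atTop.atTop_mul_const hη0
    exact this.eventually_ge_atTop _
  have hmk : Tendsto (fun k : ℕ => m * k) atTop atTop := tendsto_id.const_mul_atTop' hm
  have ev3 := hmk.eventually (eventually_lt_of_lt_liminf hc2)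
  obtain ⟨k, h1, h2, h3, h4⟩ := (ev.and (ev2.and (ev3.and (eventually_ge_atTop 1)))).exists
  refine h3.not_ge (rate_le_of_exp_le (Nat.mul_pos hm h4) (le_trans ?_ h1))
  have e8 : (1 / 8 : ℝ) = Real.exp (-Real.log 8) := by
    rw [Real.exp_neg, Real.exp_log (by norm_num)]; norm_num
  rw [e8, ← Real.exp_add, Real.exp_le_exp]
  push_cast
  have hk0 : (0 : ℝ) ≤ k := Nat.cast_nonneg k
  have := mul_le_mul_of_nonneg_left hε1 hk0
  have e2 : c * m = 2 * η + p := by rw [hη]; ring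
  have e3 : (m : ℝ) * k * c = k * (2 * η + p) := by rw [← e2]; ring
  rw [e3]
  nlinarith

theorem lt_lmean_one_of_lt_steinExp (hS : Assumption1 S) (hm : 1 ≤ m) (hτ : τ ∈ S m)
    (hA : (tpow ρ m).PosSemidef) (hB : τ.PosSemidef) (h0 : (tpow ρ m * τ).trace ≠ 0) {r : ℝ}
    (hr : (r : EReal) < steinExp ρ S) (h1 : lmgf (nsB hA hB) (nsH hA hB) 1 = 0) :
    m * r < lmean (nsB hA hB) (nsH hA hB) 1 := by
  have hm0 : (0 : ℝ) < m := by exact_mod_cast hm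
  obtain ⟨_, ⟨r', ⟨-, T, hT, hr', hlim⟩, rfl⟩, hlt⟩ := lt_sSup_iff.1 hr
  simp only [EReal.coe_lt_coe_iff] at hlt
  refine lt_of_lt_of_le (mul_lt_mul_of_pos_left hlt hm0) ?_
  by_contra hcon
  push Not at hcon
  have ev := eventually_le_typeI hS hm hτ hA hB h0 hT hr' (s := 1) (p := 0) rfl
    (by rw [h1]; ring) (by rw [zero_add]; exact hcon) one_pos
  have hmk : Tendsto (fun k : ℕ => m * k) atTop atTop := tendsto_id.const_mul_atTop' hm
  have ev2 := (hlim.comp hmk).eventually (gt_mem_nhds (show (0 : ℝ) < 1 / 8 by norm_num))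
  obtain ⟨k, h2, h3⟩ := (ev.and ev2).exists
  simp only [sub_self, abs_zero, add_zero, mul_zero, neg_zero, Real.exp_zero,
    mul_one] at h2
  exact h3.not_ge h2

theorem hoeffdingExp_le_of_psiC (hS : Assumption1 S) (hm : 1 ≤ m) (hτ : τ ∈ S m)
    (hA : (tpow ρ m).PosSemidef) (hB : τ.PosSemidef) (h0 : (tpow ρ m * τ).trace ≠ 0)
    {r a s₀ c : ℝ} (ha : 0 < a) (has : a < s₀) (hsc : s₀ < c) (hc : c ≤ 1)
    (hψa : psiC (nsB hA hB) (nsH hA hB) (m * r) a < psiC (nsB hA hB) (nsH hA hB) (m * r) s₀)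
    (hψc : psiC (nsB hA hB) (nsH hA hB) (m * r) c < psiC (nsB hA hB) (nsH hA hB) (m * r) s₀)
    {M : ℝ} (hM : ∀ s ∈ Icc a c, psiC (nsB hA hB) (nsH hA hB) (m * r) s ≤ M) :
    hoeffdingExp r ρ S ≤ ((M / m : ℝ) : EReal) := by
  have hne := nonempty_NSIdx hA hB h0
  have hm0 : (0 : ℝ) < m := by exact_mod_cast hm
  by_contra hcon
  push Not at hcon
  obtain ⟨q, hq1, hq2⟩ := EReal.lt_iff_exists_real_btwn.1 hcon
  rw [EReal.coe_lt_coe_iff, div_lt_iff₀ hm0] at hq1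
  obtain ⟨s, hs1, hs2⟩ := exists_stationary_of_lt _ _ ha has hsc hc hψa hψc hM
    (sub_pos.2 hq1)
  refine hq2.not_ge ((hoeffdingExp_le_of_lt hS hm hτ hA hB h0 rfl rfl hs1).trans ?_)
  rw [EReal.coe_le_coe_iff, div_le_iff₀ hm0]
  linarith

end Converse

section Support

variable {ι : Type*} [Fintype ι] [DecidableEq ι] {R σ : Matrix ι ι ℂ}

theorem mul_mpow_zero_of_diag (hR : R.PosSemidef) (hσ : σ.PosSemidef)
    (h : ∀ j, hσ.1.eigenvalues j = 0 → ((hσ.1.eigenvectorUnitary : Matrix ι ι ℂ).conjTranspose *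
      R * (hσ.1.eigenvectorUnitary : Matrix ι ι ℂ)) j j = 0) : R * mpow σ 0 = R := by
  have hV := specRep_eigen hσ.1
  set V := (hσ.1.eigenvectorUnitary : Matrix ι ι ℂ) with hVd
  have hP := hR.conjTranspose_mul_mul_same V
  have e : V.conjTranspose * R * V * Matrix.diagonal (fun j => pw 0 (hσ.1.eigenvalues j)) =
      V.conjTranspose * R * V := by
    ext i j
    rw [Matrix.mul_diagonal]
    by_cases hj : hσ.1.eigenvalues j = 0
    · rw [PosSemidef.apply_eq_zero_of_diag hP (h j hj), zero_mul]
    · rw [pw, if_neg hj, Complex.cpow_zero, mul_one]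
  rw [mpow_eq_mfun, hV.mfun_eq]
  calc _ = V * V.conjTranspose * R * (V * Matrix.diagonal (fun j => pw 0 (hσ.1.eigenvalues j)) *
        V.conjTranspose) := by rw [hV.mul_conj, Matrix.one_mul]
    _ = V * (V.conjTranspose * R * V * Matrix.diagonal (fun j => pw 0 (hσ.1.eigenvalues j))) *
        V.conjTranspose := by simp only [Matrix.mul_assoc]
    _ = (V * V.conjTranspose) * R * (V * V.conjTranspose) := by
        rw [e]; simp only [Matrix.mul_assoc]
    _ = R := by rw [hV.mul_conj, Matrix.one_mul, Matrix.mul_one]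

theorem conj_apply_eq_zero_of_mul_mpow_zero (hR : R.PosSemidef) (hσ : σ.PosSemidef)
    (h : R * mpow σ 0 = R) (i j : ι) (hij : hσ.1.eigenvalues i = 0 ∨ hσ.1.eigenvalues j = 0) :
    ((hσ.1.eigenvectorUnitary : Matrix ι ι ℂ).conjTranspose *
      R * (hσ.1.eigenvectorUnitary : Matrix ι ι ℂ)) j i = 0 := by
  have hV := specRep_eigen hσ.1
  set V := (hσ.1.eigenvectorUnitary : Matrix ι ι ℂ) with hVd
  have hP := hR.conjTranspose_mul_mul_same V
  have e : V.conjTranspose * R * V * Matrix.diagonal (fun j => pw 0 (hσ.1.eigenvalues j)) =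
      V.conjTranspose * R * V := by
    rw [mpow_eq_mfun, hV.mfun_eq] at h
    calc _ = V.conjTranspose * R * V * Matrix.diagonal (fun j => pw 0 (hσ.1.eigenvalues j)) *
          (V.conjTranspose * V) := by rw [hV.conj_mul, Matrix.mul_one]
      _ = V.conjTranspose * (R * (V * Matrix.diagonal (fun j => pw 0 (hσ.1.eigenvalues j)) *
          V.conjTranspose)) * V := by simp only [Matrix.mul_assoc]
      _ = _ := by rw [h]
  have key : ∀ a b, hσ.1.eigenvalues b = 0 → (V.conjTranspose * R * V) a b = 0 := fun a b hb => by
    rw [← e, Matrix.mul_diagonal, pw, if_pos hb, mul_zero]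
  rcases hij with h' | h'
  · exact key j i h'
  · rw [← hP.1.apply j i, key i j h', star_zero]

theorem rtr_mul_mpow_le_of_integral_jf_le {τ : Matrix ι ι ℂ} (hR : R.PosSemidef)
    (hσ : σ.PosSemidef) (hτ : τ.PosSemidef) {α : ℝ} (h0 : 0 < α) (h1 : α < 1)
    (hI : IntegrableOn (jf α R σ τ) (Ioi 0)) (hle : ∫ l in Ioi 0, jf α R σ τ l ≤
      (∫ w, divDiffKernel α w) * rtr (R * mpow σ ((1 - α : ℝ) : ℂ))) :
    rtr (R * mpow τ ((1 - α : ℝ) : ℂ)) ≤ rtr (R * mpow σ ((1 - α : ℝ) : ℂ)) := by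
  obtain ⟨hIσ, hIe⟩ := integral_jf_self hσ h0 h1 R
  have k0 : 0 < 1 - α := by linarith
  have k2 : 1 - α < 1 := by linarith
  have htan : (∫ l in Ioi (0 : ℝ), l ^ (1 - α - 1) * rtr (R * frac l τ)) ≤
      ∫ l in Ioi (0 : ℝ), (l ^ (1 - α - 1) * rtr (R * frac l σ) +
        (jf α R σ τ l - jf α R σ σ l)) := by
    refine setIntegral_mono_on (integrableOn_rpow_mul_rtr_frac hτ R k0 k2)
      ((integrableOn_rpow_mul_rtr_frac hσ R k0 k2).add (hI.sub hIσ)) measurableSet_Ioi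
      fun l hl => ?_
    have hl : 0 < l := hl
    have h2 := mul_le_mul_of_nonneg_left (rtr_mul_frac_le hR hτ hσ hl)
      (Real.rpow_nonneg hl.le (1 - α - 1))
    refine h2.trans (le_of_eq ?_)
    have e3 : l ^ (1 - α) = l ^ (1 - α - 1) * l := by
      rw [Real.rpow_sub_one hl.ne', div_mul_cancel₀ _ hl.ne']
    simp only [jf, e3]
    ring
  have i3 : IntegrableOn (fun l => jf α R σ τ l - jf α R σ σ l) (Ioi 0) := hI.sub hIσ
  rw [integral_add (integrableOn_rpow_mul_rtr_frac hσ R k0 k2) i3, integral_sub hI hIσ,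
    integral_rpow_mul_rtr_frac hτ R k0 k2, integral_rpow_mul_rtr_frac hσ R k0 k2, hIe] at htan
  refine le_of_mul_le_mul_left ?_ (rpowConst_pos k0 k2)
  linarith

theorem mpow_conjTranspose (hσ : σ.PosSemidef) (z : ℂ) :
    (mpow σ z).conjTranspose = mpow σ ((starRingEnd ℂ) z) := by
  have hV := specRep_eigen hσ.1
  rw [mpow_eq_mfun, mpow_eq_mfun, hV.mfun_eq, hV.mfun_eq, Matrix.conjTranspose_mul,
    Matrix.conjTranspose_mul, Matrix.conjTranspose_conjTranspose, Matrix.diagonal_conjTranspose,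
    ← Matrix.mul_assoc]
  congr 3
  funext i
  simp only [Pi.star_apply, pw]
  split_ifs with h
  · simp
  · have e := Complex.cpow_conj (hσ.1.eigenvalues i : ℂ) z (by
      rw [Complex.arg_ofReal_of_nonneg (hσ.eigenvalues_nonneg i)]
      exact Real.pi_pos.ne)
    rw [Complex.conj_ofReal] at e
    exact e.symm

/-- The operator whose pairing with `τ` is the twisted trace. -/
def twistOp (α : ℝ) (R σ : Matrix ι ι ℂ) (w : ℝ) : Matrix ι ι ℂ :=
  mpow σ (-(((α / 2 : ℝ) : ℂ) - w * Complex.I)) * R *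
    mpow σ (-(((α / 2 : ℝ) : ℂ) + w * Complex.I))

theorem twist_eq (α : ℝ) (R σ B : Matrix ι ι ℂ) (w : ℝ) :
    twist α R σ B w = rtr (twistOp α R σ w * B) := by
  rw [twist, twistOp, ← Matrix.mul_assoc, rtr_mul_comm]
  simp only [Matrix.mul_assoc]

theorem twistOp_posSemidef (hR : R.PosSemidef) (hσ : σ.PosSemidef) (α w : ℝ) :
    (twistOp α R σ w).PosSemidef := by
  have := hR.mul_mul_conjTranspose_same (mpow σ (-(((α / 2 : ℝ) : ℂ) - w * Complex.I)))
  have e : (starRingEnd ℂ) (-(((α / 2 : ℝ) : ℂ) - w * Complex.I)) =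
      -(((α / 2 : ℝ) : ℂ) + w * Complex.I) := by
    simp only [map_neg, map_sub, map_mul, Complex.conj_ofReal, Complex.conj_I]
    ring
  rwa [mpow_conjTranspose hσ, e] at this

end Support

section Direct

variable {d m : ℕ} {S : (n : ℕ) → Set (Matrix (Fin n → Fin d) (Fin n → Fin d) ℂ)}
  {R σ : Matrix (Fin m → Fin d) (Fin m → Fin d) ℂ}

theorem bpow_twistOp (hσ : σ.PosSemidef) (R : Matrix (Fin m → Fin d) (Fin m → Fin d) ℂ)
    (α w : ℝ) (k : ℕ) : bpow (twistOp α R σ w) k = twistOp α (bpow R k) (bpow σ k) w := by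
  rw [twistOp, twistOp, bpow_mul, bpow_mul, mpow_bpow hσ, mpow_bpow hσ]

theorem twist_bpow_le (hS : Assumption1 S) (hm : 1 ≤ m) (hR : R.PosSemidef) (hσ : σ.PosSemidef)
    {α Q : ℝ} (hQ : 0 < Q) {w : ℝ} (h : ∀ τ ∈ S m, twist α R σ τ w ≤ Q) {k : ℕ} (hk : 1 ≤ k)
    {τ} (hτ : τ ∈ S (m * k)) : twist α (bpow R k) (bpow σ k) τ w ≤ Q ^ k := by
  have hmem : ((Q⁻¹ : ℝ) : ℂ) • twistOp α R σ w ∈ polar (S m) := by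
    refine ⟨(twistOp_posSemidef hR hσ α w).smul (Complex.zero_le_real.2 (inv_pos.2 hQ).le),
      fun Y hY => ?_⟩
    rw [Matrix.smul_mul, rtr_smul, ← twist_eq, inv_mul_le_iff₀ hQ, mul_one]
    exact h Y hY
  have h2 := (bpow_mem (F := fun n => polar (S n)) hS.polarTens hm hmem hk).2 τ hτ
  rw [bpow_smul, ← Complex.ofReal_pow, Matrix.smul_mul, rtr_smul, bpow_twistOp hσ, ← twist_eq,
    inv_pow, inv_mul_le_iff₀ (pow_pos hQ k), mul_one] at h2
  exact h2

theorem rtr_bpow_mul_mpow_le (hS : Assumption1 S) (hm : 1 ≤ m) (hR : R.PosSemidef)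
    (hσ : σ.PosSemidef) {α Q : ℝ} (h0 : 0 < α) (h1 : α < 1) (hQ : 0 < Q)
    (hQe : rtr (R * mpow σ ((1 - α : ℝ) : ℂ)) = Q) (hRσ : R * mpow σ 0 = R)
    (h : ∀ w, ∀ τ ∈ S m, twist α R σ τ w ≤ Q) {k : ℕ} (hk : 1 ≤ k) {τ} (hτ : τ ∈ S (m * k)) :
    rtr (bpow R k * mpow τ ((1 - α : ℝ) : ℂ)) ≤ Q ^ k := by
  have hRk := bpow_posSemidef hR k
  have hσk := bpow_posSemidef hσ k
  have hτp := hS.psd _ (Nat.mul_pos hm hk) τ hτ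
  have hRσk : bpow R k * mpow (bpow σ k) 0 = bpow R k := by
    rw [mpow_bpow hσ, ← bpow_mul, hRσ]
  have hQk : rtr (bpow R k * mpow (bpow σ k) ((1 - α : ℝ) : ℂ)) = Q ^ k := by
    rw [mpow_bpow hσ, ← bpow_mul, rtr_bpow, hQe]
    exact trace_mul_eq_ofReal hR.1 (mpow_posSemidef hσ _).1
  obtain ⟨hI, hI2, hIe⟩ := integral_jf hσk h0 h1 (R := bpow R k) (B := τ) rfl fun i j hij => by
    rw [conj_apply_eq_zero_of_mul_mpow_zero hRk hσk hRσk i j hij, zero_mul]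
  rw [← hQk]
  refine rtr_mul_mpow_le_of_integral_jf_le hRk hσk hτp h0 h1 hI ?_
  rw [hIe, hQk, ← integral_mul_const]
  refine integral_mono hI2 ((integrable_divDiffKernel h0 h1).mul_const _) fun w => ?_
  exact mul_le_mul_of_nonneg_left (twist_bpow_le hS hm hR hσ hQ (h w) hk hτ)
    (divDiffKernel_pos h0 h1 w).le

end Direct

theorem convex_isTest {ι : Type*} [Fintype ι] [DecidableEq ι] :
    Convex ℝ {T : Matrix ι ι ℂ | IsTest T} := by
  intro T hT T' hT' p q hp hq hpq
  have hc : ∀ {a : ℝ} {X : Matrix ι ι ℂ}, 0 ≤ a → X.PosSemidef → (a • X).PosSemidef :=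
    fun ha hX => hX.smul ha
  refine ⟨(hc hp hT.1).add (hc hq hT'.1), ?_⟩
  have e : (1 : Matrix ι ι ℂ) - (p • T + q • T') = p • (1 - T) + q • (1 - T') := by
    rw [smul_sub, smul_sub, sub_add_sub_comm, ← add_smul, hpq, one_smul]
  rw [e]
  exact (hc hp hT.2).add (hc hq hT'.2)

theorem rtr_comb_left {ι : Type*} [Fintype ι] [DecidableEq ι] (p q : ℝ) (X Y Z : Matrix ι ι ℂ) :
    rtr ((p • X + q • Y) * Z) = p * rtr (X * Z) + q * rtr (Y * Z) := by
  rw [Matrix.add_mul, rtr_add, Matrix.smul_mul, Matrix.smul_mul, rtr_real_smul, rtr_real_smul]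

theorem rtr_comb_right {ι : Type*} [Fintype ι] [DecidableEq ι] (p q : ℝ) (X Y Z : Matrix ι ι ℂ) :
    rtr (Z * (p • X + q • Y)) = p * rtr (Z * X) + q * rtr (Z * Y) := by
  rw [rtr_mul_comm, rtr_comb_left, rtr_mul_comm X, rtr_mul_comm Y]

theorem exists_test_forall_lt {ι : Type*} [Fintype ι] [DecidableEq ι] {F : Set (Matrix ι ι ℂ)}
    (hc : IsCompact F) (hF : Convex ℝ F) (A : Matrix ι ι ℂ) {l c : ℝ}
    (h : ∀ σ ∈ F, ∃ T, IsTest T ∧ rtr ((1 - T) * A) + l * rtr (T * σ) < c) :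
    ∃ T, IsTest T ∧ ∀ σ ∈ F, rtr ((1 - T) * A) + l * rtr (T * σ) < c := by
  rcases F.eq_empty_or_nonempty with rfl | hne
  · exact ⟨0, ⟨Matrix.PosSemidef.zero, by rw [sub_zero]; exact Matrix.PosSemidef.one⟩, by simp⟩
  set f : Matrix ι ι ℂ → Matrix ι ι ℂ → ℝ := fun σ T => -(rtr ((1 - T) * A) + l * rtr (T * σ))
    with hf
  have c1 : ∀ T, Continuous fun σ => f σ T := fun T =>
    (continuous_const.add (continuous_const.mul
      (continuous_rtr.comp (continuous_const.mul continuous_id)))).neg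
  have c2 : ∀ σ, Continuous fun T => f σ T := fun σ =>
    ((continuous_rtr.comp ((continuous_const.sub continuous_id).mul continuous_const)).add
      (continuous_const.mul (continuous_rtr.comp (continuous_id.mul continuous_const)))).neg
  have cv1 : ∀ T, ConvexOn ℝ F fun σ => f σ T := fun T => by
    refine ⟨hF, fun x _ y _ p q _ _ hpq => le_of_eq ?_⟩
    have : q = 1 - p := by linarith
    simp only [hf, rtr_comb_right, smul_eq_mul, this]
    ring
  have cv2 : ∀ σ, ConcaveOn ℝ {T : Matrix ι ι ℂ | IsTest T} fun T => f σ T := fun σ => by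
    refine ⟨convex_isTest, fun x _ y _ p q _ _ hpq => le_of_eq ?_⟩
    have : q = 1 - p := by linarith
    simp only [hf, rtr_comb_left, smul_eq_mul, this, Matrix.sub_mul, rtr_sub]
    ring
  choose! T hT hlt using h
  obtain ⟨s, hs⟩ := hc.elim_finite_subcover (fun σ : F => {x | -c < f x (T σ)})
    (fun σ => isOpen_lt continuous_const (c1 _)) fun σ hσ =>
      mem_iUnion.2 ⟨⟨σ, hσ⟩, by
        change -c < -_
        exact neg_lt_neg (hlt σ hσ)⟩
  obtain ⟨T₀, hT₀, h₀⟩ := Sion.exists_lt_iInf_of_lt_iInf_of_finite (X := F)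
    (Y := {T : Matrix ι ι ℂ | IsTest T}) (f := f) hne hc
    (fun T _ => (c1 T).lowerSemicontinuous.lowerSemicontinuousOn _)
    (fun T _ => (cv1 T).quasiconvexOn) convex_isTest
    (fun σ _ => (c2 σ).upperSemicontinuous.upperSemicontinuousOn _)
    (fun σ _ => (cv2 σ).quasiconcaveOn) hF
    (s := (fun σ : F => T σ) '' s) (s.finite_toSet.image _)
    (by rintro _ ⟨σ, _, rfl⟩; exact hT σ σ.2) (t := -c) (fun x hx => by
      obtain ⟨σ, hσ, hx⟩ := mem_iUnion₂.1 (hs hx)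
      exact ⟨T σ, mem_image_of_mem _ hσ, hx⟩)
  exact ⟨T₀, hT₀, fun σ hσ => neg_lt_neg_iff.1 (h₀ σ hσ)⟩

section Direct

variable {d : ℕ} {S : (n : ℕ) → Set (Matrix (Fin n → Fin d) (Fin n → Fin d) ℂ)}
  {ρ : Matrix (Fin d) (Fin d) ℂ}

theorem exists_test_errors_le {n : ℕ} {F : Set (Matrix (Fin n → Fin d) (Fin n → Fin d) ℂ)}
    (hp : ∀ X ∈ F, X.PosSemidef) (hc : IsCompact F) (hF : Convex ℝ F) (hne : F.Nonempty)
    (hρ : (tpow ρ n).PosSemidef) {α : ℝ} (h0 : 0 < α) (h1 : α < 1) {q : ℝ} (hq : 0 < q)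
    (h : ∀ τ ∈ F, rtr (mpow (tpow ρ n) α * mpow τ ((1 - α : ℝ) : ℂ)) ≤ q) {b : ℝ} (hb : 0 < b) :
    ∃ T, IsTest T ∧ typeII F T ≤ b ∧ typeI ρ n T ≤ (2 * q * b ^ (α - 1)) ^ (α⁻¹) := by
  set l : ℝ := (2 * q * b⁻¹) ^ (α⁻¹) with hl
  have hx : 0 < 2 * q * b⁻¹ := by positivity
  have hl0 : 0 < l := Real.rpow_pos_of_pos hx _
  have e1 : l ^ (1 - α) * (2 * q) = l * b := by
    have : l ^ α = 2 * q * b⁻¹ := by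
      rw [hl, ← Real.rpow_mul hx.le, inv_mul_cancel₀ h0.ne', Real.rpow_one]
    rw [Real.rpow_sub hl0, Real.rpow_one, this]
    field_simp
  have e2 : l * b = (2 * q * b ^ (α - 1)) ^ (α⁻¹) := by
    have hb' : b = (b ^ α) ^ (α⁻¹) := by
      rw [← Real.rpow_mul hb.le, mul_inv_cancel₀ h0.ne', Real.rpow_one]
    have hq2 : 0 < b ^ α := Real.rpow_pos_of_pos hb _
    calc l * b = (2 * q * b⁻¹) ^ (α⁻¹) * (b ^ α) ^ (α⁻¹) := by rw [← hb']
      _ = (2 * q * b⁻¹ * b ^ α) ^ (α⁻¹) := (Real.mul_rpow hx.le hq2.le).symm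
      _ = _ := by
        congr 1
        rw [Real.rpow_sub hb, Real.rpow_one]
        field_simp
  obtain ⟨T, hT, hlt⟩ := exists_test_forall_lt hc hF (tpow ρ n) (l := l)
    (c := l ^ (1 - α) * (2 * q)) fun σ hσ => by
      obtain ⟨T, hT, hle⟩ := exists_test_le hρ
        ((hp σ hσ).smul (Complex.zero_le_real.2 hl0.le)) h0 h1
      refine ⟨T, hT, ?_⟩
      rw [mpow_smul (hp σ hσ) hl0, Matrix.mul_smul, rtr_smul, Matrix.mul_smul, rtr_smul] at hle
      have hpos : 0 < l ^ (1 - α) := Real.rpow_pos_of_pos hl0 _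
      have := mul_le_mul_of_nonneg_left (h σ hσ) hpos.le
      nlinarith [mul_pos hpos hq]
  have n1 : 0 ≤ rtr ((1 - T) * tpow ρ n) := rtr_mul_nonneg hT.2 hρ
  refine ⟨T, hT, csSup_le (hne.image _) ?_, ?_⟩
  · rintro _ ⟨σ, hσ, rfl⟩
    have := hlt σ hσ
    rw [e1] at this
    have h3 : l * rtr (T * σ) ≤ l * b := by linarith
    have h4 := le_of_mul_le_mul_left h3 hl0
    exact (rtr_mul_comm σ T).trans_le h4
  · obtain ⟨σ, hσ⟩ := hne
    have := hlt σ hσ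
    rw [e1, e2] at this
    have := mul_nonneg hl0.le (rtr_mul_nonneg hT.1 (hp σ hσ))
    unfold typeI
    linarith

theorem le_hoeffdingExp_of_rtr_le (hS : Assumption1 S) (hne : ∀ n, 1 ≤ n → (S n).Nonempty)
    (hρ : ∀ n, 1 ≤ n → (tpow ρ n).PosSemidef) {α Q r : ℝ} (h0 : 0 < α) (h1 : α < 1) (hQ : 0 < Q)
    (h : ∀ n, 1 ≤ n → ∀ τ ∈ S n,
      rtr (mpow (tpow ρ n) α * mpow τ ((1 - α : ℝ) : ℂ)) ≤ Q ^ n) :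
    (((((α - 1) * r - Real.log Q) / α : ℝ)) : EReal) ≤ hoeffdingExp r ρ S := by
  set ψ := ((α - 1) * r - Real.log Q) / α with hψ
  have hex : ∀ n, ∃ T : Matrix (Fin n → Fin d) (Fin n → Fin d) ℂ, IsTest T ∧ (1 ≤ n →
      typeII (S n) T ≤ Real.exp (-(n * r)) ∧
      typeI ρ n T ≤ 2 ^ (α⁻¹) * Real.exp (-(n * ψ))) := by
    intro n
    by_cases hn : 1 ≤ n
    · obtain ⟨T, hT, hII, hI⟩ := exists_test_errors_le (hS.psd n hn) (hS.compact n hn)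
        (hS.convex n hn) (hne n hn) (hρ n hn) h0 h1 (pow_pos hQ n) (h n hn)
        (Real.exp_pos (-(n * r)))
      refine ⟨T, hT, fun _ => ⟨hII, hI.trans (le_of_eq ?_)⟩⟩
      have e : 2 * Q ^ n * Real.exp (-(n * r)) ^ (α - 1) = 2 * Real.exp (-(n * ψ * α)) := by
        rw [← Real.exp_mul, mul_assoc]
        congr 1
        rw [← Real.exp_log (pow_pos hQ n), Real.log_pow, ← Real.exp_add]
        congr 1
        rw [hψ]
        field_simp
        ring
      rw [e, Real.mul_rpow zero_le_two (Real.exp_pos _).le, ← Real.exp_mul]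
      congr 2
      field_simp
    · exact ⟨0, ⟨Matrix.PosSemidef.zero, by rw [sub_zero]; exact Matrix.PosSemidef.one⟩,
        fun h => absurd h hn⟩
  choose T hT hTn using hex
  refine le_trans ?_ (le_iSup _ (⟨T, hT, ?_⟩ : {T : (n : ℕ) →
    Matrix (Fin n → Fin d) (Fin n → Fin d) ℂ // (∀ n, IsTest (T n)) ∧
      (r : EReal) ≤ Filter.liminf (fun n => rate n (typeII (S n) (T n))) Filter.atTop}))
  · refine le_of_forall_lt fun c hc => ?_
    obtain ⟨c', hcc, hcψ⟩ := EReal.lt_iff_exists_real_btwn.1 hc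
    have hcψ : c' < ψ := EReal.coe_lt_coe_iff.1 hcψ
    refine hcc.trans_le (le_liminf_of_le (by isBoundedDefault) ?_)
    have hg : Tendsto (fun n : ℕ => Real.exp (n * (ψ - c'))) atTop atTop :=
      Real.tendsto_exp_atTop.comp
        (tendsto_natCast_atTop_atTop.atTop_mul_const (sub_pos.2 hcψ))
    filter_upwards [eventually_ge_atTop 1, hg.eventually_ge_atTop (2 ^ (α⁻¹))] with n hn h2
    refine le_rate_of_le_exp hn ((hTn n hn).2.trans ?_)
    refine (mul_le_mul_of_nonneg_right h2 (Real.exp_pos _).le).trans (le_of_eq ?_)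
    rw [← Real.exp_add]
    congr 1
    ring
  · refine le_liminf_of_le (by isBoundedDefault) ?_
    filter_upwards [eventually_ge_atTop 1] with n hn
    exact le_rate_of_le_exp hn (hTn n hn).1

end Direct

section Reliability

variable {ι : Type*} [Fintype ι] [DecidableEq ι] {A B : Matrix ι ι ℂ}

/-- The finite branch of the reliability function. -/
def psiQ (A B : Matrix ι ι ℂ) (r s : ℝ) : ℝ := ((s - 1) * r - Real.log (Qpetz s A B)) / s

theorem psiC_ns (hA : A.PosSemidef) (hB : B.PosSemidef) (r s : ℝ) :
    psiC (nsB hA hB) (nsH hA hB) r s = psiQ A B r s := by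
  rw [psiC, lmgf_ns, psiQ]

theorem psiHoeffding_eq {r s : ℝ} (h1 : s < 1) (h : (A * B).trace ≠ 0) :
    psiHoeffding r A B s = (psiQ A B r s : EReal) := by
  rw [psiHoeffding, Dpetz, if_pos (Or.inl ⟨h1, h⟩), ← EReal.coe_sub, ← EReal.coe_mul, psiQ]
  have : s - 1 ≠ 0 := by linarith
  congr 1
  rcases eq_or_ne s 0 with rfl | h0
  · simp
  · field_simp

theorem psiHoeffding_one (r : ℝ) : psiHoeffding r A B 1 = 0 := by
  simp [psiHoeffding]

theorem trace_mul_ne_zero_of_msupp_le (hA : A.PosSemidef) (hB : B.PosSemidef) (hA0 : A ≠ 0)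
    (h : msupp A ≤ msupp B) : (A * B).trace ≠ 0 := by
  intro h0
  obtain ⟨C, hC⟩ := exists_smul_sub_mpow_posSemidef hA hB h 1
  have h2 := rtr_mul_nonneg hA hC
  rw [Complex.ofReal_one, mpow_one hA.1, Matrix.mul_sub, rtr_sub, Matrix.mul_smul, rtr_smul,
    rtr, h0, Complex.zero_re, mul_zero] at h2
  have h3 := (Matrix.posSemidef_conjTranspose_mul_self A).trace_nonneg
  rw [hA.1.eq] at h3
  refine hA0 (Matrix.trace_conjTranspose_mul_self_eq_zero_iff.1 ?_)
  rw [hA.1.eq]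
  have h4 := Complex.nonneg_iff.1 h3
  refine Complex.ext ?_ h4.2.symm
  have : rtr (A * A) = (A * A).trace.re := rfl
  simp only [Complex.zero_re]
  linarith [h4.1]

theorem psiHoeffding_eq_top (hA : A.PosSemidef) (hB : B.PosSemidef) (hA0 : A ≠ 0) {r s : ℝ}
    (h0 : 0 < s) (h1 : s < 1) (h : (A * B).trace = 0) : psiHoeffding r A B s = ⊤ := by
  have : ¬ ((s < 1 ∧ (A * B).trace ≠ 0) ∨ msupp A ≤ msupp B) := by
    rintro (h' | h')
    · exact h'.2 h
    · exact trace_mul_ne_zero_of_msupp_le hA hB hA0 h' h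
  rw [psiHoeffding, Dpetz, if_neg this, EReal.sub_top]
  exact EReal.coe_mul_bot_of_neg (div_neg_of_neg_of_pos (by linarith) h0)

theorem rtr_mul_pos (hA : A.PosSemidef) (hB : B.PosSemidef) (h : (A * B).trace ≠ 0) :
    0 < rtr (A * B) := by
  refine lt_of_le_of_ne (rtr_mul_nonneg hA hB) fun h0 => h ?_
  rw [trace_mul_eq_ofReal hA.1 hB.1, ← h0, Complex.ofReal_zero]

theorem posSemidef_comb {p q : ℝ} (hp : 0 ≤ p) (hq : 0 ≤ q) (hA : A.PosSemidef)
    (hB : B.PosSemidef) : (p • A + q • B).PosSemidef :=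
  Matrix.PosSemidef.add (hA.smul hp) (hB.smul hq)

theorem trace_mul_comb_ne_zero {R : Matrix ι ι ℂ} (hR : R.PosSemidef) (hA : A.PosSemidef)
    (hB : B.PosSemidef) (h : (R * A).trace ≠ 0) {ε : ℝ} (h0 : 0 ≤ ε) (h1 : ε < 1) :
    (R * ((1 - ε) • A + ε • B)).trace ≠ 0 := by
  intro h2
  have h3 : rtr (R * ((1 - ε) • A + ε • B)) = 0 := by rw [rtr, h2, Complex.zero_re]
  rw [rtr_comb_right] at h3
  have := mul_pos (sub_pos.2 h1) (rtr_mul_pos hR hA h)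
  linarith [mul_nonneg h0 (rtr_mul_nonneg hR hB)]

theorem SpecRep.add_smul_one {V : Matrix ι ι ℂ} {μ : ι → ℝ} (h : SpecRep A V μ) (x : ℝ) :
    SpecRep (A + x • (1 : Matrix ι ι ℂ)) V (fun j => μ j + x) where
  mul_conj := h.mul_conj
  conj_mul := h.conj_mul
  eq := by
    have e : Matrix.diagonal (fun j => ((μ j + x : ℝ) : ℂ)) =
        Matrix.diagonal (fun j => (μ j : ℂ)) + (x : ℂ) • (1 : Matrix ι ι ℂ) := by
      rw [← Matrix.diagonal_one, ← Matrix.diagonal_smul, Matrix.diagonal_add]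
      congr 1
      funext j
      simp
    rw [e, Matrix.mul_add, Matrix.add_mul, ← h.eq, Matrix.mul_smul, Matrix.smul_mul,
      Matrix.mul_one, h.mul_conj]
    rfl

theorem exists_rtr_mul_mpow_comb_lt {R σ τ : Matrix ι ι ℂ} (hR : R.PosSemidef)
    (hσ : σ.PosSemidef) (hτ : τ.PosSemidef) {θ : ℝ} (h0 : 0 < θ) (h1 : θ < 1) {q : ℝ}
    (hq : rtr (R * mpow σ (θ : ℂ)) < q) :
    ∃ ε ∈ Ioo (0 : ℝ) 1, rtr (R * mpow ((1 - ε) • σ + ε • τ) (θ : ℂ)) < q := by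
  obtain ⟨C, hC⟩ := exists_smul_sub_mpow_posSemidef hτ (Matrix.PosSemidef.one (n := ι) (R := ℂ))
    (by rw [msupp, msupp, Matrix.mulVecLin_one, LinearMap.range_id]; exact le_top) 1
  rw [Complex.ofReal_one, mpow_one hτ.1] at hC
  have hV := specRep_eigen hσ.1
  set V := (hσ.1.eigenvectorUnitary : Matrix ι ι ℂ)
  have hpw : ∀ x : ℝ, (if x = 0 then 0 else x ^ θ : ℝ) = x ^ θ := fun x => by
    split_ifs with h
    · rw [h, Real.zero_rpow h0.ne']
    · rfl
  set g : ℝ → ℝ := fun x => ∑ j, (hσ.1.eigenvalues j + x * C) ^ θ *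
    ((V.conjTranspose * R * V) j j).re with hg
  have hcont : Continuous g := continuous_finsetSum _ fun j _ =>
    ((continuous_const.add (continuous_id.mul continuous_const)).rpow_const
      fun _ => Or.inr h0.le).mul continuous_const
  have hg0 : g 0 = rtr (R * mpow σ (θ : ℂ)) := by
    rw [mpow_eq_mfun_real hσ, rtr_mul_mfun hV]
    simp only [hpw, hg, zero_mul, add_zero]
  have hev : ∀ᶠ x in nhdsWithin (0 : ℝ) (Ioi 0), g x < q :=
    (hcont.tendsto 0).eventually_lt_const (hg0.trans_lt hq) |>.filter_mono nhdsWithin_le_nhds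
  obtain ⟨ε, hε1, hε2⟩ := (hev.and (Ioo_mem_nhdsGT (zero_lt_one' ℝ))).exists
  refine ⟨ε, hε2, lt_of_le_of_lt ?_ hε1⟩
  have hP := posSemidef_comb (sub_pos.2 hε2.2).le hε2.1.le hσ hτ
  have e : σ + (ε * C) • (1 : Matrix ι ι ℂ) - ((1 - ε) • σ + ε • τ) =
      ε • σ + ε • ((C : ℂ) • (1 : Matrix ι ι ℂ) - τ) := by
    have : (C : ℂ) • (1 : Matrix ι ι ℂ) = C • (1 : Matrix ι ι ℂ) := rfl
    rw [this]
    module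
  have hD : (σ + (ε * C) • (1 : Matrix ι ι ℂ) - ((1 - ε) • σ + ε • τ)).PosSemidef := by
    rw [e]
    exact posSemidef_comb hε2.1.le hε2.1.le hσ hC
  have hX : (σ + (ε * C) • (1 : Matrix ι ι ℂ)).PosSemidef := by
    have := hP.add hD
    rwa [add_sub_cancel] at this
  refine (rtr_mul_mpow_mono hR hP hX hD h0 h1).trans (le_of_eq ?_)
  rw [mpow_eq_mfun_real hX, rtr_mul_mfun (hV.add_smul_one (ε * C))]
  simp only [hpw, hg]

end Reliability

theorem exists_lt_integral_mul_pow {κ f : ℝ → ℝ} (hκ : Integrable κ)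
    (hκ0 : ∀ w, 0 < κ w) (hf : Continuous f) (hf0 : ∀ w, 0 ≤ f w) {Q w₀ : ℝ} (hQ : 0 < Q)
    (hw : Q < f w₀) : ∃ m : ℕ, 1 ≤ m ∧ (Integrable (fun w => κ w * f w ^ m) →
      (∫ w, κ w) * Q ^ m < ∫ w, κ w * f w ^ m) := by
  obtain ⟨q, hQq, hqf⟩ := exists_between hw
  have hnh : ∀ᶠ w in nhds w₀, q < f w := hf.continuousAt.eventually_const_lt hqf
  obtain ⟨δ, hδ, hball⟩ := Metric.eventually_nhds_iff_ball.1 hnh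
  have hJ : 0 < ∫ w in Metric.ball w₀ δ, κ w := by
    rw [setIntegral_pos_iff_support_of_nonneg_ae
      (Filter.Eventually.of_forall fun w => (hκ0 w).le) hκ.integrableOn]
    have : Function.support κ = univ := eq_univ_of_forall fun w => (hκ0 w).ne'
    rw [this, univ_inter]
    exact Metric.measure_ball_pos _ _ hδ
  have ht : Tendsto (fun m : ℕ => (q / Q) ^ m * ∫ w in Metric.ball w₀ δ, κ w) atTop atTop :=
    (tendsto_pow_atTop_atTop_of_one_lt ((one_lt_div hQ).2 hQq)).atTop_mul_const hJ
  obtain ⟨m, hm1, hm⟩ := ((eventually_ge_atTop 1).and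
    (ht.eventually_gt_atTop (∫ w, κ w))).exists
  refine ⟨m, hm1, fun hint => ?_⟩
  have h1 : (∫ w in Metric.ball w₀ δ, κ w) * q ^ m ≤ ∫ w, κ w * f w ^ m := by
    rw [← integral_mul_const]
    refine (setIntegral_mono_on (hκ.integrableOn.mul_const _) hint.integrableOn
      Metric.isOpen_ball.measurableSet fun w hw => ?_).trans
      (setIntegral_le_integral hint (Filter.Eventually.of_forall fun w =>
        mul_nonneg (hκ0 w).le (pow_nonneg (hf0 w) m)))
    exact mul_le_mul_of_nonneg_left
      (pow_le_pow_left₀ (hQ.trans hQq).le (hball w hw).le m) (hκ0 w).le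
  refine lt_of_lt_of_le ?_ h1
  have h2 := mul_lt_mul_of_pos_right hm (pow_pos hQ m)
  rw [div_pow] at h2
  refine h2.trans_eq ?_
  field_simp

section Converse

variable {d m : ℕ} {S : (n : ℕ) → Set (Matrix (Fin n → Fin d) (Fin n → Fin d) ℂ)}
  {ρ : Matrix (Fin d) (Fin d) ℂ} {σ τ : Matrix (Fin m → Fin d) (Fin m → Fin d) ℂ}

theorem continuous_log_Qpetz {ι : Type*} [Fintype ι] [DecidableEq ι] {A B : Matrix ι ι ℂ}
    (hA : A.PosSemidef) (hB : B.PosSemidef) (h : (A * B).trace ≠ 0) :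
    Continuous fun s => Real.log (Qpetz s A B) := by
  have := nonempty_NSIdx hA hB h
  exact (continuous_lmgf (nsB hA hB) (nsH hA hB)).congr (lmgf_ns hA hB)

theorem psiQ_lt_of_lt {ι : Type*} [Fintype ι] [DecidableEq ι] {A B B' : Matrix ι ι ℂ}
    {r s : ℝ} (hs : 0 < s) (hpos : 0 < Qpetz s A B) (h : Qpetz s A B < Qpetz s A B') :
    psiQ A B' r s < psiQ A B r s := by
  have := Real.log_lt_log hpos h
  exact div_lt_div_of_pos_right (by linarith) hs

theorem hoeffdingExp_lt_of_Qpetz_lt (hS : Assumption1 S) (hm : 1 ≤ m) (hσ : σ ∈ S m)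
    (hτ : τ ∈ S m) (hA : (tpow ρ m).PosSemidef) (hσ0 : (tpow ρ m * σ).trace ≠ 0)
    (hτ0 : (tpow ρ m * τ).trace ≠ 0) {α r : ℝ} (h0 : 0 < α) (h1 : α < 1)
    (hmax : ∀ s ∈ Ioo (0 : ℝ) 1, s ≠ α →
      psiQ (tpow ρ m) σ (m * r) s < psiQ (tpow ρ m) σ (m * r) α)
    (hlt : Qpetz α (tpow ρ m) σ < Qpetz α (tpow ρ m) τ) :
    hoeffdingExp r ρ S < ((psiQ (tpow ρ m) σ (m * r) α / m : ℝ) : EReal) := by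
  have hσp := hS.psd m hm σ hσ
  have hτp := hS.psd m hm τ hτ
  set A := tpow ρ m with hAd
  have hnh : ∀ᶠ s in nhds α, s ∈ Ioo (0 : ℝ) 1 ∧
      Real.log (Qpetz s A σ) < Real.log (Qpetz s A τ) :=
    Filter.Eventually.and (Ioo_mem_nhds h0 h1)
      ((continuous_log_Qpetz hA hσp hσ0).continuousAt.eventually_lt
        (continuous_log_Qpetz hA hτp hτ0).continuousAt
        (Real.log_lt_log (Qpetz_pos hA hσp hσ0 α) hlt))
  obtain ⟨δ, hδ, hball⟩ := Metric.eventually_nhds_iff_ball.1 hnh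
  have hbox : ∀ s ∈ Icc (α - δ / 2) (α + δ / 2), s ∈ Ioo (0 : ℝ) 1 ∧
      Qpetz s A σ < Qpetz s A τ := fun s hs => by
    have := hball s (by
      rw [Metric.mem_ball, Real.dist_eq, abs_lt]
      constructor <;> linarith [hs.1, hs.2])
    exact ⟨this.1, (Real.log_lt_log_iff (Qpetz_pos hA hσp hσ0 s)
      (Qpetz_pos hA hτp hτ0 s)).1 this.2⟩
  set a := α - δ / 2 with ha
  set c := α + δ / 2 with hc
  have haα : a < α := by linarith
  have hαc : α < c := by linarith
  have hamem : a ∈ Icc a c := ⟨le_rfl, by linarith⟩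
  have hcmem : c ∈ Icc a c := ⟨by linarith, le_rfl⟩
  have hαmem : α ∈ Icc a c := ⟨haα.le, hαc.le⟩
  set μ := max (psiQ A σ (m * r) a) (psiQ A σ (m * r) c) with hμ
  have hμα : μ < psiQ A σ (m * r) α :=
    max_lt (hmax a (hbox a hamem).1 haα.ne) (hmax c (hbox c hcmem).1 hαc.ne')
  set q := Real.exp ((α - 1) * (m * r) - α * μ) with hq
  have hQq : Qpetz α A σ < q := by
    rw [hq, ← Real.log_lt_iff_lt_exp (Qpetz_pos hA hσp hσ0 α)]
    rw [psiQ, lt_div_iff₀ h0] at hμα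
    linarith
  obtain ⟨ε, hε, hεq⟩ := exists_rtr_mul_mpow_comb_lt (mpow_posSemidef hA α) hσp hτp
    (sub_pos.2 h1) (by linarith : 1 - α < 1) hQq
  set ω := (1 - ε) • σ + ε • τ with hω
  have hωS : ω ∈ S m := hS.convex m hm hσ hτ (by linarith [hε.2]) hε.1.le (by ring)
  have hωp := hS.psd m hm ω hωS
  have hω0 : (A * ω).trace ≠ 0 := trace_mul_comb_ne_zero hA hσp hτp hσ0 hε.1.le hε.2
  have hψω : ∀ s ∈ Icc a c, psiQ A ω (m * r) s < psiQ A σ (m * r) s := fun s hs => by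
    obtain ⟨hs1, hs2⟩ := hbox s hs
    refine psiQ_lt_of_lt hs1.1 (Qpetz_pos hA hσp hσ0 s) ?_
    have hcc := rtr_mul_mpow_concave (mpow_posSemidef hA s) hσp hτp (sub_pos.2 hs1.2)
      (by linarith [hs1.1] : 1 - s < 1) (sub_pos.2 hε.2).le hε.1.le (by ring)
    refine lt_of_lt_of_le ?_ hcc
    have h3 := mul_lt_mul_of_pos_left hs2 hε.1
    unfold Qpetz at h3 ⊢
    linarith
  have hμω : μ < psiQ A ω (m * r) α := by
    have h3 := (Real.log_lt_iff_lt_exp (Qpetz_pos hA hωp hω0 α)).2 hεq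
    rw [psiQ, lt_div_iff₀ h0]
    linarith
  have hcont : ContinuousOn (psiQ A ω (m * r)) (Icc a c) :=
    (((continuous_id.sub continuous_const).mul continuous_const).sub
      (continuous_log_Qpetz hA hωp hω0)).continuousOn.div continuousOn_id
      fun s hs => (hbox s hs).1.1.ne'
  obtain ⟨t, ht, htmax⟩ := isCompact_Icc.exists_isMaxOn ⟨a, hamem⟩ hcont
  have htα : psiQ A σ (m * r) t ≤ psiQ A σ (m * r) α := by
    rcases eq_or_ne t α with rfl | hne
    · exact le_rfl
    · exact (hmax t (hbox t ht).1 hne).le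
  refine (hoeffdingExp_le_of_psiC hS hm hωS hA hωp hω0 (r := r) (a := a) (s₀ := α) (c := c)
    (hbox a hamem).1.1 haα hαc (hbox c hcmem).1.2.le ?_ ?_ (M := psiQ A ω (m * r) t) ?_).trans_lt ?_
  · rw [psiC_ns, psiC_ns]
    exact (hψω a hamem).trans ((le_max_left _ _).trans_lt hμω)
  · rw [psiC_ns, psiC_ns]
    exact (hψω c hcmem).trans ((le_max_right _ _).trans_lt hμω)
  · intro s hs
    rw [psiC_ns]
    exact htmax hs
  · refine EReal.coe_lt_coe_iff.2 (div_lt_div_of_pos_right ((hψω t ht).trans_le htα) ?_)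
    exact_mod_cast hm

theorem twist_bpow {R : Matrix (Fin m → Fin d) (Fin m → Fin d) ℂ} (hR : R.PosSemidef)
    (hσ : σ.PosSemidef) (hτ : τ.PosSemidef) (α w : ℝ) (k : ℕ) :
    twist α (bpow R k) (bpow σ k) (bpow τ k) w = twist α R σ τ w ^ k := by
  rw [twist_eq, twist_eq, ← bpow_twistOp hσ, ← bpow_mul, rtr_bpow]
  exact trace_mul_eq_ofReal (twistOp_posSemidef hR hσ α w).1 hτ.1

theorem exists_lt_rtr_bpow (hσ : σ.PosSemidef) (hτ : τ.PosSemidef)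
    {R : Matrix (Fin m → Fin d) (Fin m → Fin d) ℂ} (hR : R.PosSemidef) {α Q w : ℝ}
    (h0 : 0 < α) (h1 : α < 1) (hQ : 0 < Q) (hQe : rtr (R * mpow σ ((1 - α : ℝ) : ℂ)) = Q)
    (hRσ : R * mpow σ 0 = R) (hw : Q < twist α R σ τ w) :
    ∃ k : ℕ, 1 ≤ k ∧ ∃ ε ∈ Ioo (0 : ℝ) 1,
      Q ^ k < rtr (bpow R k * mpow ((1 - ε) • bpow σ k + ε • bpow τ k) ((1 - α : ℝ) : ℂ)) := by
  obtain ⟨k, hk, hint⟩ := exists_lt_integral_mul_pow (integrable_divDiffKernel h0 h1)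
    (divDiffKernel_pos h0 h1) (continuous_twist hσ.1 α R τ)
    (fun w => by rw [twist_eq]; exact rtr_mul_nonneg (twistOp_posSemidef hR hσ α w) hτ) hQ hw
  refine ⟨k, hk, ?_⟩
  by_contra! hcon
  have hRk := bpow_posSemidef hR k
  have hσk := bpow_posSemidef hσ k
  have hτk := bpow_posSemidef hτ k
  have hRσk : bpow R k * mpow (bpow σ k) 0 = bpow R k := by
    rw [mpow_bpow hσ, ← bpow_mul, hRσ]
  have hQk : rtr (bpow R k * mpow (bpow σ k) ((1 - α : ℝ) : ℂ)) = Q ^ k := by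
    rw [mpow_bpow hσ, ← bpow_mul, rtr_bpow, hQe]
    exact trace_mul_eq_ofReal hR.1 (mpow_posSemidef hσ _).1
  obtain ⟨-, hle⟩ := integrableOn_jf_of_le hRk hσk hτk h0 h1 fun ε hε hε' => by
    rw [hQk]
    exact hcon ε ⟨hε, hε'⟩
  obtain ⟨-, hI2, hIe⟩ := integral_jf hσk h0 h1 (R := bpow R k) (B := bpow τ k) rfl
    fun i j hij => by
      rw [conj_apply_eq_zero_of_mul_mpow_zero hRk hσk hRσk i j hij, zero_mul]
  simp only [twist_bpow hR hσ hτ] at hI2 hIe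
  rw [hIe, hQk] at hle
  exact absurd hle (not_le.2 (hint hI2))

end Converse

theorem tpow_one_posSemidef {d : ℕ} {ρ : Matrix (Fin d) (Fin d) ℂ} (hρ : ρ.PosSemidef) :
    (tpow ρ 1).PosSemidef := by
  convert hρ.submatrix (fun x : Fin 1 → Fin d => x 0) using 1
  ext x y
  simp [tpow]

theorem trace_tpow_one {d : ℕ} (ρ : Matrix (Fin d) (Fin d) ℂ) :
    (tpow ρ 1).trace = ρ.trace := by
  simp only [Matrix.trace, Matrix.diag, tpow, Matrix.of_apply, Fin.prod_univ_one, Fin.isValue]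
  exact Fintype.sum_equiv (Equiv.funUnique (Fin 1) (Fin d)) _ _ fun x => rfl

section Assembly

variable {d m : ℕ} {S : (n : ℕ) → Set (Matrix (Fin n → Fin d) (Fin n → Fin d) ℂ)}
  {ρ : Matrix (Fin d) (Fin d) ℂ} {σ τ : Matrix (Fin m → Fin d) (Fin m → Fin d) ℂ}

theorem psiQ_bpow {A : Matrix (Fin m → Fin d) (Fin m → Fin d) ℂ} (hA : A.PosSemidef)
    (hσ : σ.PosSemidef) (r s : ℝ) (k : ℕ) :
    psiQ (bpow A k) (bpow σ k) (k * r) s = k * psiQ A σ r s := by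
  rw [psiQ, psiQ, Qpetz_bpow hA hσ, Real.log_pow]
  ring

theorem hoeffdingExp_lt_of_lt_twist (hS : Assumption1 S) (hm : 1 ≤ m) (hσ : σ ∈ S m)
    (hτ : τ ∈ S m) (hA : (tpow ρ m).PosSemidef) (hσ0 : (tpow ρ m * σ).trace ≠ 0) {α r w : ℝ}
    (h0 : 0 < α) (h1 : α < 1) (hRσ : mpow (tpow ρ m) α * mpow σ 0 = mpow (tpow ρ m) α)
    (hmax : ∀ s ∈ Ioo (0 : ℝ) 1, s ≠ α →
      psiQ (tpow ρ m) σ (m * r) s < psiQ (tpow ρ m) σ (m * r) α)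
    (hw : Qpetz α (tpow ρ m) σ < twist α (mpow (tpow ρ m) α) σ τ w) :
    hoeffdingExp r ρ S < ((psiQ (tpow ρ m) σ (m * r) α / m : ℝ) : EReal) := by
  have hσp := hS.psd m hm σ hσ
  have hτp := hS.psd m hm τ hτ
  obtain ⟨k, hk, ε, hε, hlt⟩ := exists_lt_rtr_bpow hσp hτp (mpow_posSemidef hA α) h0 h1
    (Qpetz_pos hA hσp hσ0 α) rfl hRσ hw
  have hmk : 1 ≤ m * k := Nat.mul_pos hm hk
  have hk0 : (0 : ℝ) < k := by exact_mod_cast hk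
  have hm0 : (0 : ℝ) < m := by exact_mod_cast hm
  have hσk := bpow_posSemidef hσp k
  have hτk := bpow_posSemidef hτp k
  have hσS := bpow_mem hS.tens hm hσ hk
  have hτS := bpow_mem hS.tens hm hτ hk
  have hAk : (tpow ρ (m * k)).PosSemidef := by
    rw [tpow_mul_eq_bpow]
    exact bpow_posSemidef hA k
  have hσk0 : (tpow ρ (m * k) * bpow σ k).trace ≠ 0 := by
    rw [tpow_mul_eq_bpow, ← bpow_mul, trace_bpow]
    exact pow_ne_zero k hσ0
  have hψ : ∀ s, psiQ (tpow ρ (m * k)) (bpow σ k) ((m * k : ℕ) * r) s =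
      k * psiQ (tpow ρ m) σ (m * r) s := fun s => by
    rw [tpow_mul_eq_bpow, ← psiQ_bpow hA hσp]
    congr 1
    push_cast
    ring
  have key := hoeffdingExp_lt_of_Qpetz_lt (ρ := ρ) hS hmk hσS
    (hS.convex _ hmk hσS hτS (sub_pos.2 hε.2).le hε.1.le (by ring)) hAk hσk0
    (trace_mul_comb_ne_zero hAk hσk hτk hσk0 hε.1.le hε.2) (r := r) h0 h1
    (fun s hs hne => by
      rw [hψ, hψ]
      exact mul_lt_mul_of_pos_left (hmax s hs hne) hk0)
    (by
      rw [tpow_mul_eq_bpow, Qpetz_bpow hA hσp]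
      rw [← mpow_bpow hA] at hlt
      exact hlt)
  refine key.trans_eq ?_
  rw [hψ]
  congr 1
  push_cast
  field_simp

theorem le_hoeffdingExp_of_twist_le {σ : Matrix (Fin 1 → Fin d) (Fin 1 → Fin d) ℂ}
    (hS : Assumption1 S) (hσ : σ ∈ S 1)
    (hA : (tpow ρ 1).PosSemidef) (hσ0 : (tpow ρ 1 * σ).trace ≠ 0) {α r : ℝ}
    (h0 : 0 < α) (h1 : α < 1) (hRσ : mpow (tpow ρ 1) α * mpow σ 0 = mpow (tpow ρ 1) α)
    (h : ∀ w, ∀ τ ∈ S 1, twist α (mpow (tpow ρ 1) α) σ τ w ≤ Qpetz α (tpow ρ 1) σ) :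
    (psiQ (tpow ρ 1) σ r α : EReal) ≤ hoeffdingExp r ρ S := by
  have hσp := hS.psd 1 le_rfl σ hσ
  have hQ := Qpetz_pos hA hσp hσ0 α
  have key : ∀ k, 1 ≤ k → (S (1 * k)).Nonempty ∧ (tpow ρ (1 * k)).PosSemidef ∧
      ∀ τ ∈ S (1 * k), rtr (mpow (tpow ρ (1 * k)) α * mpow τ ((1 - α : ℝ) : ℂ)) ≤
        Qpetz α (tpow ρ 1) σ ^ k := fun k hk => by
    refine ⟨⟨_, bpow_mem hS.tens le_rfl hσ hk⟩, ?_, fun τ hτ => ?_⟩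
    · rw [tpow_mul_eq_bpow]
      exact bpow_posSemidef hA k
    · rw [tpow_mul_eq_bpow, mpow_bpow hA]
      exact rtr_bpow_mul_mpow_le hS le_rfl (mpow_posSemidef hA α) hσp h0 h1 hQ rfl hRσ h hk hτ
  have key' : ∀ k, 1 ≤ k → (S k).Nonempty ∧ (tpow ρ k).PosSemidef ∧
      ∀ τ ∈ S k, rtr (mpow (tpow ρ k) α * mpow τ ((1 - α : ℝ) : ℂ)) ≤
        Qpetz α (tpow ρ 1) σ ^ k := fun k hk => by
    have e : 1 * k = k := Nat.one_mul k
    exact Eq.rec (motive := fun n _ => (S n).Nonempty ∧ (tpow ρ n).PosSemidef ∧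
      ∀ τ ∈ S n, rtr (mpow (tpow ρ n) α * mpow τ ((1 - α : ℝ) : ℂ)) ≤
        Qpetz α (tpow ρ 1) σ ^ k) (key k hk) e
  exact le_hoeffdingExp_of_rtr_le hS (fun n hn => (key' n hn).1) (fun n hn => (key' n hn).2.1)
    h0 h1 hQ fun n hn => (key' n hn).2.2

section Saddle

variable {σ τ : Matrix (Fin 1 → Fin d) (Fin 1 → Fin d) ℂ} {r α : ℝ}

theorem trace_ne_zero_of_psiHoeffding_ne_top {ι : Type*} [Fintype ι] [DecidableEq ι]
    {A B : Matrix ι ι ℂ} (hA : A.PosSemidef) (hB : B.PosSemidef) (hA0 : A ≠ 0)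
    {r s : ℝ} (h0 : 0 < s) (h1 : s < 1) (h : psiHoeffding r A B s ≠ ⊤) : (A * B).trace ≠ 0 :=
  fun h' => h (psiHoeffding_eq_top hA hB hA0 h0 h1 h')

theorem lt_one_of_saddle (hS : Assumption1 S) (hσ : σ ∈ S 1) (hρ : IsState ρ)
    (hr : (r : EReal) < steinExp ρ S) (hα : α ∈ Ioc (0 : ℝ) 1)
    (h : ∀ s ∈ Ioo (0 : ℝ) 1, psiHoeffding r (tpow ρ 1) σ s ≤ psiHoeffding r (tpow ρ 1) σ α) :
    α < 1 := by
  refine lt_of_le_of_ne hα.2 ?_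
  rintro rfl
  have hA := tpow_one_posSemidef hρ.1
  have htr : (tpow ρ 1).trace = 1 := (trace_tpow_one ρ).trans hρ.2
  have hA0 : tpow ρ 1 ≠ 0 := by
    intro h0
    rw [h0, Matrix.trace_zero] at htr
    exact zero_ne_one htr
  have hB := hS.psd 1 le_rfl σ hσ
  rw [psiHoeffding_one] at h
  have h0 : (tpow ρ 1 * σ).trace ≠ 0 :=
    trace_ne_zero_of_psiHoeffding_ne_top hA hB hA0 (r := r) one_half_pos one_half_lt_one
      ((h (1 / 2) ⟨one_half_pos, one_half_lt_one⟩).trans_lt EReal.zero_lt_top).ne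
  have := nonempty_NSIdx hA hB h0
  have hle : lmgf (nsB hA hB) (nsH hA hB) 1 ≤ 0 := by
    rw [lmgf_ns]
    refine Real.log_nonpos (Qpetz_pos hA hB h0 1).le ((Qpetz_one_le hA hB).trans ?_)
    rw [rtr, htr, Complex.one_re]
  obtain ⟨h1, h2⟩ := lmean_one_le_of_psiC_nonpos (nsB hA hB) (nsH hA hB) (r := r) (fun s hs => by
    have := h s hs
    rw [psiHoeffding_eq hs.2 h0, ← EReal.coe_zero, EReal.coe_le_coe_iff] at this
    rwa [psiC_ns]) hle
  have h3 := lt_lmean_one_of_lt_steinExp hS le_rfl hσ hA hB h0 hr h1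
  rw [Nat.cast_one, one_mul] at h3
  exact absurd h2 (not_le.2 h3)

theorem mpow_mul_mpow_zero_of_saddle (hS : Assumption1 S) (hσ : σ ∈ S 1) (hρ : IsState ρ)
    (hτ : τ ∈ S 1) (hsupp : msupp (tpow ρ 1) ≤ msupp τ) (h0 : 0 < α) (h1 : α < 1)
    (hσ0 : (tpow ρ 1 * σ).trace ≠ 0)
    (h : ∀ ω ∈ S 1, psiHoeffding r (tpow ρ 1) σ α ≤ psiHoeffding r (tpow ρ 1) ω α) :
    mpow (tpow ρ 1) α * mpow σ 0 = mpow (tpow ρ 1) α ∧ Qpetz 1 (tpow ρ 1) σ = 1 := by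
  have hA := tpow_one_posSemidef hρ.1
  have hσp := hS.psd 1 le_rfl σ hσ
  have hτp := hS.psd 1 le_rfl τ hτ
  have hR := mpow_posSemidef hA α
  obtain ⟨C, hC⟩ := exists_smul_sub_mpow_posSemidef hA hτp hsupp α
  obtain ⟨hI, -⟩ := integrableOn_jf_of_le hR hσp hτp h0 h1 fun ε hε hε' => by
    have hωS := hS.convex 1 le_rfl hσ hτ (sub_pos.2 hε').le hε.le (by ring)
    have hω0 := trace_mul_comb_ne_zero hA hσp hτp hσ0 hε.le hε'
    have h2 := h _ hωS
    rw [psiHoeffding_eq h1 hσ0, psiHoeffding_eq h1 hω0, EReal.coe_le_coe_iff] at h2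
    by_contra! hcon
    exact absurd h2 (not_le.2 (psiQ_lt_of_lt h0 (Qpetz_pos hA hσp hσ0 α) hcon))
  have hd := fun j hj => conj_diag_eq_zero_of_integrableOn_jf hR hσp hC hI rfl (j := j) hj
  refine ⟨mul_mpow_zero_of_diag hR hσp hd, ?_⟩
  rw [Qpetz_one_eq hA hσp α hd, rtr, trace_tpow_one, hρ.2, Complex.one_re]

theorem psiQ_lt_of_saddle (hS : Assumption1 S) (hσ : σ ∈ S 1) (hA : (tpow ρ 1).PosSemidef)
    (hr : (r : EReal) < steinExp ρ S) (h0 : 0 < α) (h1 : α < 1)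
    (hσ0 : (tpow ρ 1 * σ).trace ≠ 0) (hQ1 : Qpetz 1 (tpow ρ 1) σ = 1)
    (h : ∀ s ∈ Ioo (0 : ℝ) 1, psiQ (tpow ρ 1) σ r s ≤ psiQ (tpow ρ 1) σ r α) :
    ∀ s ∈ Ioo (0 : ℝ) 1, s ≠ α → psiQ (tpow ρ 1) σ r s < psiQ (tpow ρ 1) σ r α := by
  have hB := hS.psd 1 le_rfl σ hσ
  have := nonempty_NSIdx hA hB hσ0
  have hl1 : lmgf (nsB hA hB) (nsH hA hB) 1 = 0 := by rw [lmgf_ns, hQ1, Real.log_one]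
  have hE := lt_lmean_one_of_lt_steinExp hS le_rfl hσ hA hB hσ0 hr hl1
  rw [Nat.cast_one, one_mul] at hE
  have hst : α * lmean (nsB hA hB) (nsH hA hB) α - lmgf (nsB hA hB) (nsH hA hB) α = r := by
    refine stationary_of_isLocalMax _ _ h0.ne' ?_
    filter_upwards [Ioo_mem_nhds h0 h1] with s hs
    rw [psiC_ns, psiC_ns]
    exact h s hs
  intro s hs hne
  have := psiC_lt_of_stationary _ _ h0 hs.1 hst hl1 hE hne
  rwa [psiC_ns, psiC_ns] at this

theorem hoeffdingExp_le_of_saddle (hS : Assumption1 S) (hσ : σ ∈ S 1)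
    (hA : (tpow ρ 1).PosSemidef) (h0 : 0 < α) (h1 : α < 1) (hσ0 : (tpow ρ 1 * σ).trace ≠ 0)
    (h : ∀ s ∈ Ioo (0 : ℝ) 1, s ≠ α → psiQ (tpow ρ 1) σ r s < psiQ (tpow ρ 1) σ r α) :
    hoeffdingExp r ρ S ≤ (psiQ (tpow ρ 1) σ r α : EReal) := by
  have hB := hS.psd 1 le_rfl σ hσ
  have := hoeffdingExp_le_of_psiC hS le_rfl hσ hA hB hσ0 (r := r) (a := α / 2) (s₀ := α)
    (c := (α + 1) / 2) (M := psiQ (tpow ρ 1) σ r α) (by linarith) (by linarith) (by linarith)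
    (by linarith)
  simp only [Nat.cast_one, one_mul, div_one, psiC_ns] at this
  refine this (h _ ⟨by linarith, by linarith⟩ (by linarith))
    (h _ ⟨by linarith, by linarith⟩ (by linarith)) fun s hs => ?_
  rcases eq_or_ne s α with rfl | hne
  · exact le_rfl
  · exact (h s ⟨by linarith [hs.1], by linarith [hs.2]⟩ hne).le

end Saddle

end Assembly

/-- Theorem 32 of the paper: single-copy criterion, verified at a saddle
point of the reliability function, for removing the regularization in the Hoeffding
exponent. -/
theorem hoeffding_exponent_single_letter_iff {d : ℕ}
    (ρ : Matrix (Fin d) (Fin d) ℂ) (hρ : IsState ρ)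
    (S : (n : ℕ) → Set (Matrix (Fin n → Fin d) (Fin n → Fin d) ℂ))
    (hS : Assumption1 S)
    (hsupp : ∃ τ ∈ S 1, IsState τ ∧ msupp (tpow ρ 1) ≤ msupp τ)
    (r : ℝ) (hr0 : 0 < r)
    (hrD0 : sInf ((fun σ => -Real.log (rtr (mpow (tpow ρ 1) 0 * σ))) '' S 1) < r)
    (hrStein : (r : EReal) < steinExp ρ S)
    (α₀ : ℝ) (hα₀ : α₀ ∈ Set.Ioc (0 : ℝ) 1)
    (σ₀ : Matrix (Fin 1 → Fin d) (Fin 1 → Fin d) ℂ) (hσ₀ : σ₀ ∈ S 1)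
    (hsaddle₁ : (⨆ α ∈ Set.Ioc (0 : ℝ) 1, psiHoeffding r (tpow ρ 1) σ₀ α) =
      psiHoeffding r (tpow ρ 1) σ₀ α₀)
    (hsaddle₂ : psiHoeffding r (tpow ρ 1) σ₀ α₀ =
      ⨅ σ ∈ S 1, psiHoeffding r (tpow ρ 1) σ α₀) :
    hoeffdingExp r ρ S = psiHoeffding r (tpow ρ 1) σ₀ α₀ ↔
      (⨆ t : ℝ, ⨆ τ ∈ S 1,
        ((rtr (mpow (tpow ρ 1) ((α₀ : ℝ) : ℂ) *
          (mpow σ₀ (-(((α₀ : ℝ) : ℂ) + Complex.I * (t : ℂ)) / 2) * τ *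
            mpow σ₀ (-(((α₀ : ℝ) : ℂ) - Complex.I * (t : ℂ)) / 2))) : ℝ) : EReal)) =
        ((Qpetz α₀ (tpow ρ 1) σ₀ : ℝ) : EReal) := by
  obtain ⟨τ, hτ, -, hτs⟩ := hsupp
  have hA := tpow_one_posSemidef hρ.1
  have hA0 : tpow ρ 1 ≠ 0 := by
    intro h0
    have := trace_tpow_one ρ
    rw [h0, hρ.2, Matrix.trace_zero] at this
    exact zero_ne_one this
  have hσp := hS.psd 1 le_rfl σ₀ hσ₀
  have hτp := hS.psd 1 le_rfl τ hτ
  have hmax : ∀ s ∈ Ioo (0 : ℝ) 1,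
      psiHoeffding r (tpow ρ 1) σ₀ s ≤ psiHoeffding r (tpow ρ 1) σ₀ α₀ := fun s hs => by
    rw [← hsaddle₁]
    exact le_iSup₂ (f := fun α (_ : α ∈ Ioc (0 : ℝ) 1) => psiHoeffding r (tpow ρ 1) σ₀ α) s
      ⟨hs.1, hs.2.le⟩
  have hmin : ∀ ω ∈ S 1, psiHoeffding r (tpow ρ 1) σ₀ α₀ ≤ psiHoeffding r (tpow ρ 1) ω α₀ :=
    fun ω hω => by
      rw [hsaddle₂]
      exact iInf₂_le (f := fun σ (_ : σ ∈ S 1) => psiHoeffding r (tpow ρ 1) σ α₀) ω hω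
  have h0 := hα₀.1
  have h1 := lt_one_of_saddle hS hσ₀ hρ hrStein hα₀ hmax
  have hσ0 : (tpow ρ 1 * σ₀).trace ≠ 0 := by
    refine trace_ne_zero_of_psiHoeffding_ne_top hA hσp hA0 h0 h1 (r := r)
      ((hmin τ hτ).trans_lt ?_).ne
    rw [psiHoeffding_eq h1 (trace_mul_ne_zero_of_msupp_le hA hτp hA0 hτs)]
    exact EReal.coe_lt_top _
  obtain ⟨hRσ, hQ1⟩ := mpow_mul_mpow_zero_of_saddle hS hσ₀ hρ hτ hτs h0 h1 hσ0 hmin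
  have hstrict := psiQ_lt_of_saddle hS hσ₀ hA hrStein h0 h1 hσ0 hQ1 fun s hs => by
    have := hmax s hs
    rwa [psiHoeffding_eq h1 hσ0, psiHoeffding_eq hs.2 hσ0, EReal.coe_le_coe_iff] at this
  have htw : ∀ (t : ℝ) (ω : Matrix (Fin 1 → Fin d) (Fin 1 → Fin d) ℂ),
      rtr (mpow (tpow ρ 1) ((α₀ : ℝ) : ℂ) *
        (mpow σ₀ (-(((α₀ : ℝ) : ℂ) + Complex.I * (t : ℂ)) / 2) * ω *
          mpow σ₀ (-(((α₀ : ℝ) : ℂ) - Complex.I * (t : ℂ)) / 2))) =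
      twist α₀ (mpow (tpow ρ 1) α₀) σ₀ ω (t / 2) := fun t ω => by
    have e1 : -(((α₀ : ℝ) : ℂ) + Complex.I * (t : ℂ)) / 2 =
        -(((α₀ / 2 : ℝ) : ℂ) + ((t / 2 : ℝ) : ℂ) * Complex.I) := by
      push_cast
      ring
    have e2 : -(((α₀ : ℝ) : ℂ) - Complex.I * (t : ℂ)) / 2 =
        -(((α₀ / 2 : ℝ) : ℂ) - ((t / 2 : ℝ) : ℂ) * Complex.I) := by
      push_cast
      ring
    rw [e1, e2, twist]
  simp only [htw]
  rw [psiHoeffding_eq h1 hσ0]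
  constructor
  · intro heq
    refine le_antisymm (iSup_le fun t => iSup₂_le fun ω hω => ?_) ?_
    · rw [EReal.coe_le_coe_iff]
      by_contra! hcon
      have hlt := hoeffdingExp_lt_of_lt_twist hS le_rfl hσ₀ hω hA hσ0 (r := r) h0 h1 hRσ
        (fun s hs hne => by
          rw [Nat.cast_one, one_mul]
          exact hstrict s hs hne) hcon
      rw [Nat.cast_one, one_mul, div_one] at hlt
      exact absurd heq hlt.ne
    · refine le_iSup_of_le 0 (le_iSup₂_of_le σ₀ hσ₀ ?_)
      rw [twist_self hσp]
      exact le_rfl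
  · intro hsup
    refine le_antisymm (hoeffdingExp_le_of_saddle hS hσ₀ hA h0 h1 hσ0 hstrict)
      (le_hoeffdingExp_of_twist_le hS hσ₀ hA hσ0 h0 h1 hRσ fun w ω hω => ?_)
    rw [← EReal.coe_le_coe_iff, ← hsup]
    refine le_iSup_of_le (2 * w) (le_iSup₂_of_le ω hω ?_)
    rw [mul_div_cancel_left₀ w two_ne_zero]

end QHT
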